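/- arXiv:0707.4349 — 5 statements merged into one kernel-verified Lean document; each statement's English description precedes it below -/
import Mathlib

section
/- (Leau–Fatou flower theorem.) For every sufficiently small neighborhood N ⊆ N₀ of 0 there exist n attracting petals P₀, …, P_{n−1} of f in N and n repelling petals P′₀, …, P′_{n−1} of f in N such that the set {0} ∪ P₀ ∪ ⋯ ∪ P_{n−1} ∪ P′₀ ∪ ⋯ ∪ P′_{n−1} is a neighborhood of 0. -/
open Filter Topology Asymptotics

/-- An attracting petal of `f` (with `f^q` the relevant iterate) in a neighborhood
`N` of `0`: a nonempty simply connected open set `P ⊆ N ∩ f^q(N)` with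
`f^q(P) ⊆ P`, `0 ∈ closure P`, `0 ∉ P`, on which the iterates of `f^q` converge
uniformly to `0`. -/
def IsAttractingPetal (f : ℂ → ℂ) (q : ℕ) (N P : Set ℂ) : Prop :=
  P.Nonempty ∧ IsOpen P ∧ SimplyConnectedSpace P ∧
  P ⊆ N ∩ (f^[q] '' N) ∧ f^[q] '' P ⊆ P ∧
  (0 : ℂ) ∈ closure P ∧ (0 : ℂ) ∉ P ∧
  TendstoUniformlyOn (fun (m : ℕ) (z : ℂ) => (f^[q])^[m] z) (fun _ => 0) atTop P

/-- A repelling petal of `f` in `N`: an attracting petal in `N` of a local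
holomorphic inverse of `f` at `0`. -/
def IsRepellingPetal (f : ℂ → ℂ) (q : ℕ) (N P : Set ℂ) : Prop :=
  ∃ g : ℂ → ℂ, g 0 = 0 ∧ (∃ W ∈ 𝓝 (0 : ℂ), DifferentiableOn ℂ g W) ∧
    (∀ᶠ z in 𝓝 (0 : ℂ), g (f z) = z) ∧ IsAttractingPetal g q N P

/-- The region to the right of the V-shaped boundary `re w + |im w| = R`. -/
def vSector (R : ℝ) : Set ℂ := {w | R < w.re + |w.im|}

theorem isOpen_vSector (R : ℝ) : IsOpen (vSector R) :=
  isOpen_lt continuous_const (by fun_prop)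

theorem vSector_anti {R S : ℝ} (h : R ≤ S) : vSector S ⊆ vSector R :=
  fun _ hw => lt_of_le_of_lt h hw

theorem ofReal_mem_vSector {R x : ℝ} (h : R < x) : (x : ℂ) ∈ vSector R := by
  simpa [vSector] using h

theorem vSector_subset_slitPlane {R : ℝ} (hR : 0 ≤ R) : vSector R ⊆ Complex.slitPlane := by
  intro w hw
  rw [Complex.mem_slitPlane_iff]
  by_contra! h
  have hw' : R < w.re + |w.im| := hw
  rw [h.2, abs_zero] at hw'
  linarith [h.1]

theorem starConvex_vSector {R x : ℝ} (h : R < x) : StarConvex ℝ (x : ℂ) (vSector R) := by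
  rw [starConvex_iff_forall_pos (ofReal_mem_vSector h)]
  intro w hw s t hs ht hst
  have hw' : R < w.re + |w.im| := hw
  simp only [vSector, Set.mem_ofPred_eq, Complex.add_re, Complex.add_im, Complex.smul_re,
    Complex.smul_im, Complex.ofReal_re, Complex.ofReal_im, smul_eq_mul, mul_zero, zero_add,
    abs_mul, abs_of_pos ht]
  have h1 : R = s * R + t * R := by rw [← add_mul, hst, one_mul]
  nlinarith [mul_lt_mul_of_pos_left h hs, mul_lt_mul_of_pos_left hw' ht]

theorem lt_two_mul_norm_of_mem_vSector {R : ℝ} {w : ℂ} (hw : w ∈ vSector R) : R < 2 * ‖w‖ := by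
  have hw' : R < w.re + |w.im| := hw
  linarith [Complex.re_le_norm w, Complex.abs_im_le_norm w]

theorem abs_arg_lt_of_mem_vSector {R : ℝ} (hR : 0 ≤ R) {w : ℂ} (hw : w ∈ vSector R) :
    |w.arg| < 3 * Real.pi / 4 := by
  by_contra! h
  have hw' : R < w.re + |w.im| := hw
  have hpi := Complex.abs_arg_le_pi w
  have hs : |Real.sin w.arg| = Real.sin (Real.pi - |w.arg|) := by
    rw [Real.sin_pi_sub, Real.abs_sin_eq_sin_abs_of_abs_le_pi hpi]
  have hc : Real.cos w.arg = -Real.sin (Real.pi / 2 - (Real.pi - |w.arg|)) := by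
    rw [Real.sin_pi_div_two_sub, Real.cos_pi_sub, Real.cos_abs, neg_neg]
  have hm : Real.sin (Real.pi - |w.arg|) ≤ Real.sin (Real.pi / 2 - (Real.pi - |w.arg|)) :=
    Real.sin_le_sin_of_le_of_le_pi_div_two (by linarith) (by linarith) (by linarith)
  rw [← Complex.norm_mul_cos_arg w, ← Complex.norm_mul_sin_arg w, abs_mul, abs_norm, hs, hc] at hw'
  nlinarith [norm_nonneg w]

theorem add_mem_vSector {R : ℝ} {w d : ℂ} (hw : w ∈ vSector R) (hd : ‖d - 1‖ < 1 / 4) :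
    w + d ∈ vSector (R + 1 / 2) := by
  have hw' : R < w.re + |w.im| := hw
  have h1 := (Complex.abs_re_le_norm (d - 1)).trans_lt hd
  have h2 := (Complex.abs_im_le_norm (d - 1)).trans_lt hd
  simp only [Complex.sub_re, Complex.one_re, Complex.sub_im, Complex.one_im, sub_zero] at h1 h2
  have h3 : |w.im| - |d.im| ≤ |w.im + d.im| := by
    simpa using abs_sub_abs_le_abs_sub w.im (-d.im)
  simp only [vSector, Set.mem_ofPred_eq, Complex.add_re, Complex.add_im]
  linarith [(abs_lt.1 h1).1]

/-- The branch of `w ↦ c * w ^ (-1 / n)` given by the principal logarithm. -/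
noncomputable def petalMap (n : ℕ) (c w : ℂ) : ℂ := c * Complex.exp (-Complex.log w / n)

/-- The image of a V-shaped sector under `petalMap`. -/
def petal (n : ℕ) (c : ℂ) (R : ℝ) : Set ℂ := petalMap n c '' vSector R

theorem petal_anti (n : ℕ) (c : ℂ) {R S : ℝ} (h : R ≤ S) : petal n c S ⊆ petal n c R :=
  Set.image_mono (vSector_anti h)

theorem petalMap_ne_zero (n : ℕ) {c : ℂ} (hc : c ≠ 0) (w : ℂ) : petalMap n c w ≠ 0 :=
  mul_ne_zero hc (Complex.exp_ne_zero _)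

theorem petalMap_pow {n : ℕ} (hn : n ≠ 0) (c : ℂ) {w : ℂ} (hw : w ≠ 0) :
    petalMap n c w ^ n = c ^ n / w := by
  have hn' : (n : ℂ) ≠ 0 := Nat.cast_ne_zero.2 hn
  rw [petalMap, mul_pow, ← Complex.exp_nat_mul, mul_div_cancel₀ _ hn', Complex.exp_neg,
    Complex.exp_log hw, div_eq_mul_inv]

theorem div_petalMap_pow {n : ℕ} (hn : n ≠ 0) {c : ℂ} (hc : c ≠ 0) {w : ℂ} (hw : w ≠ 0) :
    (c / petalMap n c w) ^ n = w := by
  rw [div_pow, petalMap_pow hn c hw, div_div_cancel₀ (pow_ne_zero n hc)]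

theorem hasStrictDerivAt_petalMap (n : ℕ) (c : ℂ) {w : ℂ} (hw : w ∈ Complex.slitPlane) :
    HasStrictDerivAt (petalMap n c)
      (c * (Complex.exp (-Complex.log w / n) * (-w⁻¹ / n))) w :=
  ((((Complex.hasStrictDerivAt_log hw).neg).div_const (n : ℂ)).cexp).const_mul c

theorem isOpen_petal {n : ℕ} (hn : n ≠ 0) {c : ℂ} (hc : c ≠ 0) {R : ℝ} (hR : 0 ≤ R) :
    IsOpen (petal n c R) := by
  rw [isOpen_iff_mem_nhds]
  rintro _ ⟨w, hw, rfl⟩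
  have hs := vSector_subset_slitPlane hR hw
  have hw0 := Complex.slitPlane_ne_zero hs
  rw [← (hasStrictDerivAt_petalMap n c hs).map_nhds_eq (by
    simp [hc, hw0, hn, Complex.exp_ne_zero])]
  exact image_mem_map ((isOpen_vSector R).mem_nhds hw)

theorem simplyConnectedSpace_petal {n : ℕ} (hn : n ≠ 0) {c : ℂ} (hc : c ≠ 0) {R : ℝ}
    (hR : 0 ≤ R) : SimplyConnectedSpace (petal n c R) := by
  have hinv : ∀ w ∈ vSector R, (c / petalMap n c w) ^ n = w := fun w hw =>
    div_petalMap_pow hn hc (Complex.slitPlane_ne_zero (vSector_subset_slitPlane hR hw))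
  let e : petal n c R ≃ₜ vSector R :=
    { toFun := fun z => ⟨(c / (z : ℂ)) ^ n, by
        obtain ⟨_, w, hw, rfl⟩ := z
        simpa only [hinv w hw] using hw⟩
      invFun := fun w => ⟨petalMap n c w, w, w.2, rfl⟩
      left_inv := by
        rintro ⟨_, w, hw, rfl⟩
        simp only [hinv w hw]
      right_inv := fun w => Subtype.ext (hinv w w.2)
      continuous_toFun := by
        refine Continuous.subtype_mk ((continuous_const.div continuous_subtype_val ?_).pow n) _
        rintro ⟨_, w, hw, rfl⟩
        exact petalMap_ne_zero n hc w
      continuous_invFun := by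
        refine Continuous.subtype_mk (continuous_iff_continuousAt.2 fun w => ?_) _
        exact ContinuousAt.comp (g := petalMap n c)
          (hasStrictDerivAt_petalMap n c (vSector_subset_slitPlane hR w.2)).hasDerivAt.continuousAt
          continuous_subtype_val.continuousAt }
  have : ContractibleSpace (vSector R) :=
    (starConvex_vSector (lt_add_one R)).contractibleSpace ⟨_, ofReal_mem_vSector (lt_add_one R)⟩
  have : ContractibleSpace (petal n c R) := e.contractibleSpace
  exact SimplyConnectedSpace.ofContractible _

theorem exists_petal_subset {n : ℕ} (hn : n ≠ 0) (b : ℂ) {U : Set ℂ} (hU : U ∈ 𝓝 (0 : ℂ)) :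
    ∃ R₀ : ℝ, 0 < R₀ ∧ ∀ R ≥ R₀, ∀ c : ℂ, c ^ n = b → petal n c R ⊆ U := by
  obtain ⟨ε, hε, hU⟩ := Metric.mem_nhds_iff.1 hU
  refine ⟨2 * (‖b‖ / ε ^ n) + 1, by positivity, fun R hR c hc => ?_⟩
  rintro _ ⟨w, hw, rfl⟩
  apply hU
  have hlt := lt_two_mul_norm_of_mem_vSector hw
  have hw1 : ‖b‖ / ε ^ n < ‖w‖ := by linarith
  have hw0 : 0 < ‖w‖ := lt_of_le_of_lt (by positivity) hw1
  rw [mem_ball_zero_iff]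
  refine lt_of_pow_lt_pow_left₀ n hε.le ?_
  rw [← norm_pow, petalMap_pow hn c (norm_pos_iff.1 hw0), hc, norm_div, div_lt_iff₀ hw0]
  rwa [div_lt_iff₀' (by positivity)] at hw1

theorem disjoint_petal {n : ℕ} {b c d : ℂ} (hn : n ≠ 0) (hb : b ≠ 0) (hc : c ^ n = b)
    (hd : d ^ n = b) (hcd : c ≠ d) {R : ℝ} (hR : 0 ≤ R) :
    Disjoint (petal n c R) (petal n d R) := by
  rw [Set.disjoint_left]
  rintro _ ⟨w, hw, rfl⟩ ⟨v, hv, hvw⟩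
  have hw0 := Complex.slitPlane_ne_zero (vSector_subset_slitPlane hR hw)
  have hv0 := Complex.slitPlane_ne_zero (vSector_subset_slitPlane hR hv)
  have h : b / v = b / w := by
    rw [← hc, ← petalMap_pow hn c hw0, ← hvw, petalMap_pow hn d hv0, hc, hd]
  have : v = w := by
    field_simp at h
    exact h.symm
  subst this
  exact hcd (mul_right_cancel₀ (Complex.exp_ne_zero _) hvw).symm

theorem exists_mem_petal {n : ℕ} (hn : n ≠ 0) {b z : ℂ} (hz : z ≠ 0) {R : ℝ}
    (hb : b / z ^ n ∈ vSector R) (hR : 0 ≤ R) : ∃ c, c ^ n = b ∧ z ∈ petal n c R := by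
  have hw0 := Complex.slitPlane_ne_zero (vSector_subset_slitPlane hR hb)
  have hzn := pow_ne_zero n hz
  have he := petalMap_ne_zero n one_ne_zero (b / z ^ n)
  refine ⟨z / petalMap n 1 (b / z ^ n), ?_, b / z ^ n, hb, ?_⟩
  · rw [div_pow, petalMap_pow hn 1 hw0]
    field_simp
    simp
  · simp only [petalMap, one_mul] at he ⊢
    exact div_mul_cancel₀ z he

/-- In the coordinate `w = -1 / (n a z ^ n)`, a germ tangent to the identity is asymptotic to the
translation `w ↦ w + 1`. -/
theorem eventually_exists_log_step {F : ℂ → ℂ} {n : ℕ} (hn : n ≠ 0) {a : ℂ} (ha : a ≠ 0)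
    (hexp : (fun z : ℂ => F z - z * (1 + a * z ^ n)) =o[𝓝 (0 : ℂ)] fun z : ℂ => z ^ (n + 1)) :
    ∀ᶠ z in 𝓝[≠] (0 : ℂ), ∃ l : ℂ, F z = z * Complex.exp (-l / n) ∧ |l.im| < Real.pi / 4 ∧
      ‖-1 / (n * a) / z ^ n * (Complex.exp l - 1) - 1‖ < 1 / 4 := by
  have hn' : (n : ℂ) ≠ 0 := Nat.cast_ne_zero.2 hn
  have hne : ∀ᶠ z in 𝓝[≠] (0 : ℂ), z ≠ 0 := self_mem_nhdsWithin
  have h1 : Tendsto (fun z => (F z / z - 1) / z ^ n) (𝓝[≠] 0) (𝓝 a) := by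
    have := (hexp.mono nhdsWithin_le_nhds).tendsto_div_nhds_zero (l := 𝓝[≠] (0 : ℂ))
    have := this.const_add a
    rw [add_zero] at this
    refine this.congr' ?_
    filter_upwards [hne] with z hz
    field_simp
    ring
  have hpow : Tendsto (fun z : ℂ => z ^ n) (𝓝[≠] 0) (𝓝 0) := by
    have : Tendsto (fun z : ℂ => z ^ n) (𝓝 0) (𝓝 (0 ^ n)) := (continuous_pow n).tendsto 0
    rw [zero_pow hn] at this
    exact this.mono_left nhdsWithin_le_nhds
  have h2 : Tendsto (fun z => F z / z) (𝓝[≠] 0) (𝓝 1) := by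
    have := (h1.mul hpow).add_const 1
    rw [mul_zero, zero_add] at this
    refine this.congr' ?_
    filter_upwards [hne] with z hz
    field_simp
    ring
  have hlog : Tendsto (fun z => -n * Complex.log (F z / z)) (𝓝[≠] 0) (𝓝 0) := by
    have : Tendsto (fun z => -n * Complex.log (F z / z)) (𝓝[≠] 0) (𝓝 (-n * Complex.log 1)) :=
      ((continuousAt_clog Complex.one_mem_slitPlane).tendsto.comp h2).const_mul _
    simpa using this
  have hder : HasDerivAt (fun u : ℂ => (u ^ n)⁻¹) (-n) 1 :=
    ((hasDerivAt_pow n (1 : ℂ)).fun_inv (by simp)).congr_deriv (by simp)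
  have hslope : Tendsto (fun z => dslope (fun u : ℂ => (u ^ n)⁻¹) 1 (F z / z)) (𝓝[≠] 0)
      (𝓝 (-n)) := by
    have := (continuousAt_dslope_same.2 hder.differentiableAt).tendsto.comp h2
    rwa [dslope_same, hder.deriv] at this
  have hmain : Tendsto (fun z => -1 / (n * a) / z ^ n * (((F z / z) ^ n)⁻¹ - 1)) (𝓝[≠] 0)
      (𝓝 1) := by
    have := (h1.mul hslope).const_mul (-1 / (n * a))
    have h3 : -1 / (n * a) * (a * -n) = 1 := by field_simp
    rw [h3] at this
    refine this.congr fun z => ?_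
    have h4 := sub_smul_dslope (fun u : ℂ => (u ^ n)⁻¹) 1 (F z / z)
    simp only [smul_eq_mul, one_pow, inv_one] at h4
    rw [← h4]
    ring
  have him : Tendsto (fun z => |(-n * Complex.log (F z / z)).im|) (𝓝[≠] 0) (𝓝 0) := by
    simpa using ((Complex.continuous_im.tendsto 0).comp hlog).abs
  filter_upwards [hne, h2.eventually_ne one_ne_zero,
    him.eventually_lt_const (by positivity : (0 : ℝ) < Real.pi / 4),
    Metric.tendsto_nhds.1 hmain (1 / 4) (by norm_num)] with z hz hF hlt hd
  refine ⟨_, ?_, hlt, ?_⟩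
  · rw [neg_mul, neg_neg, mul_div_cancel_left₀ _ hn', Complex.exp_log hF, mul_div_cancel₀ _ hz]
  · rwa [neg_mul, Complex.exp_neg, Complex.exp_nat_mul, Complex.exp_log hF, ← dist_eq_norm]

theorem exists_mapsTo_petal {F : ℂ → ℂ} {n : ℕ} (hn : n ≠ 0) {a : ℂ} (ha : a ≠ 0)
    (hexp : (fun z : ℂ => F z - z * (1 + a * z ^ n)) =o[𝓝 (0 : ℂ)] fun z : ℂ => z ^ (n + 1)) :
    ∃ R₀ : ℝ, 0 < R₀ ∧ ∀ R ≥ R₀, ∀ c : ℂ, c ^ n = -1 / (n * a) →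
      Set.MapsTo F (petal n c R) (petal n c (R + 1 / 2)) := by
  have hn' : (n : ℂ) ≠ 0 := Nat.cast_ne_zero.2 hn
  obtain ⟨R₀, hR₀, hsub⟩ := exists_petal_subset hn (-1 / (n * a))
    (eventually_nhdsWithin_iff.1 (eventually_exists_log_step hn ha hexp))
  refine ⟨R₀, hR₀, fun R hR c hc => ?_⟩
  have hR0 : 0 ≤ R := hR₀.le.trans hR
  have hc0 : c ≠ 0 := by
    rintro rfl
    rw [zero_pow hn] at hc
    exact div_ne_zero (neg_ne_zero.2 one_ne_zero) (mul_ne_zero hn' ha) hc.symm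
  rintro _ ⟨w, hw, rfl⟩
  obtain ⟨l, hF, him, hd⟩ := hsub R hR c hc ⟨w, hw, rfl⟩ (petalMap_ne_zero n hc0 w)
  have hw0 := Complex.slitPlane_ne_zero (vSector_subset_slitPlane hR0 hw)
  rw [petalMap_pow hn c hw0, hc, div_div_cancel₀ (by simp [hn, ha])] at hd
  have hexp' : Complex.exp (Complex.log w + l) = w + w * (Complex.exp l - 1) := by
    rw [Complex.exp_add, Complex.exp_log hw0]
    ring
  have harg := abs_lt.1 (abs_arg_lt_of_mem_vSector hR0 hw)
  have him' := abs_lt.1 him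
  refine ⟨w + w * (Complex.exp l - 1), add_mem_vSector hw hd, ?_⟩
  rw [hF, ← hexp', petalMap, Complex.log_exp, petalMap, mul_assoc, ← Complex.exp_add]
  · congr 2
    ring
  · rw [Complex.add_im, Complex.log_im]
    linarith
  · rw [Complex.add_im, Complex.log_im]
    linarith

theorem exists_isAttractingPetal_petal {f : ℂ → ℂ} {q : ℕ} {n : ℕ} (hn : n ≠ 0) {a : ℂ}
    (ha : a ≠ 0)
    (hexp : (fun z : ℂ => f^[q] z - z * (1 + a * z ^ n)) =o[𝓝 (0 : ℂ)]
      fun z : ℂ => z ^ (n + 1))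
    {N : Set ℂ} (hN : N ∈ 𝓝 (0 : ℂ)) (hfN : f^[q] '' N ∈ 𝓝 (0 : ℂ)) :
    ∃ R : ℝ, 0 < R ∧ ∀ c : ℂ, c ^ n = -1 / (n * a) → IsAttractingPetal f q N (petal n c R) := by
  have hn' : (n : ℂ) ≠ 0 := Nat.cast_ne_zero.2 hn
  obtain ⟨R₁, hR₁, hmaps⟩ := exists_mapsTo_petal hn ha hexp
  obtain ⟨R₂, hR₂, hsub⟩ := exists_petal_subset hn (-1 / (n * a)) (inter_mem hN hfN)
  refine ⟨max R₁ R₂, lt_max_of_lt_left hR₁, fun c hc => ?_⟩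
  set R := max R₁ R₂
  have hR1 : R₁ ≤ R := le_max_left _ _
  have hR0 : 0 ≤ R := hR₁.le.trans hR1
  have hc0 : c ≠ 0 := by
    rintro rfl
    rw [zero_pow hn] at hc
    exact div_ne_zero (neg_ne_zero.2 one_ne_zero) (mul_ne_zero hn' ha) hc.symm
  have hmapsR : Set.MapsTo f^[q] (petal n c R) (petal n c R) :=
    (hmaps R hR1 c hc).mono_right (petal_anti n c (by linarith))
  have hiter : ∀ m : ℕ, Set.MapsTo (f^[q])^[m] (petal n c R) (petal n c (R + m / 2)) := by
    intro m
    induction m with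
    | zero => simpa using Set.mapsTo_id _
    | succ m ih =>
      rw [Function.iterate_succ']
      have hm : (0 : ℝ) ≤ m / 2 := by positivity
      have := (hmaps (R + m / 2) (by linarith) c hc).comp ih
      convert this using 2
      push_cast
      ring
  have hunif : TendstoUniformlyOn (fun (m : ℕ) (z : ℂ) => (f^[q])^[m] z) (fun _ => 0) atTop
      (petal n c R) := by
    rw [Metric.tendstoUniformlyOn_iff]
    intro ε hε
    obtain ⟨S, -, hS⟩ := exists_petal_subset hn (-1 / (n * a)) (Metric.ball_mem_nhds (0 : ℂ) hε)
    filter_upwards [eventually_ge_atTop ⌈2 * S⌉₊] with m hm z hz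
    have hm' : 2 * S ≤ m := Nat.ceil_le.1 hm
    have := hS (R + m / 2) (by linarith) c hc (hiter m hz)
    rwa [Metric.mem_ball'] at this
  have hne : (petal n c R).Nonempty := ⟨_, _, ofReal_mem_vSector (lt_add_one R), rfl⟩
  refine ⟨hne, isOpen_petal hn hc0 hR0, simplyConnectedSpace_petal hn hc0 hR0,
    hsub R (le_max_right _ _) c hc, hmapsR.image_subset, ?_, ?_, hunif⟩
  · obtain ⟨z, hz⟩ := hne
    exact mem_closure_of_tendsto (hunif.tendsto_at hz)
      (Eventually.of_forall fun m => hmapsR.iterate m hz)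
  · rintro ⟨w, -, hw⟩
    exact petalMap_ne_zero n hc0 w hw

theorem exists_roots_of_pow_eq {n : ℕ} (hn : n ≠ 0) {b : ℂ} (hb : b ≠ 0) :
    ∃ c : Fin n → ℂ, Function.Injective c ∧ ∀ z, z ^ n = b ↔ ∃ i, c i = z := by
  have : NeZero n := ⟨hn⟩
  obtain ⟨d, hd⟩ := IsAlgClosed.exists_pow_nat_eq b (Nat.pos_of_ne_zero hn)
  have hd0 : d ≠ 0 := by
    rintro rfl
    exact hb (by rw [← hd, zero_pow hn])
  have hζ := Complex.isPrimitiveRoot_exp n hn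
  refine ⟨fun i => d * Complex.exp (2 * Real.pi * Complex.I / n) ^ (i : ℕ), fun i j hij =>
    Fin.ext (hζ.pow_inj i.2 j.2 (mul_left_cancel₀ hd0 hij)), fun z => ⟨fun hz => ?_, ?_⟩⟩
  · obtain ⟨i, hi, h⟩ := hζ.eq_pow_of_pow_eq_one (ξ := z / d) (by
      rw [div_pow, hz, hd, div_self hb])
    exact ⟨⟨i, hi⟩, by simp only [h, mul_div_cancel₀ _ hd0]⟩
  · rintro ⟨i, rfl⟩
    rw [mul_pow, hd, pow_right_comm, hζ.pow_eq_one, one_pow, mul_one]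

theorem exists_attracting_petals {f : ℂ → ℂ} {q : ℕ} {n : ℕ} (hn : n ≠ 0) {a : ℂ} (ha : a ≠ 0)
    (hexp : (fun z : ℂ => f^[q] z - z * (1 + a * z ^ n)) =o[𝓝 (0 : ℂ)]
      fun z : ℂ => z ^ (n + 1))
    {N : Set ℂ} (hN : N ∈ 𝓝 (0 : ℂ)) (hfN : f^[q] '' N ∈ 𝓝 (0 : ℂ)) :
    ∃ R : ℝ, 0 < R ∧ ∃ P : Fin n → Set ℂ, (∀ i, IsAttractingPetal f q N (P i)) ∧
      Function.Injective P ∧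
      ∀ z : ℂ, z ≠ 0 → -1 / (n * a) / z ^ n ∈ vSector R → z ∈ ⋃ i, P i := by
  have hb : -1 / (n * a) ≠ 0 := by simp [hn, ha]
  obtain ⟨R, hR, hP⟩ := exists_isAttractingPetal_petal hn ha hexp hN hfN
  obtain ⟨c, hcinj, hc⟩ := exists_roots_of_pow_eq hn hb
  have hc' : ∀ i, c i ^ n = -1 / (n * a) := fun i => (hc _).2 ⟨i, rfl⟩
  refine ⟨R, hR, fun i => petal n (c i) R, fun i => hP _ (hc' i), fun i j hij => ?_,
    fun z hz hw => ?_⟩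
  · by_contra h
    have hdisj := disjoint_petal hn hb (hc' i) (hc' j) (hcinj.ne h) hR.le
    simp only at hij
    rw [← hij, disjoint_self, Set.bot_eq_empty] at hdisj
    exact (hP _ (hc' i)).1.ne_empty hdisj
  · obtain ⟨d, hd, hz⟩ := exists_mem_petal hn hz hw hR.le
    obtain ⟨i, rfl⟩ := (hc d).1 hd
    exact Set.mem_iUnion.2 ⟨i, hz⟩

theorem eventually_iterate_leftInverse {X : Type*} [TopologicalSpace X] {f g : X → X} {x : X}
    (hf : Tendsto f (𝓝 x) (𝓝 x)) (h : ∀ᶠ z in 𝓝 x, g (f z) = z) (q : ℕ) :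
    ∀ᶠ z in 𝓝 x, g^[q] (f^[q] z) = z := by
  induction q with
  | zero => simp
  | succ q ih =>
    filter_upwards [ih, (hf.iterate q).eventually h] with z h1 h2
    rw [Function.iterate_succ_apply, Function.iterate_succ_apply', h2, h1]

theorem map_iterate_eq {X : Type*} {f : X → X} {l : Filter X} (h : map f l = l) (q : ℕ) :
    map f^[q] l = l := by
  induction q with
  | zero => simp
  | succ q ih => rw [Function.iterate_succ, ← map_map, h, ih]

theorem isLittleO_inverse_expansion {F G : ℂ → ℂ} (hF : map F (𝓝 0) = 𝓝 0)
    (hGF : ∀ᶠ z in 𝓝 0, G (F z) = z) {n : ℕ} (hn : n ≠ 0) {a : ℂ}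
    (hexp : (fun z : ℂ => F z - z * (1 + a * z ^ n)) =o[𝓝 (0 : ℂ)] fun z : ℂ => z ^ (n + 1)) :
    (fun z : ℂ => G z - z * (1 + -a * z ^ n)) =o[𝓝 (0 : ℂ)] fun z : ℂ => z ^ (n + 1) := by
  have hpow : (fun z : ℂ => z ^ (n + 1)) =o[𝓝 (0 : ℂ)] fun z : ℂ => z := by
    simpa using isLittleO_pow_pow (𝕜 := ℂ) (show 1 < n + 1 by omega)
  have hequiv : F ~[𝓝 0] fun z => z := by
    have h := (hexp.trans hpow).add (hpow.const_mul_left a)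
    refine h.congr_left fun z => ?_
    simp only [Pi.sub_apply]
    ring
  have hequiv' := hequiv.pow (n + 1)
  have h : (fun z : ℂ => a * (F z ^ (n + 1) - z ^ (n + 1)) - (F z - z * (1 + a * z ^ n)))
      =o[𝓝 (0 : ℂ)] fun z : ℂ => z ^ (n + 1) :=
    (IsLittleO.const_mul_left hequiv' a).sub hexp
  rw [← hF, isLittleO_map]
  refine (h.trans_isBigO hequiv'.isBigO_symm).congr' ?_ (EventuallyEq.refl _ _)
  filter_upwards [hGF] with z hz
  simp only [Function.comp_apply, hz]
  ring

/-- The Leau–Fatou flower theorem: for every sufficiently small neighborhood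
`N ⊆ N₀` of `0` there are `n` attracting petals and `n` repelling petals of `f`
in `N` whose union, together with `0`, is a neighborhood of `0`. -/
theorem leau_fatou_flower (f : ℂ → ℂ) (N₀ : Set ℂ) (hN₀ : N₀ ∈ 𝓝 (0 : ℂ))
    (hf : DifferentiableOn ℂ f N₀) (hfinj : Set.InjOn f N₀) (hf0 : f 0 = 0)
    (p : ℤ) (q : ℕ) (hq : 0 < q) (hpq : IsCoprime p (q : ℤ))
    (hder : deriv f 0 = Complex.exp (2 * Real.pi * Complex.I * p / q))
    (n : ℕ) (hn : 1 ≤ n) (a : ℂ) (ha : a ≠ 0)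
    (hexp : (fun z : ℂ => f^[q] z - z * (1 + a * z ^ n)) =o[𝓝 (0 : ℂ)]
      fun z : ℂ => z ^ (n + 1)) :
    ∃ N₁ ∈ 𝓝 (0 : ℂ), N₁ ⊆ N₀ ∧
      ∀ N ∈ 𝓝 (0 : ℂ), N ⊆ N₁ →
        ∃ P P' : Fin n → Set ℂ,
          (∀ i, IsAttractingPetal f q N (P i)) ∧
          (∀ i, IsRepellingPetal f q N (P' i)) ∧
          Function.Injective P ∧ Function.Injective P' ∧
          insert (0 : ℂ) ((⋃ i, P i) ∪ ⋃ i, P' i) ∈ 𝓝 (0 : ℂ) := by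
  have hn0 : n ≠ 0 := by omega
  have hder0 : deriv f 0 ≠ 0 := hder ▸ Complex.exp_ne_zero _
  have han : AnalyticAt ℂ f 0 := hf.analyticAt hN₀
  have hst := han.hasStrictDerivAt
  have hmapf : map f (𝓝 0) = 𝓝 0 := by simpa only [hf0] using hst.map_nhds_eq hder0
  set g := hst.localInverse _ _ _ hder0 with hg
  have hgf : ∀ᶠ z in 𝓝 (0 : ℂ), g (f z) = z := hst.eventually_left_inverse hder0
  have hg0 : g 0 = 0 := by simpa only [hf0] using hgf.self_of_nhds
  have hgan : AnalyticAt ℂ g 0 := by simpa only [hf0] using han.analyticAt_localInverse hder0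
  have hmapg : map g (𝓝 0) = 𝓝 0 := by
    have := (hst.to_localInverse hder0).map_nhds_eq (inv_ne_zero hder0)
    rwa [hf0, ← hg, hg0] at this
  have hgf' := eventually_iterate_leftInverse hmapf.le hgf q
  have hexp' := isLittleO_inverse_expansion (map_iterate_eq hmapf q) hgf' hn0 hexp
  refine ⟨N₀, hN₀, subset_rfl, fun N hN _ => ?_⟩
  obtain ⟨R, hR, P, hP, hPinj, hPcov⟩ := exists_attracting_petals hn0 ha hexp hN
    (by simpa only [map_iterate_eq hmapf q] using image_mem_map (m := f^[q]) hN)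
  obtain ⟨R', hR', P', hP', hPinj', hPcov'⟩ := exists_attracting_petals hn0 (neg_ne_zero.2 ha)
    hexp' hN (by simpa only [map_iterate_eq hmapg q] using image_mem_map (m := g^[q]) hN)
  refine ⟨P, P', hP, fun i => ⟨g, hg0, ?_, hgf, hP' i⟩, hPinj, hPinj', ?_⟩
  · obtain ⟨W, hW, hgW⟩ := hgan.eventually_analyticAt.exists_mem
    exact ⟨W, hW, fun z hz => (hgW z hz).differentiableAt.differentiableWithinAt⟩
  have hlim : Tendsto (fun z : ℂ => ‖-1 / (n * a) / z ^ n‖) (𝓝[≠] 0) atTop := by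
    have hb : 0 < ‖-1 / (n * a)‖ := norm_pos_iff.2 (by simp [hn0, ha])
    have h := tendsto_norm_inv_nhdsNE_zero_atTop (α := ℂ)
    have h' := ((tendsto_pow_atTop hn0).comp h).const_mul_atTop hb
    refine h'.congr fun z => ?_
    simp [div_eq_mul_inv]
  have hev := eventually_nhdsWithin_iff.1 (hlim.eventually_gt_atTop (max R R'))
  filter_upwards [hev] with z hz
  rcases eq_or_ne z 0 with rfl | hz0
  · exact Set.mem_insert _ _
  refine Set.mem_insert_of_mem _ ?_
  set w := -1 / (n * a) / z ^ n with hw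
  have hw' : -1 / (n * -a) / z ^ n = -w := by
    rw [hw, mul_neg, div_neg, neg_div]
  have hle : ‖w‖ ≤ |w.re| + |w.im| := Complex.norm_le_abs_re_add_abs_im w
  have hlt : max R R' < ‖w‖ := hz hz0
  rcases le_total 0 w.re with h | h
  · refine Or.inl (hPcov z hz0 ?_)
    rw [abs_of_nonneg h] at hle
    exact (le_max_left R R').trans_lt (hlt.trans_le hle)
  · refine Or.inr (hPcov' z hz0 ?_)
    rw [abs_of_nonpos h] at hle
    rw [hw']
    simp only [vSector, Set.mem_ofPred_eq, Complex.neg_re, Complex.neg_im, abs_neg]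
    exact (le_max_right R R').trans_lt (hlt.trans_le hle)
end

section
/- (Fatou linearization on a petal.) There exist a real number τ, an attracting petal P of f in N₀, and a bijective holomorphic map φ : P → R_τ = {w ∈ ℂ : Re w > τ} such that φ(f^q(z)) = φ(z) + 1 for all z ∈ P. -/
open Filter Topology Asymptotics

/-- The closed region `R ≤ Re w + |Im w|`, the union of two half-planes. -/
def closedWedge (R : ℝ) : Set ℂ := {w | R ≤ w.re + |w.im|}

/-- The open region `R < Re w + |Im w|`, the union of two half-planes. -/
def openWedge (R : ℝ) : Set ℂ := {w | R < w.re + |w.im|}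

/-- The unit translation perturbed by `h`. -/
def perturbedShift (h : ℂ → ℂ) (w : ℂ) : ℂ := w + 1 + h w

/-- Smallness conditions on `h` on `closedWedge R` which make `perturbedShift h` conjugate to the
unit translation. -/
structure IsTamePerturbation (h : ℂ → ℂ) (R : ℝ) (δ : ℕ → ℝ) : Prop where
  nonneg : ∀ k, 0 ≤ δ k
  summable : Summable δ
  tsum_le : ∑' k, δ k ≤ 1 / 32
  norm_le : ∀ w ∈ closedWedge R, ‖h w‖ ≤ 1 / 4
  lipschitz : ∀ s : ℝ, |s| ≤ 1 → ∀ (k : ℕ) (u v : ℂ), R + k / 2 ≤ u.re + s * u.im →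
    R + k / 2 ≤ v.re + s * v.im → ‖h u - h v‖ ≤ δ k * ‖u - v‖
  differentiableOn : DifferentiableOn ℂ h (openWedge R)
  tendsto : Tendsto h (Bornology.cobounded ℂ) (𝓝 0)

/-- The solution of the Abel equation for `perturbedShift h` that fixes `R`. -/
noncomputable def abelSolution (h : ℂ → ℂ) (R : ℝ) (w : ℂ) : ℂ :=
  w + ∑' k, (h ((perturbedShift h)^[k] w) - h ((perturbedShift h)^[k] R))

lemma mem_closedWedge_of_le {R s : ℝ} (hs : |s| ≤ 1) {w : ℂ} (hw : R ≤ w.re + s * w.im) :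
    w ∈ closedWedge R := by
  have : s * w.im ≤ |w.im| := (le_abs_self _).trans
    (by rw [abs_mul]; exact mul_le_of_le_one_left (abs_nonneg _) hs)
  change R ≤ w.re + |w.im|
  linarith

lemma openWedge_subset_closedWedge (R : ℝ) : openWedge R ⊆ closedWedge R :=
  fun _ hw => (show R < _ from hw).le

lemma isOpen_openWedge (R : ℝ) : IsOpen (openWedge R) :=
  isOpen_lt continuous_const (Complex.continuous_re.add Complex.continuous_im.abs)

lemma ofReal_mem_closedWedge (R : ℝ) : (R : ℂ) ∈ closedWedge R := by
  simp [closedWedge]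

lemma exists_slope (w : ℂ) : ∃ s : ℝ, |s| ≤ 1 ∧ w.re + |w.im| = w.re + s * w.im := by
  rcases le_total 0 w.im with h | h
  · exact ⟨1, by simp, by rw [abs_of_nonneg h, one_mul]⟩
  · exact ⟨-1, by simp, by rw [abs_of_nonpos h]; ring⟩

lemma level_le_two_mul_norm {s : ℝ} (hs : |s| ≤ 1) (w : ℂ) : w.re + s * w.im ≤ 2 * ‖w‖ := by
  have h1 : s * w.im ≤ ‖w‖ := (le_abs_self _).trans
    (by rw [abs_mul]; exact (mul_le_of_le_one_left (abs_nonneg _) hs).trans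
          (Complex.abs_im_le_norm w))
  linarith [Complex.re_le_norm w]

lemma norm_sub_add_norm_sub_le {R : ℝ} {u v : ℂ} (hu : R ≤ u.re + u.im) (hu' : u.re - u.im ≤ R)
    (hv : R ≤ v.re - v.im) (hv' : v.re + v.im ≤ R) :
    ‖u - R‖ + ‖v - R‖ ≤ 2 * ‖u - v‖ := by
  have key : ‖u - R‖ ^ 2 + ‖v - R‖ ^ 2 ≤ ‖u - v‖ ^ 2 := by
    simp only [Complex.sq_norm, Complex.normSq_apply, Complex.sub_re, Complex.sub_im,
      Complex.ofReal_re, Complex.ofReal_im]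
    nlinarith [mul_nonneg (sub_nonneg.2 hu) (sub_nonneg.2 hv),
      mul_nonneg (sub_nonneg.2 hu') (sub_nonneg.2 hv'),
      mul_nonneg (sub_nonneg.2 hu) (sub_nonneg.2 hv'),
      mul_nonneg (sub_nonneg.2 hu') (sub_nonneg.2 hv)]
  refine abs_le_of_sq_le_sq' ?_ (by positivity) |>.2
  nlinarith [sq_nonneg (‖u - R‖ - ‖v - R‖), sq_nonneg ‖u - v‖]

namespace IsTamePerturbation

variable {h : ℂ → ℂ} {R : ℝ} {δ : ℕ → ℝ}

lemma level_le_perturbedShift (H : IsTamePerturbation h R δ) {s : ℝ} (hs : |s| ≤ 1) {w : ℂ}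
    (hw : R ≤ w.re + s * w.im) :
    w.re + s * w.im + 1 / 2 ≤ (perturbedShift h w).re + s * (perturbedShift h w).im := by
  have h4 := H.norm_le w (mem_closedWedge_of_le hs hw)
  have hre : -(1 / 4) ≤ (h w).re := by linarith [(abs_le.1 (Complex.abs_re_le_norm (h w))).1]
  have him : |s * (h w).im| ≤ 1 / 4 := by
    rw [abs_mul]
    calc |s| * |(h w).im| ≤ 1 * (1 / 4) :=
          mul_le_mul hs ((Complex.abs_im_le_norm _).trans h4) (abs_nonneg _) zero_le_one
      _ = 1 / 4 := one_mul _
  have him' := (abs_le.1 him).1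
  simp only [perturbedShift, Complex.add_re, Complex.add_im, Complex.one_re, Complex.one_im]
  nlinarith

lemma level_le_iterate (H : IsTamePerturbation h R δ) {s : ℝ} (hs : |s| ≤ 1) {w : ℂ}
    (hw : R ≤ w.re + s * w.im) (k : ℕ) :
    R + k / 2 ≤ ((perturbedShift h)^[k] w).re + s * ((perturbedShift h)^[k] w).im := by
  induction k with
  | zero => simpa using hw
  | succ k ih =>
    rw [Function.iterate_succ_apply']
    have hk : (0 : ℝ) ≤ k := k.cast_nonneg
    have := H.level_le_perturbedShift hs (by linarith : R ≤ _)
    push_cast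
    linarith

lemma le_norm_iterate (H : IsTamePerturbation h R δ) {w : ℂ} (hw : w ∈ closedWedge R) (k : ℕ) :
    (R + k / 2) / 2 ≤ ‖(perturbedShift h)^[k] w‖ := by
  obtain ⟨s, hs, hws⟩ := exists_slope w
  have h0 : R ≤ w.re + |w.im| := hw
  linarith [H.level_le_iterate hs (hws ▸ h0) k,
    level_le_two_mul_norm hs ((perturbedShift h)^[k] w)]

lemma sum_le (H : IsTamePerturbation h R δ) (k : ℕ) : ∑ j ∈ Finset.range k, δ j ≤ 1 / 32 :=
  (H.summable.sum_le_tsum _ fun j _ => H.nonneg j).trans H.tsum_le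

lemma norm_iterate_sub_le (H : IsTamePerturbation h R δ) {s : ℝ} (hs : |s| ≤ 1) {u v : ℂ}
    (hu : R ≤ u.re + s * u.im) (hv : R ≤ v.re + s * v.im) (k : ℕ) :
    ‖(perturbedShift h)^[k] u - (perturbedShift h)^[k] v - (u - v)‖ ≤
      2 * (∑ j ∈ Finset.range k, δ j) * ‖u - v‖ := by
  induction k with
  | zero => simp
  | succ k ih =>
    have hlip := H.lipschitz s hs k _ _ (H.level_le_iterate hs hu k) (H.level_le_iterate hs hv k)
    rw [Function.iterate_succ_apply', Function.iterate_succ_apply', Finset.sum_range_succ]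
    set a := (perturbedShift h)^[k] u
    set b := (perturbedShift h)^[k] v
    have hab : ‖a - b‖ ≤ 2 * ‖u - v‖ := by
      have h1 : ‖a - b‖ ≤ ‖a - b - (u - v)‖ + ‖u - v‖ := by
        simpa using norm_add_le (a - b - (u - v)) (u - v)
      nlinarith [H.sum_le k, norm_nonneg (u - v)]
    have hsplit : perturbedShift h a - perturbedShift h b - (u - v) =
        (a - b - (u - v)) + (h a - h b) := by
      simp only [perturbedShift]; ring
    rw [hsplit]
    refine (norm_add_le _ _).trans ?_
    nlinarith [mul_le_mul_of_nonneg_left hab (H.nonneg k)]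

lemma norm_term_le (H : IsTamePerturbation h R δ) {s : ℝ} (hs : |s| ≤ 1) {u v : ℂ}
    (hu : R ≤ u.re + s * u.im) (hv : R ≤ v.re + s * v.im) (k : ℕ) :
    ‖h ((perturbedShift h)^[k] u) - h ((perturbedShift h)^[k] v)‖ ≤ δ k * (2 * ‖u - v‖) := by
  refine (H.lipschitz s hs k _ _ (H.level_le_iterate hs hu k) (H.level_le_iterate hs hv k)).trans
    (mul_le_mul_of_nonneg_left ?_ (H.nonneg k))
  have h1 := H.norm_iterate_sub_le hs hu hv k
  have h2 := norm_add_le ((perturbedShift h)^[k] u - (perturbedShift h)^[k] v - (u - v)) (u - v)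
  rw [sub_add_cancel] at h2
  nlinarith [H.sum_le k, norm_nonneg (u - v)]

lemma norm_term_base_le (H : IsTamePerturbation h R δ) {w : ℂ} (hw : w ∈ closedWedge R) (k : ℕ) :
    ‖h ((perturbedShift h)^[k] w) - h ((perturbedShift h)^[k] R)‖ ≤ δ k * (2 * ‖w - R‖) := by
  obtain ⟨s, hs, hws⟩ := exists_slope w
  exact H.norm_term_le hs (hws ▸ hw) (by simp) k

lemma summable_term (H : IsTamePerturbation h R δ) {w : ℂ} (hw : w ∈ closedWedge R) :
    Summable fun k => h ((perturbedShift h)^[k] w) - h ((perturbedShift h)^[k] R) :=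
  .of_norm_bounded (H.summable.mul_right _) (H.norm_term_base_le hw)

lemma abelSolution_base : abelSolution h R R = R := by simp [abelSolution]

lemma norm_abelSolution_sub_le_of_slope (H : IsTamePerturbation h R δ) {s : ℝ} (hs : |s| ≤ 1)
    {u v : ℂ} (hu : R ≤ u.re + s * u.im) (hv : R ≤ v.re + s * v.im) :
    ‖abelSolution h R u - abelSolution h R v - (u - v)‖ ≤ 1 / 16 * ‖u - v‖ := by
  have hsu := H.summable_term (mem_closedWedge_of_le hs hu)
  have hsv := H.summable_term (mem_closedWedge_of_le hs hv)
  have heq : abelSolution h R u - abelSolution h R v - (u - v) =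
      ∑' k, (h ((perturbedShift h)^[k] u) - h ((perturbedShift h)^[k] v)) := by
    have := hsu.tsum_sub hsv
    simp only [sub_sub_sub_cancel_right] at this
    rw [this, abelSolution, abelSolution]
    ring
  rw [heq]
  refine (tsum_of_norm_bounded (H.summable.mul_right _).hasSum (H.norm_term_le hs hu hv)).trans ?_
  rw [tsum_mul_right]
  nlinarith [H.tsum_le, norm_nonneg (u - v)]

lemma norm_abelSolution_sub_le (H : IsTamePerturbation h R δ) {u v : ℂ}
    (hu : u ∈ closedWedge R) (hv : v ∈ closedWedge R) :
    ‖abelSolution h R u - abelSolution h R v - (u - v)‖ ≤ 1 / 8 * ‖u - v‖ := by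
  have hpos := norm_nonneg (u - v)
  have detour : ‖u - R‖ + ‖v - R‖ ≤ 2 * ‖u - v‖ →
      ‖abelSolution h R u - abelSolution h R v - (u - v)‖ ≤ 1 / 8 * ‖u - v‖ := by
    intro hd
    have base : ∀ w ∈ closedWedge R,
        ‖abelSolution h R w - R - (w - R)‖ ≤ 1 / 16 * ‖w - R‖ := by
      intro w hw
      obtain ⟨s, hs, hws⟩ := exists_slope w
      simpa [abelSolution_base] using
        H.norm_abelSolution_sub_le_of_slope hs (hws ▸ hw) (v := R) (by simp)
    have := norm_sub_le (abelSolution h R u - R - (u - R)) (abelSolution h R v - R - (v - R))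
    rw [show abelSolution h R u - R - (u - R) - (abelSolution h R v - R - (v - R)) =
      abelSolution h R u - abelSolution h R v - (u - v) by ring] at this
    linarith [base u hu, base v hv]
  have slope : ∀ s : ℝ, |s| ≤ 1 → R ≤ u.re + s * u.im → R ≤ v.re + s * v.im →
      ‖abelSolution h R u - abelSolution h R v - (u - v)‖ ≤ 1 / 8 * ‖u - v‖ := by
    intro s hs h1 h2
    linarith [H.norm_abelSolution_sub_le_of_slope hs h1 h2]
  by_cases hp : R ≤ u.re + u.im ∧ R ≤ v.re + v.im
  · exact slope 1 (by simp) (by linarith) (by linarith)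
  by_cases hm : R ≤ u.re - u.im ∧ R ≤ v.re - v.im
  · exact slope (-1) (by simp) (by linarith) (by linarith)
  have hu' : R ≤ u.re + u.im ∨ R ≤ u.re - u.im := by
    rcases abs_choice u.im with h | h <;> simp only [closedWedge, Set.mem_ofPred_eq, h] at hu
    · exact .inl hu
    · exact .inr (by linarith)
  have hv' : R ≤ v.re + v.im ∨ R ≤ v.re - v.im := by
    rcases abs_choice v.im with h | h <;> simp only [closedWedge, Set.mem_ofPred_eq, h] at hv
    · exact .inl hv
    · exact .inr (by linarith)
  by_cases h1 : R ≤ u.re + u.im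
  · have h2 : v.re + v.im ≤ R := by by_contra! h; exact hp ⟨h1, h.le⟩
    by_cases h3 : R ≤ v.re - v.im
    · have h4 : u.re - u.im ≤ R := by by_contra! h; exact hm ⟨h.le, h3⟩
      exact detour (norm_sub_add_norm_sub_le h1 h4 h3 h2)
    · exact absurd (hv'.resolve_right h3) (fun h => hp ⟨h1, h⟩)
  · have h2 : R ≤ u.re - u.im := hu'.resolve_left h1
    have h3 : v.re - v.im ≤ R := by by_contra! h; exact hm ⟨h2, h.le⟩
    by_cases h4 : R ≤ v.re + v.im
    · refine detour ?_
      rw [add_comm, norm_sub_rev u v]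
      exact norm_sub_add_norm_sub_le h4 h3 h2 (not_le.1 h1).le
    · exact absurd (hv'.resolve_left h4) (fun h => hm ⟨h2, h⟩)

lemma injOn_abelSolution (H : IsTamePerturbation h R δ) :
    Set.InjOn (abelSolution h R) (closedWedge R) := by
  intro u hu v hv huv
  have := H.norm_abelSolution_sub_le hu hv
  rw [huv, sub_self, zero_sub, norm_neg] at this
  exact sub_eq_zero.1 (norm_eq_zero.1 (by linarith [norm_nonneg (u - v)]))

lemma norm_sub_le_two_mul (H : IsTamePerturbation h R δ) {u v : ℂ}
    (hu : u ∈ closedWedge R) (hv : v ∈ closedWedge R) :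
    ‖u - v‖ ≤ 2 * ‖abelSolution h R u - abelSolution h R v‖ := by
  have h1 := H.norm_abelSolution_sub_le hu hv
  have h2 := norm_sub_norm_le (u - v) (abelSolution h R u - abelSolution h R v)
  rw [norm_sub_rev] at h1
  linarith [norm_nonneg (u - v)]

lemma mapsTo_perturbedShift (H : IsTamePerturbation h R δ) :
    Set.MapsTo (perturbedShift h) (openWedge R) (openWedge R) := by
  intro w hw
  obtain ⟨s, hs, hws⟩ := exists_slope w
  have h0 : R ≤ w.re + |w.im| := openWedge_subset_closedWedge R hw
  have h1 := H.level_le_perturbedShift hs (hws ▸ h0)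
  have h2 : s * (perturbedShift h w).im ≤ |(perturbedShift h w).im| := (le_abs_self _).trans
    (by rw [abs_mul]; exact mul_le_of_le_one_left (abs_nonneg _) hs)
  have h3 : R < w.re + |w.im| := hw
  change R < (perturbedShift h w).re + |(perturbedShift h w).im|
  linarith

lemma differentiableOn_iterate (H : IsTamePerturbation h R δ) (k : ℕ) :
    DifferentiableOn ℂ ((perturbedShift h)^[k]) (openWedge R) := by
  induction k with
  | zero => exact differentiableOn_id
  | succ k ih =>
    rw [Function.iterate_succ]
    exact ih.comp ((differentiableOn_id.add_const _).add H.differentiableOn)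
      H.mapsTo_perturbedShift

lemma differentiableOn_abelSolution (H : IsTamePerturbation h R δ) :
    DifferentiableOn ℂ (abelSolution h R) (openWedge R) := by
  intro w hw
  have hopen : IsOpen (openWedge R ∩ Metric.ball (R : ℂ) (‖w - R‖ + 1)) :=
    (isOpen_openWedge R).inter Metric.isOpen_ball
  have hwmem : w ∈ openWedge R ∩ Metric.ball (R : ℂ) (‖w - R‖ + 1) :=
    ⟨hw, by simp [dist_eq_norm]⟩
  have hd : DifferentiableOn ℂ
      (fun w => ∑' k, (h ((perturbedShift h)^[k] w) - h ((perturbedShift h)^[k] R)))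
      (openWedge R ∩ Metric.ball (R : ℂ) (‖w - R‖ + 1)) := by
    refine Complex.differentiableOn_tsum_of_summable_norm
      (H.summable.mul_right (2 * (‖w - R‖ + 1))) (fun k => ?_) hopen fun k u hu => ?_
    · exact ((H.differentiableOn.comp (H.differentiableOn_iterate k)
        (H.mapsTo_perturbedShift.iterate k)).sub_const _).mono Set.inter_subset_left
    · have : ‖u - R‖ < ‖w - R‖ + 1 := by simpa [dist_eq_norm] using hu.2
      refine (H.norm_term_base_le (openWedge_subset_closedWedge R hu.1) k).trans ?_
      exact mul_le_mul_of_nonneg_left (by linarith) (H.nonneg k)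
  exact (differentiableAt_id.add
    (hd.differentiableAt (hopen.mem_nhds hwmem))).differentiableWithinAt

lemma abelSolution_perturbedShift (H : IsTamePerturbation h R δ) {w : ℂ} (hw : w ∈ openWedge R) :
    abelSolution h R (perturbedShift h w) = abelSolution h R w + 1 := by
  have hs := H.summable_term (openWedge_subset_closedWedge R hw)
  have hs' := H.summable_term (openWedge_subset_closedWedge R (H.mapsTo_perturbedShift hw))
  have hbase : Tendsto (fun k => h ((perturbedShift h)^[k] R)) atTop (𝓝 0) := by
    refine H.tendsto.comp (tendsto_norm_atTop_iff_cobounded.1 (tendsto_atTop_mono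
      (H.le_norm_iterate (ofReal_mem_closedWedge R)) ?_))
    exact (tendsto_atTop_add_const_left _ R
      (tendsto_natCast_atTop_atTop.atTop_div_const two_pos)).atTop_div_const two_pos
  have htend := hs'.hasSum.tendsto_sum_nat.sub hs.hasSum.tendsto_sum_nat
  have hz : Tendsto (fun k => h ((perturbedShift h)^[k] w)) atTop (𝓝 0) := by
    simpa using hs.tendsto_atTop_zero.add hbase
  have hsum : ∀ N, ∑ k ∈ Finset.range N,
        (h ((perturbedShift h)^[k] (perturbedShift h w)) - h ((perturbedShift h)^[k] R)) -
      ∑ k ∈ Finset.range N, (h ((perturbedShift h)^[k] w) - h ((perturbedShift h)^[k] R)) =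
      h ((perturbedShift h)^[N] w) - h w := by
    intro N
    rw [← Finset.sum_sub_distrib]
    simp only [sub_sub_sub_cancel_right, ← Function.iterate_succ_apply]
    exact Finset.sum_range_sub (fun k => h ((perturbedShift h)^[k] w)) N
  simp only [hsum] at htend
  have := tendsto_nhds_unique htend (hz.sub_const (h w))
  rw [abelSolution, abelSolution, ← sub_eq_zero, perturbedShift] at *
  linear_combination this

lemma exists_abelSolution_eq (H : IsTamePerturbation h R δ) {ζ : ℂ} (hζ : R < ζ.re) :
    ∃ w ∈ openWedge R, abelSolution h R w = ζ := by
  set r : ℝ := (ζ.re + |ζ.im| - R) / 2 with hr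
  have hrpos : 0 < r := by have := abs_nonneg ζ.im; rw [hr]; linarith
  have hball : Metric.closedBall ζ r ⊆ openWedge R := by
    intro w hw
    have hwr : ‖w - ζ‖ ^ 2 ≤ r ^ 2 := by
      rw [Metric.mem_closedBall, dist_eq_norm] at hw
      gcongr
    rw [Complex.sq_norm, Complex.normSq_apply, Complex.sub_re, Complex.sub_im] at hwr
    have h1 : |ζ.im| ≤ |w.im| + |w.im - ζ.im| := by
      have := abs_sub_abs_le_abs_sub ζ.im w.im
      rw [abs_sub_comm] at this
      linarith
    have h2 : ζ.re - w.re ≤ |w.re - ζ.re| := by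
      rw [abs_sub_comm]; exact le_abs_self _
    have h3 : |w.re - ζ.re| + |w.im - ζ.im| < 2 * r := by
      refine abs_lt_of_sq_lt_sq' ?_ (by positivity) |>.2
      nlinarith [sq_nonneg (|w.re - ζ.re| - |w.im - ζ.im|), sq_abs (w.re - ζ.re),
        sq_abs (w.im - ζ.im)]
    change R < w.re + |w.im|
    linarith
  have happ : ApproximatesLinearOn (abelSolution h R) (ContinuousLinearMap.id ℂ ℂ)
      (Metric.closedBall ζ r) (1 / 8) := by
    intro u hu v hv
    simpa using H.norm_abelSolution_sub_le (openWedge_subset_closedWedge R (hball hu))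
      (openWedge_subset_closedWedge R (hball hv))
  let inv : (ContinuousLinearMap.id ℂ ℂ).NonlinearRightInverse :=
    { toFun := id
      nnnorm := 1
      bound' := fun y => by simp
      right_inv' := fun y => by simp }
  have hsurj := happ.surjOn_closedBall_of_nonlinearRightInverse inv hrpos.le subset_rfl
  have hmem : ζ ∈ Metric.closedBall (abelSolution h R ζ) ((((inv.nnnorm : NNReal) : ℝ)⁻¹
      - ((1 / 8 : NNReal) : ℝ)) * r) := by
    have h1 := H.norm_abelSolution_sub_le (v := R) (openWedge_subset_closedWedge R
      (hball (Metric.mem_closedBall_self hrpos.le))) (ofReal_mem_closedWedge R)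
    rw [abelSolution_base, sub_sub_sub_cancel_right] at h1
    have h2 : ‖ζ - R‖ ≤ 2 * r := by
      refine (Complex.norm_le_abs_re_add_abs_im _).trans ?_
      simp only [Complex.sub_re, Complex.sub_im, Complex.ofReal_re, Complex.ofReal_im, sub_zero]
      rw [abs_of_pos (by linarith)]
      linarith
    rw [Metric.mem_closedBall, dist_eq_norm, norm_sub_rev]
    have h3 : (((inv.nnnorm : NNReal) : ℝ)⁻¹ - ((1 / 8 : NNReal) : ℝ)) = 7 / 8 := by
      simp [inv]; norm_num
    rw [h3]
    linarith
  obtain ⟨w, hw, hwζ⟩ := hsurj hmem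
  exact ⟨w, hball hw, hwζ⟩

end IsTamePerturbation

/-- The branch of the `n`-th root of `c ^ n / w` given by the principal logarithm. -/
noncomputable def rootChart (c : ℂ) (n : ℕ) (w : ℂ) : ℂ := c * Complex.exp (-Complex.log w / n)

section rootChart

variable {c : ℂ} {n : ℕ}

lemma rootChart_ne_zero (hc : c ≠ 0) (w : ℂ) : rootChart c n w ≠ 0 :=
  mul_ne_zero hc (Complex.exp_ne_zero _)

lemma rootChart_pow_mul (hn : 1 ≤ n) {w : ℂ} (hw : w ≠ 0) : rootChart c n w ^ n * w = c ^ n := by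
  have hn0 : (n : ℂ) ≠ 0 := by exact_mod_cast (by lia : n ≠ 0)
  rw [rootChart, mul_pow, ← Complex.exp_nat_mul, mul_div_cancel₀ _ hn0, Complex.exp_neg,
    Complex.exp_log hw, mul_assoc, inv_mul_cancel₀ hw, mul_one]

lemma norm_rootChart {w : ℂ} (hw : w ≠ 0) :
    ‖rootChart c n w‖ = ‖c‖ * ‖w‖ ^ (-(1 / n) : ℝ) := by
  rw [rootChart, norm_mul, Complex.norm_exp, Complex.div_natCast_re, Complex.neg_re,
    Complex.log_re, Real.rpow_def_of_pos (norm_pos_iff.2 hw)]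
  ring_nf

lemma tendsto_rootChart (hn : 1 ≤ n) : Tendsto (rootChart c n) (Bornology.cobounded ℂ) (𝓝 0) := by
  have hpos : (0 : ℝ) < 1 / n := by positivity
  have h1 : Tendsto (fun w : ℂ => ‖c‖ * ‖w‖ ^ (-(1 / n) : ℝ)) (Bornology.cobounded ℂ) (𝓝 0) := by
    simpa using ((tendsto_rpow_neg_atTop hpos).comp
      (tendsto_norm_cobounded_atTop (E := ℂ))).const_mul ‖c‖
  rw [tendsto_zero_iff_norm_tendsto_zero]
  refine h1.congr' ?_
  filter_upwards [Bornology.eventually_ne_cobounded (0 : ℂ)] with w hw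
  exact (norm_rootChart hw).symm

lemma hasDerivAt_rootChart {w : ℂ} (hw : w ∈ Complex.slitPlane) :
    HasDerivAt (rootChart c n) (rootChart c n w * (-(w⁻¹) / n)) w := by
  have := ((((Complex.hasDerivAt_log hw).fun_neg).div_const (n : ℂ)).cexp).const_mul c
  rw [← mul_assoc] at this
  exact this

lemma rootChart_div_pow (hn : 1 ≤ n) {w x : ℂ} (hw : 0 < w.re + |w.im|) (hx : 1 + x ≠ 0)
    (harg : n * |(1 + x).arg| ≤ Real.pi / 8) :
    rootChart c n (w / (1 + x) ^ n) = rootChart c n w * (1 + x) := by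
  have hn0 : (n : ℂ) ≠ 0 := by exact_mod_cast (by lia : n ≠ 0)
  have hw0 : w ≠ 0 := by rintro rfl; simp at hw
  have hargw : |w.arg| ≤ 3 * Real.pi / 4 := by
    by_contra! hlt
    have hcos := Real.cos_nonpos_of_pi_div_two_le_of_le
      (x := |w.arg| - Real.pi / 4) (by linarith)
      (by linarith [Complex.abs_arg_le_pi w, Real.pi_pos])
    rw [Real.cos_sub, Real.cos_pi_div_four, Real.sin_pi_div_four, Real.cos_abs,
      ← Real.abs_sin_eq_sin_abs_of_abs_le_pi (Complex.abs_arg_le_pi w), Complex.cos_arg hw0,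
      Complex.sin_arg, abs_div, abs_norm, ← add_mul, ← add_div] at hcos
    have : 0 < (w.re + |w.im|) / ‖w‖ * (√2 / 2) := by positivity
    linarith
  have hlog : Complex.log (w / (1 + x) ^ n) = Complex.log w - n * Complex.log (1 + x) := by
    have hexp : w / (1 + x) ^ n = Complex.exp (Complex.log w - n * Complex.log (1 + x)) := by
      rw [Complex.exp_sub, Complex.exp_nat_mul, Complex.exp_log hw0, Complex.exp_log hx]
    have him : |n * (1 + x).arg| ≤ Real.pi / 8 := by rwa [abs_mul, Nat.abs_cast]
    rw [hexp]
    apply Complex.log_exp <;>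
    rw [Complex.sub_im, ← nsmul_eq_mul, Complex.im_nsmul, Complex.log_im, Complex.log_im,
      nsmul_eq_mul] <;>
    linarith [abs_le.1 him, abs_le.1 hargw, Real.pi_pos]
  have hsplit : -(Complex.log w - n * Complex.log (1 + x)) / n =
      -Complex.log w / n + Complex.log (1 + x) := by field_simp; ring
  rw [rootChart, hlog, hsplit, Complex.exp_add, Complex.exp_log hx, rootChart, mul_assoc]

end rootChart

lemma exists_one_add_pow_eq (n : ℕ) : ∃ Q : ℂ → ℂ, AnalyticAt ℂ Q 0 ∧
    ∀ x, (1 + x) ^ n = 1 + n * x + x ^ 2 * Q x := by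
  induction n with
  | zero => exact ⟨0, analyticAt_const, by simp⟩
  | succ n ih =>
    obtain ⟨Q, hQ, hQx⟩ := ih
    refine ⟨fun x => n + Q x + x * Q x, by fun_prop, fun x => ?_⟩
    rw [pow_succ, hQx]
    push_cast
    ring

lemma AnalyticAt.exists_eq_pow_succ_mul_of_isLittleO {r : ℂ → ℂ} {m : ℕ} (hr : AnalyticAt ℂ r 0)
    (ho : r =o[𝓝 0] fun z => z ^ m) :
    ∃ k : ℂ → ℂ, AnalyticAt ℂ k 0 ∧ ∀ᶠ z in 𝓝 0, r z = z ^ (m + 1) * k z := by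
  have hle : ((m + 1 : ℕ) : ℕ∞) ≤ analyticOrderAt r 0 := by
    by_contra! hlt
    obtain ⟨N, hN⟩ := ENat.ne_top_iff_exists.1 (ne_top_of_lt hlt)
    rw [← hN] at hlt
    have hNm : N ≤ m := Nat.lt_succ_iff.1 (by exact_mod_cast hlt)
    obtain ⟨k, hk, hk0, hkr⟩ := hr.analyticOrderAt_eq_natCast.1 hN.symm
    have hoN : r =o[𝓝 0] fun z : ℂ => z ^ N := by
      refine ho.trans_isBigO (IsBigO.of_bound 1 ?_)
      filter_upwards [Metric.closedBall_mem_nhds (0 : ℂ) one_pos] with z hz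
      rw [one_mul, norm_pow, norm_pow]
      exact pow_le_pow_of_le_one (norm_nonneg z) (by simpa using hz) hNm
    have hk' : Tendsto k (𝓝[≠] 0) (𝓝 0) := by
      refine ((hoN.tendsto_div_nhds_zero).mono_left nhdsWithin_le_nhds).congr' ?_
      filter_upwards [hkr.filter_mono nhdsWithin_le_nhds, self_mem_nhdsWithin] with z hz hz0
      rw [hz, sub_zero, smul_eq_mul, mul_div_cancel_left₀ _ (pow_ne_zero _ hz0)]
    exact hk0 (tendsto_nhds_unique (hk.continuousAt.tendsto.mono_left nhdsWithin_le_nhds) hk')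
  obtain ⟨k, hk, hkr⟩ := (natCast_le_analyticOrderAt hr).1 hle
  exact ⟨k, hk, by simpa using hkr⟩

/-- In the coordinate `w = b / z ^ n`, a germ `z (1 + a z ^ n + o(z ^ n))` becomes
`w ↦ w + 1 + H z` with `H` analytic and vanishing at `0`. -/
lemma exists_analyticAt_perturbation {g : ℂ → ℂ} {n : ℕ} {a b : ℂ} (hg : AnalyticAt ℂ g 0)
    (hn : 1 ≤ n) (hab : n * a * b = -1)
    (hexp : (fun z : ℂ => g z - z * (1 + a * z ^ n)) =o[𝓝 (0 : ℂ)] fun z : ℂ => z ^ (n + 1)) :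
    ∃ x H : ℂ → ℂ, AnalyticAt ℂ x 0 ∧ x 0 = 0 ∧ AnalyticAt ℂ H 0 ∧ H 0 = 0 ∧
      ∀ᶠ z in 𝓝 0, g z = z * (1 + x z) ∧ (b + z ^ n + z ^ n * H z) * (1 + x z) ^ n = b := by
  have hn0 : n ≠ 0 := by lia
  have ha : a ≠ 0 := by rintro rfl; simp at hab
  obtain ⟨k, hk, hkg⟩ := AnalyticAt.exists_eq_pow_succ_mul_of_isLittleO (by fun_prop) hexp
  obtain ⟨Q, hQ, hQx⟩ := exists_one_add_pow_eq n
  set x : ℂ → ℂ := fun z => z ^ n * (a + z * k z) with hx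
  have hxa : AnalyticAt ℂ x 0 := by fun_prop
  have hx0 : x 0 = 0 := by simp [hx, hn0]
  have hQxa : AnalyticAt ℂ (fun z => Q (x z)) 0 := AnalyticAt.comp_of_eq hQ hxa hx0
  have hpow : (1 + x 0) ^ n ≠ 0 := by simp [hx0]
  refine ⟨x, fun z => z * k z / a + b * z ^ n * (a + z * k z) ^ 2 *
      ((n ^ 2 + n * x z * Q (x z) - Q (x z)) / (1 + x z) ^ n), hxa, hx0, ?_, by simp [hn0], ?_⟩
  · have h1 : AnalyticAt ℂ (fun z => (1 + x z) ^ n) 0 := by fun_prop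
    have h2 : AnalyticAt ℂ (fun z => n ^ 2 + n * x z * Q (x z) - Q (x z)) 0 :=
      (analyticAt_const.fun_add ((analyticAt_const.fun_mul hxa).fun_mul hQxa)).fun_sub hQxa
    have h3 := h2.fun_div h1 hpow
    fun_prop
  · filter_upwards [hkg, (hxa.continuousAt.const_add 1).pow n |>.eventually_ne hpow] with z hz hz1
    refine ⟨by rw [hx]; linear_combination hz, ?_⟩
    have hb : b = -1 / (n * a) := by
      have : (n : ℂ) * a ≠ 0 := by rintro h; simp [h] at hab
      field_simp; linear_combination hab
    have key : (1 - n * x z) * (1 + x z) ^ n +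
        x z ^ 2 * (n ^ 2 + n * x z * Q (x z) - Q (x z)) = 1 := by
      rw [hQx]; ring
    have hcancel : (n ^ 2 + n * x z * Q (x z) - Q (x z)) / (1 + x z) ^ n * (1 + x z) ^ n =
        n ^ 2 + n * x z * Q (x z) - Q (x z) := div_mul_cancel₀ _ hz1
    have hlin : z ^ n + z ^ n * (z * k z / a) = -(b * n * x z) := by
      rw [hx]
      field_simp
      linear_combination (z ^ n * (a + z * k z)) * hab
    have hsq : z ^ n * (b * z ^ n * (a + z * k z) ^ 2) = b * x z ^ 2 := by rw [hx]; ring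
    linear_combination (1 + x z) ^ n * hlin + b * key + b * x z ^ 2 * hcancel +
      ((n ^ 2 + n * x z * Q (x z) - Q (x z)) / (1 + x z) ^ n * (1 + x z) ^ n) * hsq

lemma closedWedge_subset_slitPlane {R : ℝ} (hR : 0 < R) : closedWedge R ⊆ Complex.slitPlane := by
  intro w hw
  have hw' : R ≤ w.re + |w.im| := hw
  rw [Complex.mem_slitPlane_iff]
  by_contra! hcon
  rw [hcon.2, abs_zero] at hw'
  linarith [hcon.1]

lemma half_le_norm_of_mem_closedWedge {R : ℝ} {w : ℂ} (hw : w ∈ closedWedge R) : R / 2 ≤ ‖w‖ := by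
  obtain ⟨s, hs, hws⟩ := exists_slope w
  have h0 : R ≤ w.re + |w.im| := hw
  linarith [level_le_two_mul_norm hs w]

lemma hasDerivAt_comp_rootChart {H : ℂ → ℂ} {c : ℂ} {n : ℕ} {w : ℂ}
    (hH : DifferentiableAt ℂ H (rootChart c n w)) (hw : w ∈ Complex.slitPlane) :
    HasDerivAt (fun w => H (rootChart c n w))
      (deriv H (rootChart c n w) * (rootChart c n w * (-(w⁻¹) / n))) w :=
  hH.hasDerivAt.comp w (hasDerivAt_rootChart hw)

lemma norm_deriv_comp_rootChart_le {d c w : ℂ} {n : ℕ} {C t : ℝ} (hn : 1 ≤ n) (hd : ‖d‖ ≤ C)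
    (ht : 0 < t) (hw : t ≤ ‖w‖) :
    ‖d * (rootChart c n w * (-(w⁻¹) / n))‖ ≤ C * ‖c‖ * t ^ (-(1 + 1 / n) : ℝ) := by
  have hw0 : 0 < ‖w‖ := ht.trans_le hw
  have hn1 : (1 : ℝ) ≤ n := by exact_mod_cast hn
  have hC : 0 ≤ C := (norm_nonneg d).trans hd
  have hpow : ‖w‖ ^ (-(1 / n) : ℝ) * ‖w‖⁻¹ = ‖w‖ ^ (-(1 + 1 / n) : ℝ) := by
    rw [← Real.rpow_neg_one, ← Real.rpow_add hw0]
    ring_nf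
  calc ‖d * (rootChart c n w * (-(w⁻¹) / n))‖
      = ‖d‖ * (‖c‖ * ‖w‖ ^ (-(1 + 1 / n) : ℝ) / n) := by
        rw [norm_mul, norm_mul, norm_rootChart (norm_pos_iff.1 hw0), norm_div, norm_neg, norm_inv,
          Complex.norm_natCast, ← hpow]
        ring
    _ ≤ C * (‖c‖ * t ^ (-(1 + 1 / n) : ℝ)) := by
        gcongr
        refine (div_le_self (by positivity) hn1).trans ?_
        gcongr ?_ * ?_
        exact Real.rpow_le_rpow_of_nonpos ht hw (by have : (0 : ℝ) ≤ 1 / n := by positivity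
                                                    linarith)
    _ = C * ‖c‖ * t ^ (-(1 + 1 / n) : ℝ) := by ring

lemma exists_isTamePerturbation {H : ℂ → ℂ} (hH : AnalyticAt ℂ H 0) (hH0 : H 0 = 0) (c : ℂ)
    {n : ℕ} (hn : 1 ≤ n) {p : ℂ → Prop} (hp : ∀ᶠ z in 𝓝 0, p z) :
    ∃ (R : ℝ) (δ : ℕ → ℝ), 0 < R ∧
      IsTamePerturbation (fun w => H (rootChart c n w)) R δ ∧
      ∀ w ∈ closedWedge R, p (rootChart c n w) := by
  have hn0 : (0 : ℝ) < 1 / n := by positivity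
  set C : ℝ := ‖deriv H 0‖ + 1
  have hlocal : ∀ᶠ z in 𝓝 0, p z ∧ ‖H z‖ ≤ 1 / 4 ∧ DifferentiableAt ℂ H z ∧ ‖deriv H z‖ ≤ C := by
    have h1 : ∀ᶠ z in 𝓝 0, ‖H z‖ < 1 / 4 :=
      hH.continuousAt.norm.eventually_lt_const (by simp [hH0])
    have h2 : ∀ᶠ z in 𝓝 0, ‖deriv H z‖ < C :=
      hH.deriv.continuousAt.norm.eventually_lt_const (lt_add_one _)
    filter_upwards [hp, h1, hH.eventually_analyticAt, h2] with z a1 a2 a3 a4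
    exact ⟨a1, a2.le, a3.differentiableAt, a4.le⟩
  have hfar : ∀ᶠ t : ℝ in atTop, ∀ w : ℂ, t ≤ ‖w‖ → p (rootChart c n w) ∧
      ‖H (rootChart c n w)‖ ≤ 1 / 4 ∧ DifferentiableAt ℂ H (rootChart c n w) ∧
      ‖deriv H (rootChart c n w)‖ ≤ C := by
    have := (tendsto_rootChart (c := c) hn).eventually hlocal
    rw [← comap_norm_atTop, eventually_comap] at this
    obtain ⟨t₀, ht₀⟩ := eventually_atTop.1 this
    filter_upwards [eventually_ge_atTop t₀] with t ht w hw
    exact ht₀ _ (ht.trans hw) w rfl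
  set d : ℕ → ℝ := fun k => C * ‖c‖ * ((k : ℝ) / 4) ^ (-(1 + 1 / n) : ℝ) with hd
  have hdsum : Summable d := by
    have h1 : Summable fun k : ℕ => (k : ℝ) ^ (-(1 + 1 / n) : ℝ) :=
      Real.summable_nat_rpow.2 (by linarith)
    refine (h1.mul_left (C * ‖c‖ * (1 / 4) ^ (-(1 + 1 / n) : ℝ))).congr fun k => ?_
    simp only [hd]
    rw [div_eq_mul_one_div (k : ℝ) 4, Real.mul_rpow k.cast_nonneg (by norm_num)]
    ring
  have htend : Tendsto (fun M : ℕ => (M : ℝ) / 4) atTop atTop :=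
    tendsto_natCast_atTop_atTop.atTop_div_const (by norm_num)
  have htail : ∀ᶠ M : ℕ in atTop, ∑' k, d (k + M) ≤ 1 / 32 :=
    (tendsto_sum_nat_add d).eventually_le_const (by norm_num)
  obtain ⟨M, hM1, hM2, hM3⟩ :=
    ((eventually_ge_atTop 1).and (htail.and (htend.eventually hfar))).exists
  have hMpos : (0 : ℝ) < M := by exact_mod_cast hM1
  have hwedge : ∀ w ∈ closedWedge ((M : ℝ) / 2), (M : ℝ) / 4 ≤ ‖w‖ := fun w hw => by
    linarith [half_le_norm_of_mem_closedWedge hw]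
  have hderiv : ∀ w ∈ closedWedge ((M : ℝ) / 2), HasDerivAt (fun w => H (rootChart c n w))
      (deriv H (rootChart c n w) * (rootChart c n w * (-(w⁻¹) / n))) w := fun w hw =>
    hasDerivAt_comp_rootChart (hM3 w (hwedge w hw)).2.2.1
      (closedWedge_subset_slitPlane (half_pos hMpos) hw)
  refine ⟨M / 2, fun k => d (k + M), half_pos hMpos, ?_, fun w hw => (hM3 w (hwedge w hw)).1⟩
  refine ⟨fun k => by positivity, (summable_nat_add_iff M).2 hdsum, hM2,
    fun w hw => (hM3 w (hwedge w hw)).2.1, fun s hs k u v hu hv => ?_,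
    fun w hw =>
      (hderiv w (openWedge_subset_closedWedge _ hw)).differentiableAt.differentiableWithinAt,
    ?_⟩
  · have hk : (0 : ℝ) ≤ k := k.cast_nonneg
    have hconv : Convex ℝ {w : ℂ | (M : ℝ) / 2 + k / 2 ≤ w.re + s * w.im} := by
      refine convex_halfSpace_ge (f := fun w : ℂ => w.re + s * w.im) ⟨fun x y => ?_, fun r x => ?_⟩ _
      · simp only [Complex.add_re, Complex.add_im]; ring
      · simp only [Complex.real_smul, Complex.re_ofReal_mul, Complex.im_ofReal_mul, smul_eq_mul]
        ring
    have hmem : ∀ w ∈ {w : ℂ | (M : ℝ) / 2 + k / 2 ≤ w.re + s * w.im},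
        w ∈ closedWedge ((M : ℝ) / 2) := fun w hw =>
      mem_closedWedge_of_le hs (le_trans (by linarith) hw)
    refine hconv.norm_image_sub_le_of_norm_hasDerivWithin_le
      (fun w hw => (hderiv w (hmem w hw)).hasDerivWithinAt) (fun w hw => ?_) hv hu
    have hw' : (M : ℝ) / 2 + k / 2 ≤ w.re + s * w.im := hw
    refine norm_deriv_comp_rootChart_le hn (hM3 w (hwedge w (hmem w hw))).2.2.2 (by positivity) ?_
    push_cast
    linarith [level_le_two_mul_norm hs w]
  · have := hH.continuousAt.tendsto
    rw [hH0] at this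
    exact this.comp (tendsto_rootChart hn)

lemma analyticAt_iterate {f : ℂ → ℂ} {z : ℂ} (hf : AnalyticAt ℂ f z) (hz : f z = z) (q : ℕ) :
    AnalyticAt ℂ f^[q] z := by
  induction q with
  | zero => exact analyticAt_id
  | succ q ih => exact ih.comp_of_eq hf hz

lemma simplyConnectedSpace_of_invOn {X Y : Type*} [TopologicalSpace X] [AddCommGroup Y]
    [Module ℝ Y] [TopologicalSpace Y] [ContinuousAdd Y] [ContinuousSMul ℝ Y] {P : Set X} {Q : Set Y}
    {φ : X → Y} {ψ : Y → X} (hQ : Convex ℝ Q) (hQne : Q.Nonempty) (hφ : ContinuousOn φ P)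
    (hψ : ContinuousOn ψ Q) (hφm : Set.MapsTo φ P Q) (hψm : Set.MapsTo ψ Q P)
    (hinv : Set.InvOn ψ φ P Q) : SimplyConnectedSpace P := by
  have := hQ.contractibleSpace hQne
  have e : P ≃ₜ Q :=
    { toFun := hφm.restrict φ P Q
      invFun := hψm.restrict ψ Q P
      left_inv := fun x => Subtype.ext (hinv.1 x.2)
      right_inv := fun y => Subtype.ext (hinv.2 y.2)
      continuous_toFun := hφ.mapsToRestrict hφm
      continuous_invFun := hψ.mapsToRestrict hψm }
  have := e.contractibleSpace
  exact SimplyConnectedSpace.ofContractible P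

/-- Fatou linearization on a petal: there exist `τ ∈ ℝ`, an attracting petal `P`
of `f` in `N₀`, and a biholomorphic map `φ : P → {Re w > τ}` conjugating `f^q`
to `w ↦ w + 1`. -/
theorem fatou_linearization_on_petal (f : ℂ → ℂ) (N₀ : Set ℂ) (hN₀ : N₀ ∈ 𝓝 (0 : ℂ))
    (hf : DifferentiableOn ℂ f N₀) (hfinj : Set.InjOn f N₀) (hf0 : f 0 = 0)
    (p : ℤ) (q : ℕ) (hq : 0 < q) (hpq : IsCoprime p (q : ℤ))
    (hder : deriv f 0 = Complex.exp (2 * Real.pi * Complex.I * p / q))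
    (n : ℕ) (hn : 1 ≤ n) (a : ℂ) (ha : a ≠ 0)
    (hexp : (fun z : ℂ => f^[q] z - z * (1 + a * z ^ n)) =o[𝓝 (0 : ℂ)]
      fun z : ℂ => z ^ (n + 1)) :
    ∃ (τ : ℝ) (P : Set ℂ), IsAttractingPetal f q N₀ P ∧
      ∃ φ : ℂ → ℂ, DifferentiableOn ℂ φ P ∧
        Set.BijOn φ P {w : ℂ | τ < w.re} ∧
        ∀ z ∈ P, φ (f^[q] z) = φ z + 1 := by
  set g : ℂ → ℂ := f^[q]
  have hfa : AnalyticAt ℂ f 0 := hf.analyticAt hN₀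
  have hga : AnalyticAt ℂ g 0 := analyticAt_iterate hfa hf0 q
  have hg0 : g 0 = 0 := Function.iterate_fixed hf0 q
  have hnC : (n : ℂ) ≠ 0 := by exact_mod_cast (by lia : n ≠ 0)
  obtain ⟨c, hc⟩ := IsAlgClosed.exists_pow_nat_eq (-1 / (n * a)) (n := n) (by lia)
  have hab : n * a * c ^ n = -1 := by rw [hc]; field_simp
  have hc0 : c ≠ 0 := by
    rintro rfl
    simp [show n ≠ 0 by lia] at hab
  obtain ⟨x, H, hx, hx0, hH, hH0, hgx⟩ := exists_analyticAt_perturbation hga hn hab hexp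
  have hx1 : Tendsto (fun z => 1 + x z) (𝓝 0) (𝓝 1) := by
    simpa [hx0] using hx.continuousAt.tendsto.const_add 1
  have hgderiv : HasDerivAt g 1 0 := by
    have h1 : HasDerivAt (fun z => z * (1 + x z)) (1 * (1 + x 0) + 0 * deriv x 0) 0 :=
      (hasDerivAt_id (0 : ℂ)).mul (hx.differentiableAt.hasDerivAt.const_add 1)
    simp only [hx0, add_zero, mul_one, zero_mul] at h1
    exact h1.congr_of_eventuallyEq (hgx.mono fun z hz => hz.1)
  have himage : g '' N₀ ∈ 𝓝 (0 : ℂ) := by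
    have hmap := hga.hasStrictDerivAt.map_nhds_eq (by rw [hgderiv.deriv]; exact one_ne_zero)
    rw [hg0] at hmap
    rw [← hmap]
    exact image_mem_map hN₀
  have harg : ∀ᶠ z in 𝓝 0, n * |(1 + x z).arg| ≤ Real.pi / 8 := by
    have h1 : Tendsto (fun z => n * |(1 + x z).arg|) (𝓝 0) (𝓝 (n * |(1 : ℂ).arg|)) :=
      (((Complex.continuousAt_arg Complex.one_mem_slitPlane).tendsto.comp hx1).abs).const_mul _
    exact h1.eventually_le_const (by simpa using Real.pi_pos)
  have hmem : ∀ᶠ z in 𝓝 0, z ∈ N₀ ∩ g '' N₀ := inter_mem hN₀ himage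
  obtain ⟨R, δ, hR, hT, hnear⟩ := exists_isTamePerturbation hH hH0 c hn
    (hgx.and (hmem.and (harg.and (hx1.eventually_ne one_ne_zero))))
  set Z := rootChart c n
  have hZ0 : ∀ w, Z w ≠ 0 := rootChart_ne_zero hc0
  set h : ℂ → ℂ := fun w => H (Z w)
  set Φ := abelSolution h R
  have hslit : openWedge R ⊆ Complex.slitPlane :=
    (openWedge_subset_closedWedge R).trans (closedWedge_subset_slitPlane hR)
  have hne : ∀ w ∈ openWedge R, w ≠ 0 := fun w hw => Complex.slitPlane_ne_zero (hslit hw)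
  have hconj : ∀ w ∈ openWedge R, g (Z w) = Z (perturbedShift h w) := by
    intro w hw
    obtain ⟨⟨hg1, hg2⟩, -, hg3, hg4⟩ := hnear w (openWedge_subset_closedWedge R hw)
    have hwZ : Z w ^ n * w = c ^ n := rootChart_pow_mul hn (hne w hw)
    have hshift : perturbedShift h w = w / (1 + x (Z w)) ^ n := by
      rw [eq_div_iff (pow_ne_zero n hg4)]
      refine mul_left_cancel₀ (pow_ne_zero n (hZ0 w)) ?_
      change Z w ^ n * ((w + 1 + H (Z w)) * (1 + x (Z w)) ^ n) = Z w ^ n * w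
      linear_combination hg2 + ((1 + x (Z w)) ^ n - 1) * hwZ
    rw [hg1, hshift]
    exact (rootChart_div_pow hn (hR.trans hw) hg4 hg3).symm
  have hiter : ∀ w ∈ openWedge R, ∀ m : ℕ, g^[m] (Z w) = Z ((perturbedShift h)^[m] w) := by
    intro w hw m
    induction m with
    | zero => rfl
    | succ m ih =>
      rw [Function.iterate_succ_apply', Function.iterate_succ_apply', ih]
      exact hconj _ (hT.mapsTo_perturbedShift.iterate m hw)
  set W : ℂ → ℂ := fun z => c ^ n / z ^ n
  have hWZ : ∀ w ∈ openWedge R, W (Z w) = w := fun w hw => by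
    rw [div_eq_iff (pow_ne_zero n (hZ0 w)), mul_comm]
    exact (rootChart_pow_mul hn (hne w hw)).symm
  set HP : Set ℂ := {w : ℂ | R < w.re}
  set Q : Set ℂ := openWedge R ∩ Φ ⁻¹' HP
  have hΦd : DifferentiableOn ℂ Φ (openWedge R) := hT.differentiableOn_abelSolution
  have hΦG : ∀ w ∈ openWedge R, Φ (perturbedShift h w) = Φ w + 1 := fun w hw =>
    hT.abelSolution_perturbedShift hw
  have hΦsurj : ∀ ζ ∈ HP, ∃ w ∈ openWedge R, Φ w = ζ := fun ζ hζ => hT.exists_abelSolution_eq hζ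
  have hHP : IsOpen HP := isOpen_lt continuous_const Complex.continuous_re
  have hQ : IsOpen Q := hΦd.continuousOn.isOpen_inter_preimage (isOpen_openWedge R) hHP
  have hQG : ∀ w ∈ Q, perturbedShift h w ∈ Q := fun w hw =>
    ⟨hT.mapsTo_perturbedShift hw.1, by
      have hw2 : R < (Φ w).re := hw.2
      change R < (Φ (perturbedShift h w)).re
      rw [hΦG w hw.1, Complex.add_re, Complex.one_re]
      linarith⟩
  choose! Ψ hΨw hΨ using hΦsurj
  have hΨQ : ∀ ζ ∈ HP, Ψ ζ ∈ Q := fun ζ hζ =>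
    ⟨hΨw ζ hζ, by change Φ (Ψ ζ) ∈ HP; rw [hΨ ζ hζ]; exact hζ⟩
  have hΨlip : LipschitzOnWith 2 Ψ HP := LipschitzOnWith.of_dist_le_mul fun u hu v hv => by
    have := hT.norm_sub_le_two_mul (openWedge_subset_closedWedge R (hΨw u hu))
      (openWedge_subset_closedWedge R (hΨw v hv))
    change _ ≤ 2 * ‖Φ (Ψ u) - Φ (Ψ v)‖ at this
    rw [hΨ u hu, hΨ v hv] at this
    simpa [dist_eq_norm] using this
  have hΨΦ : ∀ w ∈ Q, Ψ (Φ w) = w := fun w hw =>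
    hT.injOn_abelSolution (openWedge_subset_closedWedge R (hΨw _ hw.2))
      (openWedge_subset_closedWedge R hw.1) (hΨ _ hw.2)
  have hHPne : HP.Nonempty := ⟨(R + 1 : ℝ), by
    change R < ((R + 1 : ℝ) : ℂ).re
    rw [Complex.ofReal_re]
    linarith⟩
  have hZd : ∀ w ∈ openWedge R, DifferentiableAt ℂ Z w := fun w hw =>
    (hasDerivAt_rootChart (hslit hw)).differentiableAt
  set P : Set ℂ := Z '' Q
  have hP0 : (0 : ℂ) ∉ P := by
    rintro ⟨w, -, hw⟩
    exact hZ0 w hw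
  have hWP : Set.MapsTo W P Q := by
    rintro _ ⟨w, hw, rfl⟩
    rw [hWZ w hw.1]
    exact hw
  have hφd : DifferentiableOn ℂ (Φ ∘ W) P := by
    refine (hΦd.mono Set.inter_subset_left).comp (fun z hz => ?_) hWP
    have hz0 : z ^ n ≠ 0 := pow_ne_zero n fun h0 => hP0 (h0 ▸ hz)
    have hWd : DifferentiableAt ℂ (fun u : ℂ => c ^ n / u ^ n) z :=
      (differentiableAt_const _).fun_div (differentiableAt_fun_id.fun_pow n) hz0
    exact hWd.differentiableWithinAt
  have hφm : Set.MapsTo (Φ ∘ W) P HP := fun z hz => (hWP hz).2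
  have hψm : Set.MapsTo (Z ∘ Ψ) HP P := fun ζ hζ => ⟨Ψ ζ, hΨQ ζ hζ, rfl⟩
  have hinv : Set.InvOn (Z ∘ Ψ) (Φ ∘ W) P HP := by
    constructor
    · rintro _ ⟨w, hw, rfl⟩
      simp only [Function.comp_apply, hWZ w hw.1, hΨΦ w hw]
    · intro ζ hζ
      simp only [Function.comp_apply, hWZ _ (hΨw ζ hζ), hΨ ζ hζ]
  have hPne : P.Nonempty := hHPne.image (Z ∘ Ψ) |>.mono hψm.image_subset
  have hconv : TendstoUniformlyOn (fun (m : ℕ) (z : ℂ) => g^[m] z) (fun _ => 0) atTop P := by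
    rw [Metric.tendstoUniformlyOn_iff]
    intro ε hε
    have hZε := (tendsto_rootChart (c := c) hn).eventually (Metric.ball_mem_nhds 0 hε)
    rw [← comap_norm_atTop, eventually_comap] at hZε
    have hlev : Tendsto (fun m : ℕ => (R + m / 2) / 2) atTop atTop :=
      (tendsto_atTop_add_const_left _ R
        (tendsto_natCast_atTop_atTop.atTop_div_const two_pos)).atTop_div_const two_pos
    obtain ⟨t, ht⟩ := eventually_atTop.1 hZε
    filter_upwards [hlev.eventually_ge_atTop t] with m hm
    rintro _ ⟨w, hw, rfl⟩
    rw [hiter w hw.1, dist_comm]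
    exact ht _ (hm.trans (hT.le_norm_iterate (openWedge_subset_closedWedge R hw.1) m)) _ rfl
  have hgP : Set.MapsTo g P P := by
    rintro _ ⟨w, hw, rfl⟩
    exact ⟨_, hQG w hw, (hconj w hw.1).symm⟩
  refine ⟨R, P, ⟨hPne, ?_, ?_, ?_, hgP.image_subset, ?_, hP0, hconv⟩, Φ ∘ W, hφd,
    Set.InvOn.bijOn hinv hφm hψm, ?_⟩
  · rw [isOpen_iff_mem_nhds]
    rintro _ ⟨w, hw, rfl⟩
    have hZa : AnalyticAt ℂ Z w := DifferentiableOn.analyticAt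
      (fun u hu => (hZd u hu).differentiableWithinAt) ((isOpen_openWedge R).mem_nhds hw.1)
    have hZ' : deriv Z w ≠ 0 := by
      rw [(hasDerivAt_rootChart (hslit hw.1)).deriv]
      exact mul_ne_zero (hZ0 w)
        (div_ne_zero (neg_ne_zero.2 (inv_ne_zero (hne w hw.1))) hnC)
    rw [← hZa.hasStrictDerivAt.map_nhds_eq hZ']
    exact image_mem_map (hQ.mem_nhds hw)
  · refine simplyConnectedSpace_of_invOn (convex_halfSpace_re_gt R) hHPne hφd.continuousOn ?_
      hφm hψm hinv
    exact ContinuousOn.comp (fun w hw => (hZd w hw).continuousAt.continuousWithinAt)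
      hΨlip.continuousOn hΨw
  · rintro _ ⟨w, hw, rfl⟩
    exact (hnear w (openWedge_subset_closedWedge R hw.1)).2.1
  · obtain ⟨z, hz⟩ := hPne
    exact mem_closure_of_tendsto (hconv.tendsto_at hz)
      (Eventually.of_forall fun m => hgP.iterate m hz)
  · rintro _ ⟨w, hw, rfl⟩
    simp only [Function.comp_apply]
    rw [hconj w hw.1, hWZ _ (hQG w hw).1, hWZ w hw.1]
    exact hΦG w hw.1
end

section
/- (Topological rigidity of parabolic germs, homeomorphism form.) Let n ≥ 1 be an integer and let f and g be normalized parabolic germs of multiplicity n + 1. Then there exist neighborhoods V and U of 0 in ℂ and a homeomorphism ψ : V → U with ψ(0) = 0 such that f(ψ(z)) = ψ(g(z)) for every z ∈ V with g(z) ∈ V. -/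
open Filter Topology Asymptotics

/-- A smooth cutoff on `ℂ ∖ {0}`, equal to `0` for `‖w‖ ≤ 4 * M` and on a cone around the negative
real axis, whose sum with its reflection is `1` for `8 * M ≤ ‖w‖`. -/
noncomputable def sectorCutoff (M : ℝ) (w : ℂ) : ℝ :=
  Real.smoothTransition (2 * (w.re / ‖w‖) + 1 / 2) * Real.smoothTransition (‖w‖ / (4 * M) - 1)

lemma Real.smoothTransition_add_smoothTransition_one_sub (x : ℝ) :
    Real.smoothTransition x + Real.smoothTransition (1 - x) = 1 := by
  have h := (Real.smoothTransition.pos_denom x).ne'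
  have h' := (Real.smoothTransition.pos_denom (1 - x)).ne'
  simp only [Real.smoothTransition, sub_sub_cancel] at *
  field_simp
  ring

lemma Real.exists_norm_deriv_smoothTransition_le :
    ∃ C : ℝ, 0 < C ∧ ∀ x, ‖deriv Real.smoothTransition x‖ ≤ C := by
  have hc : Continuous (deriv Real.smoothTransition) :=
    (Real.smoothTransition.contDiff (n := 1)).continuous_deriv le_rfl
  obtain ⟨C, hC⟩ := (isCompact_Icc (a := (0 : ℝ)) (b := 1)).exists_bound_of_continuousOn
    hc.continuousOn
  refine ⟨max C 1, by positivity, fun x => ?_⟩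
  rcases lt_or_ge x 0 with h | h
  · have : Real.smoothTransition =ᶠ[𝓝 x] fun _ => 0 := by
      filter_upwards [eventually_lt_nhds h] with y hy
      exact Real.smoothTransition.zero_of_nonpos hy.le
    rw [this.deriv_eq]
    simp
  rcases lt_or_ge 1 x with h' | h'
  · have : Real.smoothTransition =ᶠ[𝓝 x] fun _ => 1 := by
      filter_upwards [eventually_gt_nhds h'] with y hy
      exact Real.smoothTransition.one_of_one_le hy.le
    rw [this.deriv_eq]
    simp
  exact (hC x ⟨h, h'⟩).trans (le_max_left _ _)

lemma norm_sectorCutoff_le_one (M : ℝ) (w : ℂ) : ‖sectorCutoff M w‖ ≤ 1 := by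
  have h1 := Real.smoothTransition.nonneg
  have h2 := Real.smoothTransition.le_one
  rw [sectorCutoff, Real.norm_of_nonneg (mul_nonneg (h1 _) (h1 _))]
  exact mul_le_one₀ (h2 _) (h1 _) (h2 _)

lemma le_of_sectorCutoff_ne_zero {M : ℝ} (hM : 0 < M) {w : ℂ} (hw : sectorCutoff M w ≠ 0) :
    M ≤ w.re + ‖w‖ / 2 := by
  obtain ⟨h1, h2⟩ := mul_ne_zero_iff.1 hw
  rw [Ne, Real.smoothTransition.zero_iff_nonpos, not_le] at h1 h2
  have h3 : 4 * M < ‖w‖ := by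
    have : 1 < ‖w‖ / (4 * M) := by linarith
    rwa [lt_div_iff₀ (by positivity), one_mul] at this
  have h4 : -(1 / 4) < w.re / ‖w‖ := by linarith
  rw [lt_div_iff₀ (by linarith)] at h4
  linarith

lemma sectorCutoff_add_sectorCutoff_neg {M : ℝ} (hM : 0 < M) {w : ℂ} (hw : 8 * M ≤ ‖w‖) :
    sectorCutoff M w + sectorCutoff M (-w) = 1 := by
  have h : 1 ≤ ‖w‖ / (4 * M) - 1 := by
    rw [le_sub_iff_add_le, le_div_iff₀ (by positivity)]
    linarith
  have := Real.smoothTransition_add_smoothTransition_one_sub (2 * (w.re / ‖w‖) + 1 / 2)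
  rw [show 1 - (2 * (w.re / ‖w‖) + 1 / 2) = 2 * (-w.re / ‖w‖) + 1 / 2 by ring] at this
  simpa only [sectorCutoff, norm_neg, Complex.neg_re, Real.smoothTransition.one_of_one_le h,
    mul_one] using this

lemma exists_fderiv_sectorCutoff_le : ∃ C : ℝ, 0 < C ∧ ∀ M : ℝ, 0 < M → ∀ w : ℂ, w ≠ 0 →
    DifferentiableAt ℝ (sectorCutoff M) w ∧ ‖fderiv ℝ (sectorCutoff M) w‖ * ‖w‖ ≤ C := by
  obtain ⟨C, hC, hb⟩ := Real.exists_norm_deriv_smoothTransition_le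
  refine ⟨6 * C, by positivity, fun M hM w hw => ?_⟩
  have hw' : 0 < ‖w‖ := norm_pos_iff.2 hw
  have hst : ∀ x, HasDerivAt Real.smoothTransition (deriv Real.smoothTransition x) x := fun x =>
    ((Real.smoothTransition.contDiff (n := 1)).differentiable one_ne_zero x).hasDerivAt
  have hnd : DifferentiableAt ℝ (fun w : ℂ => ‖w‖) w := differentiableAt_id.norm ℝ hw
  have hn := hnd.hasFDerivAt
  have hnb : ‖fderiv ℝ (fun w : ℂ => ‖w‖) w‖ ≤ 1 := by
    have := norm_fderiv_le_of_lipschitz ℝ (f := fun w : ℂ => ‖w‖) (x₀ := w) lipschitzWith_one_norm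
    simpa using this
  set N := fderiv ℝ (fun w : ℂ => ‖w‖) w
  have hre : HasFDerivAt (fun w : ℂ => w.re) Complex.reCLM w := Complex.reCLM.hasFDerivAt
  have hcomp : ∀ (a : ℂ → ℝ) (A : ℂ →L[ℝ] ℝ) (B : ℝ), HasFDerivAt a A w → ‖A‖ * ‖w‖ ≤ B →
      DifferentiableAt ℝ (fun y => Real.smoothTransition (a y)) w ∧
      ‖fderiv ℝ (fun y => Real.smoothTransition (a y)) w‖ * ‖w‖ ≤ C * B := by
    intro a A B ha hA
    have h := (hst (a w)).comp_hasFDerivAt w ha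
    refine ⟨h.differentiableAt, ?_⟩
    rw [show (fun y => Real.smoothTransition (a y)) = Real.smoothTransition ∘ a from rfl, h.fderiv,
      norm_smul, mul_assoc]
    exact mul_le_mul (hb _) hA (by positivity) hC.le
  have hα : DifferentiableAt ℝ
      (fun y : ℂ => Real.smoothTransition (2 * (y.re / ‖y‖) + 1 / 2)) w ∧
      ‖fderiv ℝ (fun y : ℂ => Real.smoothTransition (2 * (y.re / ‖y‖) + 1 / 2)) w‖ * ‖w‖
        ≤ C * 4 := by
    have h0 := ((hre.mul ((hasDerivAt_inv hw'.ne').comp_hasFDerivAt w hn)).const_mul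
      2).add_const (1 / 2)
    refine hcomp (fun y : ℂ => 2 * (y.re / ‖y‖) + 1 / 2) _ 4 h0 ?_
    have e1 : ‖w.re • (-(‖w‖ ^ 2)⁻¹ • N) + (‖w‖⁻¹ : ℝ) • Complex.reCLM‖ ≤ 2 * ‖w‖⁻¹ := by
      refine (norm_add_le _ _).trans ?_
      simp only [norm_smul, norm_neg, norm_inv, norm_pow, norm_norm, Complex.reCLM_norm]
      have e2 : ‖w.re‖ ≤ ‖w‖ := Complex.abs_re_le_norm w
      calc _ ≤ ‖w‖ * ((‖w‖ ^ 2)⁻¹ * 1) + ‖w‖⁻¹ * 1 := by gcongr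
        _ = _ := by field_simp; norm_num
    change ‖(2 : ℝ) • (w.re • (-(‖w‖ ^ 2)⁻¹ • N) + (‖w‖⁻¹ : ℝ) • Complex.reCLM)‖ * ‖w‖ ≤ 4
    rw [norm_smul, Real.norm_two]
    calc _ ≤ 2 * (2 * ‖w‖⁻¹) * ‖w‖ := by gcongr
      _ = 4 := by field_simp; norm_num
  have hβ : DifferentiableAt ℝ (fun y : ℂ => Real.smoothTransition (‖y‖ / (4 * M) - 1)) w ∧
      ‖fderiv ℝ (fun y : ℂ => Real.smoothTransition (‖y‖ / (4 * M) - 1)) w‖ * ‖w‖ ≤ C * 2 := by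
    rcases lt_or_ge (8 * M) ‖w‖ with h | h
    · have hev : (fun y : ℂ => Real.smoothTransition (‖y‖ / (4 * M) - 1)) =ᶠ[𝓝 w] fun _ => 1 := by
        filter_upwards [continuousAt_const.eventually_lt hnd.continuousAt h] with y hy
        apply Real.smoothTransition.one_of_one_le
        rw [le_sub_iff_add_le, le_div_iff₀ (by positivity)]
        linarith
      refine ⟨(differentiableAt_const _).congr_of_eventuallyEq hev, ?_⟩
      rw [hev.fderiv_eq]
      simp only [fderiv_fun_const, Pi.zero_apply, norm_zero, zero_mul]
      positivity
    · refine hcomp (fun y : ℂ => ‖y‖ / (4 * M) - 1) _ 2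
        ((hn.mul_const (4 * M)⁻¹).sub_const 1) ?_
      rw [norm_smul, norm_inv, Real.norm_of_nonneg (by positivity)]
      calc (4 * M)⁻¹ * ‖N‖ * ‖w‖ ≤ (4 * M)⁻¹ * 1 * (8 * M) := by gcongr
        _ = 2 := by field_simp; norm_num
  have hmul := hα.1.hasFDerivAt.mul hβ.1.hasFDerivAt
  refine ⟨hmul.differentiableAt, ?_⟩
  rw [show sectorCutoff M = _ * _ from rfl, hmul.fderiv]
  have hle : ∀ x, ‖Real.smoothTransition x‖ ≤ 1 := fun x => by
    rw [Real.norm_of_nonneg (Real.smoothTransition.nonneg x)]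
    exact Real.smoothTransition.le_one x
  refine (mul_le_mul_of_nonneg_right (norm_add_le _ _) hw'.le).trans ?_
  rw [norm_smul, norm_smul, add_mul, mul_assoc, mul_assoc]
  calc _ ≤ 1 * (C * 2) + 1 * (C * 4) :=
        add_le_add (mul_le_mul (hle _) hβ.2 (by positivity) zero_le_one)
          (mul_le_mul (hle _) hα.2 (by positivity) zero_le_one)
    _ = 6 * C := by ring

lemma exists_lyapunov {s C δ : ℝ} (hs : 0 < s) (hs1 : s ≤ 1) (hC : 0 < C) (hδ : 0 < δ) :
    ∀ᶠ M : ℝ in atTop, ∃ Λ : ℝ → ℝ, ∀ x, M ≤ x → (0 ≤ Λ x ∧ Λ x ≤ δ) ∧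
      (0 ≤ C * x ^ (-s - 1) ∧ C * x ^ (-s - 1) ≤ 1) ∧
      ∀ y, x + 1 / 4 ≤ y → Λ x + 3 * (C * x ^ (-s - 1)) ≤ Λ y := by
  set K := 48 * C / s
  have hK : 0 < K := by positivity
  have ht := tendsto_rpow_neg_atTop hs
  have h1 : ∀ᶠ M : ℝ in atTop, 2 * K * M ^ (-s) < δ := by
    have := ht.const_mul (2 * K)
    rw [mul_zero] at this
    exact this.eventually_lt_const hδ
  have h2 : ∀ᶠ M : ℝ in atTop, C * M ^ (-s) < 1 := by
    have := ht.const_mul C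
    rw [mul_zero] at this
    exact this.eventually_lt_const one_pos
  filter_upwards [h1, h2, eventually_ge_atTop 1] with M h1 h2 hM
  refine ⟨fun x => K * (2 * M ^ (-s) - x ^ (-s)), fun x hx => ?_⟩
  have hx1 : 1 ≤ x := hM.trans hx
  have hx0 : 0 < x := by linarith
  have hxM : x ^ (-s) ≤ M ^ (-s) :=
    Real.rpow_le_rpow_of_nonpos (by linarith) hx (by linarith)
  have hxp : 0 < x ^ (-s) := Real.rpow_pos_of_pos hx0 _
  have hxs : x ^ (-s - 1) = x ^ (-s) / x := by rw [Real.rpow_sub hx0, Real.rpow_one]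
  refine ⟨⟨mul_nonneg hK.le (by linarith), by nlinarith⟩, ⟨by positivity, ?_⟩, fun y hy => ?_⟩
  · rw [hxs]
    have : x ^ (-s) / x ≤ x ^ (-s) := div_le_self hxp.le hx1
    nlinarith
  · have hy' : y ^ (-s) ≤ (x + 1 / 4) ^ (-s) :=
      Real.rpow_le_rpow_of_nonpos (by linarith) hy (by linarith)
    set t := 1 / (4 * x)
    have ht0 : 0 < t := by positivity
    have ht1 : t ≤ 1 := by
      simp only [t]
      rw [div_le_one (by positivity)]
      linarith
    have hsplit : (x + 1 / 4) ^ (-s) = x ^ (-s) * (1 + t) ^ (-s) := by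
      rw [← Real.mul_rpow hx0.le (by positivity)]
      congr 1
      simp only [t]
      field_simp
    have hpow : 1 + s * t / 2 ≤ (1 + t) ^ s := by
      rw [Real.rpow_def_of_pos (by linarith)]
      have e1 := Real.add_one_le_exp (Real.log (1 + t) * s)
      have e2 : t / 2 ≤ Real.log (1 + t) := by
        have := Real.one_sub_inv_le_log_of_pos (show 0 < 1 + t by linarith)
        have e3 : t / 2 ≤ 1 - (1 + t)⁻¹ := by
          rw [← sub_nonneg, show 1 - (1 + t)⁻¹ - t / 2 = t * (1 - t) / (2 * (1 + t)) by
            field_simp; ring]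
          have : 0 ≤ 1 - t := by linarith
          positivity
        linarith
      nlinarith
    have hs' : (1 + t) ^ (-s) ≤ 1 - s * t / (2 + s * t) := by
      rw [Real.rpow_neg (by linarith)]
      have hst : 0 < s * t := by positivity
      calc ((1 + t) ^ s)⁻¹ ≤ (1 + s * t / 2)⁻¹ := inv_anti₀ (by positivity) hpow
        _ = _ := by field_simp; ring
    have hs'' : s * t / 4 ≤ s * t / (2 + s * t) := by
      have hst : s * t ≤ 2 := by nlinarith
      gcongr
      linarith
    rw [hxs]
    have e4 : 3 * (C * (x ^ (-s) / x)) = K * (x ^ (-s) * (s * t / 4)) := by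
      simp only [K, t]
      field_simp
      norm_num
    have e5 : y ^ (-s) ≤ x ^ (-s) * (1 - s * t / 4) :=
      hy'.trans (hsplit.le.trans (mul_le_mul_of_nonneg_left (by linarith) hxp.le))
    rw [e4, ← sub_nonneg]
    have := mul_le_mul_of_nonneg_left e5 hK.le
    linarith

/-- Partial sums of the orbit sum `∑ k (g^[j] z)`, `j ≥ 1`, truncated when the orbit leaves
`{M ≤ L}`. -/
noncomputable def orbitPartialSum (L : ℂ → ℝ) (M : ℝ) (g k : ℂ → ℂ) : ℕ → ℂ → ℂ
  | 0, _ => 0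
  | m + 1, z => if L z < M then 0 else k (g z) + orbitPartialSum L M g k m (g z)

section OrbitSum

variable {L : ℂ → ℝ} {M : ℝ} {g k : ℂ → ℂ}

lemma orbitPartialSum_of_lt (m : ℕ) {z : ℂ} (hz : L z < M) :
    orbitPartialSum L M g k m z = 0 := by
  cases m <;> simp [orbitPartialSum, hz]

lemma orbitPartialSum_succ (m : ℕ) {z : ℂ} (hz : M ≤ L z) :
    orbitPartialSum L M g k (m + 1) z = k (g z) + orbitPartialSum L M g k m (g z) := by
  simp [orbitPartialSum, hz.not_gt]

lemma orbitPartialSum_stable (h1 : ∀ z, M ≤ L z → L (g z) ≤ L z - 1 / 4)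
    (j m : ℕ) : ∀ z : ℂ, L z < M + m / 4 →
      orbitPartialSum L M g k (m + j) z = orbitPartialSum L M g k m z := by
  induction m with
  | zero =>
    intro z hz
    have hz : L z < M := by simpa using hz
    rw [orbitPartialSum_of_lt _ hz, orbitPartialSum_of_lt _ hz]
  | succ m ih =>
    intro z hz
    rcases lt_or_ge (L z) M with h | h
    · rw [orbitPartialSum_of_lt _ h, orbitPartialSum_of_lt _ h]
    · rw [show m + 1 + j = (m + j) + 1 by ring, orbitPartialSum_succ _ h,
        orbitPartialSum_succ _ h, ih]
      have := h1 z h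
      push_cast at hz
      linarith

lemma norm_orbitPartialSum_le {κ : ℝ} (hκ : 0 ≤ κ) (hM : 0 ≤ M)
    (h1 : ∀ z, M ≤ L z → L (g z) ≤ L z - 1 / 4)
    (hk0 : ∀ z, L z < M → k z = 0) (hk1 : ∀ z, ‖k z‖ ≤ κ) (m : ℕ) :
    ∀ z : ℂ, M ≤ L z → ‖orbitPartialSum L M g k m z‖ ≤ 4 * κ * L z := by
  induction m with
  | zero =>
    intro z hz
    have : 0 ≤ L z := hM.trans hz
    simp only [orbitPartialSum, norm_zero]
    positivity
  | succ m ih =>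
    intro z hz
    rw [orbitPartialSum_succ _ hz]
    rcases lt_or_ge (L (g z)) M with h | h
    · rw [hk0 _ h, orbitPartialSum_of_lt _ h]
      have : 0 ≤ L z := hM.trans hz
      simp only [add_zero, norm_zero]
      positivity
    · calc _ ≤ κ + 4 * κ * L (g z) := (norm_add_le _ _).trans (add_le_add (hk1 _) (ih _ h))
        _ ≤ κ + 4 * κ * (L z - 1 / 4) := by
          have := h1 z hz
          gcongr
        _ = _ := by ring

lemma orbitPartialSum_differentiableAt {ρ : ℂ → ℝ} {Λ q : ℝ → ℝ}
    (hL : ∀ z, z ≠ 0 → ContinuousAt L z) (hz0 : ∀ z, M ≤ L z → z ≠ 0)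
    (hg : ∀ z, M ≤ L z → DifferentiableAt ℂ g z) (hg0 : ∀ z, M ≤ L z → g z ≠ 0)
    (h1 : ∀ z, M ≤ L z → L (g z) ≤ L z - 1 / 4)
    (hρ : ∀ z, 0 ≤ ρ z)
    (h2 : ∀ z, M ≤ L z → M ≤ L (g z) → ‖deriv g z‖ * ρ z ≤ (1 + q (L (g z))) * ρ (g z))
    (hk0 : ∀ z, L z < M → k z = 0)
    (hkd : ∀ z, M ≤ L z → DifferentiableAt ℝ k z)
    (hk2 : ∀ z, M ≤ L z → ‖fderiv ℝ k z‖ * ρ z ≤ q (L z))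
    (hq : ∀ x, M ≤ x → 0 ≤ q x ∧ q x ≤ 1) (hΛ : ∀ x, M ≤ x → 0 ≤ Λ x ∧ Λ x ≤ 1)
    (hΛq : ∀ x, M ≤ x → ∀ y, x + 1 / 4 ≤ y → Λ x + 3 * q x ≤ Λ y) (m : ℕ) :
    ∀ z : ℂ, M ≤ L z → DifferentiableAt ℝ (orbitPartialSum L M g k m) z ∧
      ‖fderiv ℝ (orbitPartialSum L M g k m) z‖ * ρ z ≤ Λ (L z) := by
  have hconst : ∀ z, M ≤ L z → ∀ F : ℂ → ℂ, F =ᶠ[𝓝 z] (fun _ => 0) →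
      DifferentiableAt ℝ F z ∧ ‖fderiv ℝ F z‖ * ρ z ≤ Λ (L z) := by
    intro z hz F hF
    refine ⟨(differentiableAt_const _).congr_of_eventuallyEq hF, ?_⟩
    rw [hF.fderiv_eq]
    simpa using (hΛ _ hz).1
  induction m with
  | zero => exact fun z hz => hconst z hz _ (Eventually.of_forall fun _ => rfl)
  | succ m ih =>
    intro z hz
    rcases lt_or_ge (L (g z)) M with h | h
    · apply hconst z hz
      have hc : ContinuousAt (fun y => L (g y)) z :=
        ContinuousAt.comp (g := L) (hL _ (hg0 z hz)) (hg z hz).continuousAt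
      filter_upwards [hc.eventually_lt continuousAt_const h] with y hy
      rcases lt_or_ge (L y) M with h' | h'
      · exact orbitPartialSum_of_lt _ h'
      · rw [orbitPartialSum_succ _ h', hk0 _ hy, orbitPartialSum_of_lt _ hy, add_zero]
    · have hlt : M < L z := by linarith [h1 z hz]
      have hev : orbitPartialSum L M g k (m + 1) =ᶠ[𝓝 z]
          fun y => (k + orbitPartialSum L M g k m) (g y) := by
        filter_upwards [continuousAt_const.eventually_lt (hL z (hz0 z hz)) hlt] with y hy
        simpa using orbitPartialSum_succ m hy.le
      obtain ⟨hd, hb⟩ := ih _ h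
      have hD := ((hkd _ h).hasFDerivAt.add hd.hasFDerivAt).comp z
        ((hg z hz).hasDerivAt.hasFDerivAt.restrictScalars ℝ)
      have hD' := hD.congr_of_eventuallyEq hev
      refine ⟨hD'.differentiableAt, ?_⟩
      rw [hD'.fderiv]
      set A := fderiv ℝ k (g z)
      set B := fderiv ℝ (orbitPartialSum L M g k m) (g z)
      have hn : ‖(ContinuousLinearMap.toSpanSingleton ℂ (deriv g z)).restrictScalars ℝ‖
          ≤ ‖deriv g z‖ := by
        simp
      have hq' := hq _ h
      have hΛ' := hΛ _ h
      have hkb := hk2 _ h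
      have hρ' := hρ (g z)
      calc _ ≤ ((‖A‖ + ‖B‖) * ‖deriv g z‖) * ρ z := by
            refine mul_le_mul_of_nonneg_right ?_ (hρ z)
            refine (ContinuousLinearMap.opNorm_comp_le _ _).trans ?_
            gcongr
            exact norm_add_le _ _
        _ = (‖A‖ + ‖B‖) * (‖deriv g z‖ * ρ z) := by ring
        _ ≤ (‖A‖ + ‖B‖) * ((1 + q (L (g z))) * ρ (g z)) := by
            exact mul_le_mul_of_nonneg_left (h2 z hz h) (by positivity)
        _ = (1 + q (L (g z))) * (‖A‖ * ρ (g z) + ‖B‖ * ρ (g z)) := by ring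
        _ ≤ (1 + q (L (g z))) * (q (L (g z)) + Λ (L (g z))) := by
            gcongr
            linarith
        _ ≤ Λ (L (g z)) + 3 * q (L (g z)) := by nlinarith
        _ ≤ _ := hΛq _ h _ (by linarith [h1 z hz])

/-- Solution of the cohomological equation `v = (k + v) ∘ g` along orbits descending in `L`. -/
lemma exists_orbitSum {ρ : ℂ → ℝ} {Λ q : ℝ → ℝ} {κ : ℝ} (hκ : 0 ≤ κ) (hM : 0 ≤ M)
    (hL : ∀ z, z ≠ 0 → ContinuousAt L z) (hz0 : ∀ z, M ≤ L z → z ≠ 0)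
    (hg : ∀ z, M ≤ L z → DifferentiableAt ℂ g z) (hg0 : ∀ z, M ≤ L z → g z ≠ 0)
    (h1 : ∀ z, M ≤ L z → L (g z) ≤ L z - 1 / 4)
    (hρ : ∀ z, 0 ≤ ρ z)
    (h2 : ∀ z, M ≤ L z → M ≤ L (g z) → ‖deriv g z‖ * ρ z ≤ (1 + q (L (g z))) * ρ (g z))
    (hk0 : ∀ z, L z < M → k z = 0) (hk1 : ∀ z, ‖k z‖ ≤ κ)
    (hkd : ∀ z, M ≤ L z → DifferentiableAt ℝ k z)
    (hk2 : ∀ z, M ≤ L z → ‖fderiv ℝ k z‖ * ρ z ≤ q (L z))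
    (hq : ∀ x, M ≤ x → 0 ≤ q x ∧ q x ≤ 1) (hΛ : ∀ x, M ≤ x → 0 ≤ Λ x ∧ Λ x ≤ 1)
    (hΛq : ∀ x, M ≤ x → ∀ y, x + 1 / 4 ≤ y → Λ x + 3 * q x ≤ Λ y) :
    ∃ v : ℂ → ℂ, (∀ z, L z < M → v z = 0) ∧
      (∀ z, M ≤ L z → v z = k (g z) + v (g z)) ∧
      (∀ z, M ≤ L z → ‖v z‖ ≤ 4 * κ * L z) ∧
      ∀ z, M ≤ L z → DifferentiableAt ℝ v z ∧ ‖fderiv ℝ v z‖ * ρ z ≤ Λ (L z) := by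
  set N : ℂ → ℕ := fun z => ⌈4 * (L z - M)⌉₊ + 1
  have hN : ∀ z, L z < M + N z / 4 := by
    intro z
    have := Nat.le_ceil (4 * (L z - M))
    simp only [N]
    push_cast
    linarith
  set v : ℂ → ℂ := fun z => orbitPartialSum L M g k (N z) z
  have hv : ∀ m : ℕ, ∀ z, L z < M + m / 4 → v z = orbitPartialSum L M g k m z := by
    intro m z hz
    rw [← orbitPartialSum_stable h1 (N z) m z hz, add_comm,
      orbitPartialSum_stable h1 m (N z) z (hN z)]
  refine ⟨v, fun z hz => orbitPartialSum_of_lt _ hz, ?_,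
    fun z hz => norm_orbitPartialSum_le hκ hM h1 hk0 hk1 _ z hz, ?_⟩
  · intro z hz
    have e1 := h1 z hz
    have e2 := hN z
    rw [hv (N z + 1) z (by push_cast; linarith), orbitPartialSum_succ _ hz,
      hv (N z) (g z) (by linarith)]
  · intro z hz
    have hev : v =ᶠ[𝓝 z] orbitPartialSum L M g k (N z) := by
      filter_upwards [(hL z (hz0 z hz)).eventually_lt continuousAt_const (hN z)] with y hy
      exact hv _ _ hy
    obtain ⟨hd, hb⟩ := orbitPartialSum_differentiableAt hL hz0 hg hg0 h1 hρ h2 hk0 hkd hk2 hq hΛ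
      hΛq (N z) z hz
    exact ⟨hd.congr_of_eventuallyEq hev, by rwa [hev.fderiv_eq]⟩

end OrbitSum

section FatouCoordinate

/-- The coordinate in which `z ↦ z (1 + z ^ n + ⋯)` is close to the unit translation. -/
noncomputable def fatouCoord (n : ℕ) (z : ℂ) : ℂ := -((n : ℂ) * z ^ n)⁻¹

lemma norm_fatouCoord (n : ℕ) (z : ℂ) : ‖fatouCoord n z‖ = (n * ‖z‖ ^ n)⁻¹ := by
  simp [fatouCoord]

lemma fatouCoord_ne_zero {n : ℕ} (hn : 1 ≤ n) {z : ℂ} (hz : z ≠ 0) : fatouCoord n z ≠ 0 := by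
  have : (n : ℂ) ≠ 0 := by exact_mod_cast (by lia : n ≠ 0)
  simp [fatouCoord, this, hz]

lemma hasDerivAt_fatouCoord {n : ℕ} (hn : 1 ≤ n) {z : ℂ} (hz : z ≠ 0) :
    HasDerivAt (fatouCoord n) (z ^ (n + 1))⁻¹ z := by
  have hn0 : (n : ℂ) ≠ 0 := by exact_mod_cast (by lia : n ≠ 0)
  have h := (((hasDerivAt_pow n z).const_mul (n : ℂ)).inv (mul_ne_zero hn0 (pow_ne_zero n hz))).neg
  refine h.congr_deriv ?_
  obtain ⟨m, rfl⟩ : ∃ m, n = m + 1 := ⟨n - 1, by lia⟩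
  simp only [Nat.add_sub_cancel] at *
  field_simp
  ring

lemma norm_pow_succ_le_rpow {n : ℕ} (hn : 1 ≤ n) {z : ℂ} (hz : z ≠ 0) {x : ℝ} (hx : 0 < x)
    (hxz : x ≤ 3 / 2 * ‖fatouCoord n z‖) :
    ‖z‖ ^ (n + 1) ≤ 9 / 4 * x ^ (-(1 / (n : ℝ)) - 1) := by
  have hn1 : (1 : ℝ) ≤ n := by exact_mod_cast hn
  have hz' : 0 < ‖z‖ := norm_pos_iff.2 hz
  rw [norm_fatouCoord] at hxz
  have h1 : ‖z‖ ^ n ≤ 3 / 2 * x⁻¹ := by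
    have h2 : n * ‖z‖ ^ n ≤ 3 / 2 * x⁻¹ := by
      rw [← div_eq_mul_inv, le_div_iff₀ hx]
      calc _ ≤ n * ‖z‖ ^ n * (3 / 2 * (n * ‖z‖ ^ n)⁻¹) := by gcongr
        _ = 3 / 2 := by field_simp
    exact (le_mul_of_one_le_left (by positivity) hn1).trans h2
  have h3 : ‖z‖ ≤ 3 / 2 * x ^ (-(1 / (n : ℝ))) := by
    calc ‖z‖ = (‖z‖ ^ n) ^ (1 / (n : ℝ)) := by
          rw [one_div, Real.pow_rpow_inv_natCast hz'.le (by lia)]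
      _ ≤ (3 / 2 * x⁻¹) ^ (1 / (n : ℝ)) := Real.rpow_le_rpow (by positivity) h1 (by positivity)
      _ = (3 / 2) ^ (1 / (n : ℝ)) * x ^ (-(1 / (n : ℝ))) := by
          rw [Real.mul_rpow (by norm_num) (by positivity), Real.inv_rpow hx.le, Real.rpow_neg hx.le]
      _ ≤ (3 / 2) ^ (1 : ℝ) * x ^ (-(1 / (n : ℝ))) := by
          gcongr
          · norm_num
          · rw [div_le_one (by positivity)]
            exact hn1
      _ = _ := by rw [Real.rpow_one]
  rw [pow_succ, Real.rpow_sub hx, Real.rpow_one]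
  calc _ ≤ (3 / 2 * x⁻¹) * (3 / 2 * x ^ (-(1 / (n : ℝ)))) := by gcongr
    _ = _ := by ring

lemma AnalyticAt.exists_bound {F : ℂ → ℂ} (hF : AnalyticAt ℂ F 0) (h0 : F 0 = 0) :
    ∃ C : ℝ, 0 < C ∧ ∀ᶠ z in 𝓝 (0 : ℂ), DifferentiableAt ℂ F z ∧ ‖F z‖ ≤ C * ‖z‖ ∧
      ‖deriv F z‖ ≤ C := by
  have hO : F =O[𝓝 0] fun z : ℂ => z := by
    simpa [h0] using hF.differentiableAt.isBigO_sub
  obtain ⟨C, hC, hb⟩ := hO.exists_pos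
  have hd : ∀ᶠ z in 𝓝 (0 : ℂ), ‖deriv F z‖ < ‖deriv F 0‖ + 1 :=
    hF.deriv.continuousAt.norm.eventually_lt_const (by linarith)
  refine ⟨max C (‖deriv F 0‖ + 1), by positivity, ?_⟩
  filter_upwards [hF.eventually_analyticAt, hb.bound, hd] with z h1 h2 h3
  exact ⟨h1.differentiableAt, h2.trans (by gcongr; exact le_max_left _ _),
    h3.le.trans (le_max_right _ _)⟩

/-- Smallness of `v` at `z`, in absolute value and in derivative, measured in `fatouCoord n`. -/
def SmallAt (n : ℕ) (δ : ℝ) (v : ℂ → ℂ) (z : ℂ) : Prop :=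
  ‖v z‖ ≤ δ * ‖fatouCoord n z‖ ∧ DifferentiableAt ℝ v z ∧
    ‖fderiv ℝ v z‖ * ‖z‖ ^ (n + 1) ≤ δ

lemma SmallAt.add {n : ℕ} {δ₁ δ₂ : ℝ} {v₁ v₂ : ℂ → ℂ} {z : ℂ} (h₁ : SmallAt n δ₁ v₁ z)
    (h₂ : SmallAt n δ₂ v₂ z) : SmallAt n (δ₁ + δ₂) (fun y => v₁ y + v₂ y) z := by
  obtain ⟨a, b, c⟩ := h₁
  obtain ⟨a', b', c'⟩ := h₂
  refine ⟨(norm_add_le _ _).trans (by linarith), b.add b', ?_⟩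
  rw [fderiv_fun_add b b']
  have := mul_le_mul_of_nonneg_right (norm_add_le (fderiv ℝ v₁ z) (fderiv ℝ v₂ z))
    (show 0 ≤ ‖z‖ ^ (n + 1) by positivity)
  linarith

lemma SmallAt.of_eventuallyEq_zero {n : ℕ} {δ : ℝ} (hδ : 0 ≤ δ) {v : ℂ → ℂ} {z : ℂ}
    (h : v =ᶠ[𝓝 z] fun _ => 0) : SmallAt n δ v z := by
  refine ⟨?_, (differentiableAt_const _).congr_of_eventuallyEq h, ?_⟩
  · rw [h.eq_of_nhds, norm_zero]
    positivity
  · rw [h.fderiv_eq]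
    simpa using hδ

lemma sectorCutoff_mul_differentiableAt {n : ℕ} (hn : 1 ≤ n) {σ M C₀ C₁ : ℝ} (hσ : |σ| = 1)
    (hC₀ : ∀ w : ℂ, w ≠ 0 → DifferentiableAt ℝ (sectorCutoff M) w ∧
      ‖fderiv ℝ (sectorCutoff M) w‖ * ‖w‖ ≤ C₀)
    {h : ℂ → ℂ} {z : ℂ} (hz : z ≠ 0) (hd : DifferentiableAt ℂ h z) (hh : ‖h z‖ ≤ C₁ * ‖z‖)
    (hh' : ‖deriv h z‖ ≤ C₁) :
    DifferentiableAt ℝ (fun z => (sectorCutoff M (σ * fatouCoord n z) : ℂ) * h z) z ∧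
    ‖fderiv ℝ (fun z => (sectorCutoff M (σ * fatouCoord n z) : ℂ) * h z) z‖ * ‖z‖ ^ (n + 1) ≤
      (C₀ * n + 1) * C₁ * ‖z‖ ^ (n + 1) := by
  have hσ0 : (σ : ℂ) ≠ 0 := by
    rintro h
    simp [Complex.ofReal_eq_zero.1 h] at hσ
  have hσn : ‖(σ : ℂ)‖ = 1 := by simpa using hσ
  have hz' : 0 < ‖z‖ := norm_pos_iff.2 hz
  have hn1 : (1 : ℝ) ≤ n := by exact_mod_cast hn
  obtain ⟨hβ, hβ'⟩ := hC₀ (σ * fatouCoord n z) (mul_ne_zero hσ0 (fatouCoord_ne_zero hn hz))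
  rw [norm_mul, hσn, one_mul, norm_fatouCoord] at hβ'
  have hw := ((hasDerivAt_fatouCoord hn hz).const_mul (σ : ℂ)).hasFDerivAt.restrictScalars ℝ
  have hβw := hβ.hasFDerivAt.comp z hw
  have hh0 := hd.hasDerivAt.hasFDerivAt.restrictScalars ℝ
  have hk := hβw.smul hh0
  have he : (fun z => (sectorCutoff M (σ * fatouCoord n z) : ℂ) * h z) =
      (sectorCutoff M ∘ fun z => σ * fatouCoord n z) • h := by
    ext y
    simp
  rw [he]
  refine ⟨hk.differentiableAt, ?_⟩
  rw [hk.fderiv]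
  set B := fderiv ℝ (sectorCutoff M) (σ * fatouCoord n z)
  refine mul_le_mul_of_nonneg_right (c := (C₀ * n + 1) * C₁) ?_ (by positivity)
  have hB : ‖B‖ ≤ C₀ * (n * ‖z‖ ^ n) := by
    rwa [← div_eq_mul_inv, div_le_iff₀ (by positivity)] at hβ'
  have hC₀' : 0 ≤ C₀ := by
    by_contra! hneg
    have := (norm_nonneg B).trans hB
    have : C₀ * (n * ‖z‖ ^ n) < 0 := mul_neg_of_neg_of_pos hneg (by positivity)
    linarith
  refine (norm_add_le _ _).trans ?_
  have e1 : ‖(sectorCutoff M ∘ fun z => σ * fatouCoord n z) z •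
      (ContinuousLinearMap.toSpanSingleton ℂ (deriv h z)).restrictScalars ℝ‖ ≤ 1 * C₁ := by
    rw [norm_smul]
    refine mul_le_mul (norm_sectorCutoff_le_one _ _) ?_ (norm_nonneg _) zero_le_one
    simpa using hh'
  have e2 : ‖(B.comp ((ContinuousLinearMap.toSpanSingleton ℂ
      (σ * (z ^ (n + 1))⁻¹)).restrictScalars ℝ)).smulRight (h z)‖ ≤ C₀ * n * C₁ := by
    rw [ContinuousLinearMap.norm_smulRight_apply]
    have e3 : ‖B.comp ((ContinuousLinearMap.toSpanSingleton ℂ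
        (σ * (z ^ (n + 1))⁻¹)).restrictScalars ℝ)‖ ≤ ‖B‖ * (‖z‖ ^ (n + 1))⁻¹ := by
      refine (ContinuousLinearMap.opNorm_comp_le _ _).trans ?_
      gcongr
      simp [hσ]
    calc _ ≤ (C₀ * (n * ‖z‖ ^ n)) * (‖z‖ ^ (n + 1))⁻¹ * (C₁ * ‖z‖) := by
          gcongr
          exact e3.trans (by gcongr)
      _ = _ := by
          field_simp
          ring
  linarith

/-- Solution of `v = (k + v) ∘ g` for `k` a cutoff of an analytic germ vanishing at `0`. -/
lemma exists_cohomological_solution {n : ℕ} (hn : 1 ≤ n) {σ : ℝ} (hσ : |σ| = 1) {g η h : ℂ → ℂ}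
    (hg : AnalyticAt ℂ g 0) (hη : AnalyticAt ℂ η 0) (hη0 : η 0 = 0) (hh : AnalyticAt ℂ h 0)
    (hh0 : h 0 = 0) (hg0 : ∀ᶠ z in 𝓝[≠] (0 : ℂ), g z ≠ 0)
    (hW : ∀ᶠ z in 𝓝[≠] (0 : ℂ), σ * fatouCoord n (g z) = σ * fatouCoord n z - 1 + η z)
    {δ : ℝ} (hδ : 0 < δ) :
    ∀ᶠ M : ℝ in atTop, ∃ v : ℂ → ℂ, ∀ᶠ z in 𝓝[≠] (0 : ℂ),
      v z = (sectorCutoff M (σ * fatouCoord n (g z)) : ℂ) * h (g z) + v (g z) ∧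
      SmallAt n δ v z ∧
      SmallAt n δ (fun z => (sectorCutoff M (σ * fatouCoord n z) : ℂ) * h z) z := by
  obtain ⟨C₀, hC₀, hcut⟩ := exists_fderiv_sectorCutoff_le
  obtain ⟨Cη, hCη, hηb⟩ := hη.exists_bound hη0
  obtain ⟨Ch, hCh, hhb⟩ := hh.exists_bound hh0
  have hn1 : (1 : ℝ) ≤ n := by exact_mod_cast hn
  have hσ0 : (σ : ℂ) ≠ 0 := by
    rintro h
    simp [Complex.ofReal_eq_zero.1 h] at hσ
  have hσn : ‖(σ : ℂ)‖ = 1 := by simpa using hσ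
  set C₁ := max Cη Ch
  have hC₁ : 0 < C₁ := lt_max_of_lt_left hCη
  set C₂ := (C₀ * n + 1) * C₁
  have hC₂ : 0 < C₂ := by positivity
  have hC₁₂ : C₁ ≤ C₂ := le_mul_of_one_le_left hC₁.le (le_add_of_nonneg_left (by positivity))
  have hs1 : ∀ᶠ z in 𝓝 (0 : ℂ), ‖z‖ < min (1 / (8 * C₁)) (δ / (6 * C₁)) := by
    filter_upwards [Metric.ball_mem_nhds (0 : ℂ)
      (show 0 < min (1 / (8 * C₁)) (δ / (6 * C₁)) by positivity)] with z hz
    simpa using hz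
  have hs2 : ∀ᶠ z in 𝓝 (0 : ℂ), C₂ * ‖z‖ ^ (n + 1) < δ := by
    have : ContinuousAt (fun z : ℂ => C₂ * ‖z‖ ^ (n + 1)) 0 := by fun_prop
    exact this.eventually_lt_const (by simpa using hδ)
  have hWev := hW
  rw [← eventually_eventually_nhdsWithin] at hWev
  have hall : ∀ᶠ z in 𝓝[≠] (0 : ℂ), z ≠ 0 ∧ g z ≠ 0 ∧ DifferentiableAt ℂ g z ∧
      ‖deriv g z‖ * ‖z‖ ^ (n + 1) ≤ (1 + C₁ * ‖z‖ ^ (n + 1)) * ‖g z‖ ^ (n + 1) ∧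
      σ * fatouCoord n (g z) = σ * fatouCoord n z - 1 + η z ∧ ‖η z‖ ≤ 1 / 8 ∧
      DifferentiableAt ℂ h z ∧ ‖h z‖ ≤ C₁ * ‖z‖ ∧ ‖h z‖ ≤ δ / 6 ∧ ‖deriv h z‖ ≤ C₁ ∧
      C₂ * ‖z‖ ^ (n + 1) ≤ δ := by
    filter_upwards [hW, hWev, hg0, self_mem_nhdsWithin, hηb.filter_mono nhdsWithin_le_nhds,
      hhb.filter_mono nhdsWithin_le_nhds, hs1.filter_mono nhdsWithin_le_nhds,
      hs2.filter_mono nhdsWithin_le_nhds,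
      hg.eventually_analyticAt.filter_mono nhdsWithin_le_nhds]
      with z hWz hWz' hgz hz hηz hhz hsz hsz2 hga
    have hz : z ≠ 0 := hz
    obtain ⟨hs3, hs4⟩ := lt_min_iff.1 hsz
    have hs3 : C₁ * ‖z‖ ≤ 1 / 8 := by
      rw [lt_div_iff₀ (by positivity)] at hs3
      linarith
    have hs4 : C₁ * ‖z‖ ≤ δ / 6 := by
      rw [lt_div_iff₀ (by positivity)] at hs4
      linarith
    have hh1 : ‖h z‖ ≤ C₁ * ‖z‖ := hhz.2.1.trans (by gcongr; exact le_max_right _ _)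
    have hη1 : ‖η z‖ ≤ C₁ * ‖z‖ := hηz.2.1.trans (by gcongr; exact le_max_left _ _)
    refine ⟨hz, hgz, hga.differentiableAt, ?_, hWz, hη1.trans hs3, hhz.1, hh1, hh1.trans hs4,
      hhz.2.2.trans (le_max_right _ _), hsz2.le⟩
    have hd1 := ((hasDerivAt_fatouCoord hn hgz).comp z
      hga.differentiableAt.hasDerivAt).const_mul (σ : ℂ)
    have hd2 := (((hasDerivAt_fatouCoord hn hz).const_mul (σ : ℂ)).sub_const 1).add
      hηz.1.hasDerivAt
    have hev : (fun y => σ * fatouCoord n (g y)) =ᶠ[𝓝 z]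
        fun y => σ * fatouCoord n y - 1 + η y := by
      rwa [hz.nhdsWithin_compl_singleton] at hWz'
    have heq := hd1.unique (hd2.congr_of_eventuallyEq hev)
    have hnorm : (‖g z‖ ^ (n + 1))⁻¹ * ‖deriv g z‖ ≤ (‖z‖ ^ (n + 1))⁻¹ + C₁ := by
      calc _ = ‖σ * ((g z ^ (n + 1))⁻¹ * deriv g z)‖ := by simp [hσ]
        _ = _ := congrArg norm heq
        _ ≤ ‖σ * (z ^ (n + 1))⁻¹‖ + ‖deriv η z‖ := norm_add_le _ _
        _ ≤ _ := by
          refine add_le_add (by simp [hσ]) (hηz.2.2.trans (le_max_left _ _))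
    have hz' : 0 < ‖z‖ ^ (n + 1) := pow_pos (norm_pos_iff.2 hz) _
    have hg' : 0 < ‖g z‖ ^ (n + 1) := pow_pos (norm_pos_iff.2 hgz) _
    rw [inv_mul_le_iff₀ hg'] at hnorm
    calc _ ≤ (‖g z‖ ^ (n + 1) * ((‖z‖ ^ (n + 1))⁻¹ + C₁)) * ‖z‖ ^ (n + 1) := by gcongr
      _ = _ := by field_simp
  rw [eventually_nhdsWithin_iff, Metric.eventually_nhds_iff] at hall
  obtain ⟨r, hr, hall⟩ := hall
  have hall' := fun z (hz : z ≠ 0) (hzr : ‖z‖ < r) => hall (by simpa using hzr) hz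
  set L : ℂ → ℝ := fun z => (σ * fatouCoord n z).re + ‖fatouCoord n z‖ / 2
  have hLW : ∀ z, L z ≤ 3 / 2 * ‖fatouCoord n z‖ := by
    intro z
    have := Complex.re_le_norm (σ * fatouCoord n z)
    rw [norm_mul, hσn, one_mul] at this
    simp only [L]
    linarith
  have hLc : ∀ z, z ≠ 0 → ContinuousAt L z := by
    intro z hz
    have := (hasDerivAt_fatouCoord hn hz).continuousAt
    exact (Complex.continuous_re.continuousAt.comp (this.const_mul _)).add
      (this.norm.div_const 2)
  have hdesc : ∀ z, z ≠ 0 → ‖z‖ < r → L (g z) ≤ L z - 1 / 4 := by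
    intro z hz hzr
    obtain ⟨-, -, -, -, hWz, hηz, -⟩ := hall' z hz hzr
    have h1 : ‖fatouCoord n (g z)‖ ≤ ‖fatouCoord n z‖ + 1 + ‖η z‖ := by
      have e1 : ‖fatouCoord n (g z)‖ = ‖σ * fatouCoord n (g z)‖ := by simp [hσ]
      have e2 : ‖fatouCoord n z‖ = ‖σ * fatouCoord n z‖ := by simp [hσ]
      rw [e1, hWz, e2]
      refine (norm_add_le _ _).trans ?_
      gcongr
      simpa using norm_sub_le (σ * fatouCoord n z) 1
    have h2 := congrArg Complex.re hWz
    rw [Complex.add_re, Complex.sub_re, Complex.one_re] at h2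
    have h3 := Complex.re_le_norm (η z)
    simp only [L]
    linarith
  have hδ' : 0 < min δ 1 := by positivity
  filter_upwards [exists_lyapunov (s := 1 / n) (C := 9 / 4 * C₂) (by positivity)
    ((div_le_one (by positivity)).2 hn1) (by positivity) hδ', eventually_ge_atTop 1,
    eventually_gt_atTop (3 / 2 * (n * r ^ n)⁻¹)] with M hΛ hM1 hMr
  obtain ⟨Λ, hΛ⟩ := hΛ
  have hM0 : 0 < M := by linarith
  have hMz : ∀ z, M ≤ L z → z ≠ 0 ∧ ‖z‖ < r := by
    intro z hz
    have h1 := hz.trans (hLW z)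
    constructor
    · rintro rfl
      rw [norm_fatouCoord, norm_zero, zero_pow (by lia), mul_zero, inv_zero] at h1
      linarith
    · by_contra! hzr
      have : ‖fatouCoord n z‖ ≤ (n * r ^ n)⁻¹ := by
        rw [norm_fatouCoord]
        gcongr
      linarith
  set k : ℂ → ℂ := fun z => (sectorCutoff M (σ * fatouCoord n z) : ℂ) * h z
  have hk0 : ∀ z, L z < M → k z = 0 := by
    intro z hz
    by_contra hne
    have h1 : sectorCutoff M (σ * fatouCoord n z) ≠ 0 := by
      intro h0
      simp [k, h0] at hne
    have := le_of_sectorCutoff_ne_zero hM0 h1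
    rw [norm_mul, hσn, one_mul] at this
    simp only [L] at hz
    linarith
  have hk1 : ∀ z, ‖k z‖ ≤ δ / 6 := by
    intro z
    rcases lt_or_ge (L z) M with hz | hz
    · rw [hk0 z hz, norm_zero]
      positivity
    · obtain ⟨hz0, hzr⟩ := hMz z hz
      obtain ⟨-, -, -, -, -, -, -, -, hhz, -⟩ := hall' z hz0 hzr
      simp only [k, norm_mul, Complex.norm_real]
      calc _ ≤ 1 * (δ / 6) := mul_le_mul (norm_sectorCutoff_le_one _ _) hhz (norm_nonneg _)
            zero_le_one
        _ = _ := one_mul _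
  have hkd : ∀ z, z ≠ 0 → ‖z‖ < r → DifferentiableAt ℝ k z ∧
      ‖fderiv ℝ k z‖ * ‖z‖ ^ (n + 1) ≤ C₂ * ‖z‖ ^ (n + 1) := by
    intro z hz hzr
    obtain ⟨-, -, -, -, -, -, hd, hh1, -, hh2, -⟩ := hall' z hz hzr
    exact sectorCutoff_mul_differentiableAt hn hσ (hcut M hM0) hz hd hh1 hh2
  have hpow : ∀ z x, z ≠ 0 → M ≤ x → x ≤ L z →
      C₂ * ‖z‖ ^ (n + 1) ≤ 9 / 4 * C₂ * x ^ (-(1 / (n : ℝ)) - 1) := by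
    intro z x hz hx hxz
    have := norm_pow_succ_le_rpow hn hz (hM0.trans_le hx) (hxz.trans (hLW z))
    calc _ ≤ C₂ * (9 / 4 * x ^ (-(1 / (n : ℝ)) - 1)) := by gcongr
      _ = _ := by ring
  obtain ⟨v, hv0, hveq, hvb, hvd⟩ := exists_orbitSum (L := L) (M := M) (g := g) (k := k)
    (ρ := fun z => ‖z‖ ^ (n + 1)) (Λ := Λ)
    (q := fun x => 9 / 4 * C₂ * x ^ (-(1 / (n : ℝ)) - 1)) (κ := δ / 6)
    (by positivity) hM0.le hLc (fun z hz => (hMz z hz).1)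
    (fun z hz => (hall' z (hMz z hz).1 (hMz z hz).2).2.2.1)
    (fun z hz => (hall' z (hMz z hz).1 (hMz z hz).2).2.1)
    (fun z hz => hdesc z (hMz z hz).1 (hMz z hz).2) (fun z => by positivity)
    (fun z hz hgz => by
      have hz' := hMz z hz
      refine (hall' z hz'.1 hz'.2).2.2.2.1.trans ?_
      have := hpow z (L (g z)) hz'.1 hgz (by linarith [hdesc z hz'.1 hz'.2])
      refine mul_le_mul_of_nonneg_right ?_ (by positivity)
      have h3 : C₁ * ‖z‖ ^ (n + 1) ≤ C₂ * ‖z‖ ^ (n + 1) := by gcongr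
      linarith) hk0 hk1
    (fun z hz => (hkd z (hMz z hz).1 (hMz z hz).2).1)
    (fun z hz => (hkd z (hMz z hz).1 (hMz z hz).2).2.trans (hpow z _ (hMz z hz).1 hz le_rfl))
    (fun x hx => (hΛ x hx).2.1)
    (fun x hx => ⟨(hΛ x hx).1.1, (hΛ x hx).1.2.trans (min_le_right _ _)⟩)
    (fun x hx => (hΛ x hx).2.2)
  refine ⟨v, ?_⟩
  rw [eventually_nhdsWithin_iff, Metric.eventually_nhds_iff]
  refine ⟨r, hr, fun z hzr hz => ?_⟩
  have hz : z ≠ 0 := hz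
  have hzr : ‖z‖ < r := by simpa using hzr
  rcases lt_or_ge (L z) M with hlt | hge
  · have hev : ∀ F : ℂ → ℂ, (∀ y, L y < M → F y = 0) → F =ᶠ[𝓝 z] fun _ => 0 := by
      intro F hF
      filter_upwards [(hLc z hz).eventually_lt continuousAt_const hlt] with y hy
      exact hF y hy
    refine ⟨?_, .of_eventuallyEq_zero hδ.le (hev v hv0), .of_eventuallyEq_zero hδ.le (hev k hk0)⟩
    have hglt : L (g z) < M := by linarith [hdesc z hz hzr]
    change v z = k (g z) + v (g z)
    rw [hv0 _ hlt, hv0 _ hglt, hk0 _ hglt, add_zero]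
  · have hge' := hge.trans (hLW z)
    refine ⟨hveq z hge, ⟨?_, (hvd z hge).1, ?_⟩, ?_, (hkd z hz hzr).1, ?_⟩
    · calc _ ≤ 4 * (δ / 6) * L z := hvb z hge
        _ ≤ 4 * (δ / 6) * (3 / 2 * ‖fatouCoord n z‖) := by gcongr; exact hLW z
        _ = _ := by ring
    · exact (hvd z hge).2.trans ((hΛ _ hge).1.2.trans (min_le_left _ _))
    · refine (hk1 z).trans ?_
      nlinarith
    · exact (hkd z hz hzr).2.trans (hall' z hz hzr).2.2.2.2.2.2.2.2.2.2

end FatouCoordinate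

lemma AnalyticAt.exists_eq_pow_mul_of_isLittleO {F : ℂ → ℂ} {m : ℕ} (hF : AnalyticAt ℂ F 0)
    (ho : F =o[𝓝 0] fun z => z ^ m) :
    ∃ q : ℂ → ℂ, AnalyticAt ℂ q 0 ∧ q 0 = 0 ∧ ∀ᶠ z in 𝓝 0, F z = z ^ m * q z := by
  by_cases htop : analyticOrderAt F 0 = ⊤
  · refine ⟨fun _ => 0, analyticAt_const, rfl, ?_⟩
    filter_upwards [analyticOrderAt_eq_top.1 htop] with z hz
    simp [hz]
  obtain ⟨p, hp, hp0, he⟩ := (hF.analyticOrderAt_ne_top).1 htop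
  set k := analyticOrderNatAt F 0
  simp only [sub_zero, smul_eq_mul] at he
  have hk : m < k := by
    by_contra! hkm
    have h1 : (fun z : ℂ => z ^ m) =O[𝓝 0] fun z => z ^ k := by
      obtain ⟨j, rfl⟩ := Nat.exists_eq_add_of_le hkm
      have : (fun z : ℂ => z ^ j) =O[𝓝 0] fun _ => (1 : ℂ) :=
        ((continuous_pow j).tendsto 0).isBigO_one ℂ
      simpa [pow_add] using (isBigO_refl (fun z : ℂ => z ^ k) (𝓝 0)).mul this
    have h2 : (fun z => z ^ k * p z) =o[𝓝 0] fun z => z ^ k := (ho.trans_isBigO h1).congr' he .rfl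
    have h3 : Tendsto p (𝓝[≠] 0) (𝓝 0) := by
      refine ((h2.mono nhdsWithin_le_nhds).tendsto_div_nhds_zero).congr' ?_
      filter_upwards [self_mem_nhdsWithin] with z hz
      have hz : z ≠ 0 := hz
      field_simp
    exact hp0 (tendsto_nhds_unique (hp.continuousAt.tendsto.mono_left nhdsWithin_le_nhds) h3)
  obtain ⟨j, hj⟩ := Nat.exists_eq_add_of_lt hk
  refine ⟨fun z => z ^ (j + 1) * p z, by fun_prop, by simp, ?_⟩
  filter_upwards [he] with z hz
  rw [hz, hj]
  ring

lemma exists_fatouCoord_normalForm {n : ℕ} (hn : 1 ≤ n) {f : ℂ → ℂ} (hf : AnalyticAt ℂ f 0)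
    (hfexp : (fun z : ℂ => f z - z * (1 + z ^ n)) =o[𝓝 (0 : ℂ)] fun z : ℂ => z ^ (n + 1)) :
    f 0 = 0 ∧ deriv f 0 = 1 ∧ (∀ᶠ z in 𝓝[≠] 0, f z ≠ 0) ∧
    ∃ ε : ℂ → ℂ, AnalyticAt ℂ ε 0 ∧ ε 0 = 0 ∧
      ∀ᶠ z in 𝓝[≠] 0, fatouCoord n (f z) = fatouCoord n z + 1 + ε z := by
  obtain ⟨q, hq, hq0, he⟩ := AnalyticAt.exists_eq_pow_mul_of_isLittleO
    (show AnalyticAt ℂ (fun z : ℂ => f z - z * (1 + z ^ n)) 0 by fun_prop) hfexp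
  have hn0 : n ≠ 0 := by omega
  have hnC : (n : ℂ) ≠ 0 := by exact_mod_cast hn0
  set y : ℂ → ℂ := fun z => z ^ n * (1 + q z) with hy
  have hya : AnalyticAt ℂ y 0 := by fun_prop
  have hy0 : y 0 = 0 := by simp [hy, hn0]
  have hfy : ∀ᶠ z in 𝓝 0, f z = z * (1 + y z) := by
    filter_upwards [he] with z hz
    rw [sub_eq_iff_eq_add.1 hz, hy]
    ring
  have hy1 : ∀ᶠ z in 𝓝 0, 1 + y z ≠ 0 :=
    ContinuousAt.eventually_ne (by fun_prop) (by simp [hy0])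
  refine ⟨by simpa using hfy.self_of_nhds, ?_, ?_, ?_⟩
  · rw [EventuallyEq.deriv_eq hfy]
    have h1 := (hasDerivAt_id (0 : ℂ)).mul ((hya.differentiableAt.hasDerivAt).const_add 1)
    simpa [hy0] using! h1.deriv
  · filter_upwards [self_mem_nhdsWithin, hfy.filter_mono nhdsWithin_le_nhds,
      hy1.filter_mono nhdsWithin_le_nhds] with z hz h1 h2
    rw [h1]
    exact mul_ne_zero hz h2
  · refine ⟨fun z => (1 + q z) * (∑ i ∈ Finset.range n, (1 + y z) ^ i) / (n * (1 + y z) ^ n) - 1,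
      ?_, ?_, ?_⟩
    · refine AnalyticAt.sub (AnalyticAt.div ?_ ?_ ?_) analyticAt_const
      · refine AnalyticAt.mul (by fun_prop) (Finset.analyticAt_fun_sum _ fun i _ => by fun_prop)
      · fun_prop
      · simp [hy0, hnC]
    · simp [hy0, hq0, hnC]
    · filter_upwards [self_mem_nhdsWithin, hfy.filter_mono nhdsWithin_le_nhds,
        hy1.filter_mono nhdsWithin_le_nhds] with z hz h1 h2
      have hz : z ≠ 0 := hz
      have hg := geom_sum_mul (1 + y z) n
      rw [add_sub_cancel_left] at hg
      have hq1 : y z = z ^ n * (1 + q z) := rfl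
      rw [h1, fatouCoord, fatouCoord]
      generalize (∑ i ∈ Finset.range n, (1 + y z) ^ i) = S at *
      rw [mul_pow]
      have h3 : (1 + y z) ^ n ≠ 0 := pow_ne_zero _ h2
      generalize (1 + y z) ^ n = Y at *
      have hzn : z ^ n ≠ 0 := pow_ne_zero _ hz
      field_simp
      rw [hq1] at hg
      linear_combination -hg

lemma exists_analytic_localInverse {f : ℂ → ℂ} (hf : AnalyticAt ℂ f 0) (hf0 : f 0 = 0)
    (hd : deriv f 0 ≠ 0) : ∃ g : ℂ → ℂ, AnalyticAt ℂ g 0 ∧ g 0 = 0 ∧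
      (∀ᶠ z in 𝓝 0, f (g z) = z) ∧ ∀ᶠ z in 𝓝 0, g (f z) = z := by
  refine ⟨hf.hasStrictDerivAt.localInverse _ _ _ hd, ?_, ?_, ?_, ?_⟩
  · simpa [hf0] using hf.analyticAt_localInverse hd
  · have : hf.hasStrictDerivAt.localInverse _ _ _ hd (f 0) = 0 :=
      HasStrictFDerivAt.localInverse_apply_image ..
    rwa [hf0] at this
  · have := HasStrictDerivAt.eventually_right_inverse hf.hasStrictDerivAt hd
    rwa [hf0] at this
  · exact HasStrictDerivAt.eventually_left_inverse hf.hasStrictDerivAt hd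

lemma exists_abel_correction {n : ℕ} (hn : 1 ≤ n) {f : ℂ → ℂ} (hf : AnalyticAt ℂ f 0)
    (hfexp : (fun z : ℂ => f z - z * (1 + z ^ n)) =o[𝓝 (0 : ℂ)] fun z : ℂ => z ^ (n + 1))
    {δ : ℝ} (hδ : 0 < δ) :
    ∃ u : ℂ → ℂ, ∀ᶠ z in 𝓝[≠] 0, SmallAt n δ u z ∧
      fatouCoord n (f z) + u (f z) = fatouCoord n z + u z + 1 := by
  obtain ⟨hf0, hd, hfne, ε, hε, hε0, hW⟩ := exists_fatouCoord_normalForm hn hf hfexp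
  obtain ⟨g, hg, hg0, hfg, hgf⟩ := exists_analytic_localInverse hf hf0 (by simp [hd])
  have hεg : AnalyticAt ℂ (fun z => ε (g z)) 0 :=
    AnalyticAt.fun_comp (by rwa [hg0]) hg
  have hgne : ∀ᶠ z in 𝓝[≠] 0, g z ≠ 0 := by
    filter_upwards [hfg.filter_mono nhdsWithin_le_nhds, self_mem_nhdsWithin] with z hz hz0 h
    exact hz0 (by rw [← hz, h, hf0]; rfl)
  have htf : Tendsto f (𝓝[≠] 0) (𝓝[≠] 0) :=
    tendsto_nhdsWithin_iff.2 ⟨by simpa [hf0] using hf.continuousAt.continuousWithinAt.tendsto, hfne⟩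
  have htg : Tendsto g (𝓝[≠] 0) (𝓝[≠] 0) :=
    tendsto_nhdsWithin_iff.2 ⟨by simpa [hg0] using hg.continuousAt.continuousWithinAt.tendsto, hgne⟩
  have hWg : ∀ᶠ z in 𝓝[≠] (0 : ℂ), ((1 : ℝ) : ℂ) * fatouCoord n (g z) =
      ((1 : ℝ) : ℂ) * fatouCoord n z - 1 + -ε (g z) := by
    filter_upwards [htg.eventually hW, hfg.filter_mono nhdsWithin_le_nhds] with z h1 h2
    rw [h2] at h1
    rw [h1]
    push_cast
    ring
  have hWf : ∀ᶠ z in 𝓝[≠] (0 : ℂ), ((-1 : ℝ) : ℂ) * fatouCoord n (f z) =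
      ((-1 : ℝ) : ℂ) * fatouCoord n z - 1 + -ε z := by
    filter_upwards [hW] with z h1
    rw [h1]
    push_cast
    ring
  have hM := (exists_cohomological_solution hn (by norm_num) hg hεg.neg (by simp [hg0, hε0])
    hε.neg (by simp [hε0]) hgne hWg (show 0 < δ / 3 by positivity)).and <|
    (exists_cohomological_solution hn (by norm_num) hf hε.neg (by simp [hε0])
    hε (by simp [hε0]) hfne hWf (show 0 < δ / 3 by positivity)).and (eventually_gt_atTop 0)
  obtain ⟨M, ⟨v, hv⟩, ⟨w, hw⟩, hM⟩ := hM.exists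
  refine ⟨fun z => v z + (w z + (sectorCutoff M (((-1 : ℝ) : ℂ) * fatouCoord n z) : ℂ) * ε z), ?_⟩
  have hlarge : ∀ᶠ z in 𝓝[≠] (0 : ℂ), 8 * M ≤ ‖fatouCoord n z‖ := by
    have h1 : Tendsto (fun z : ℂ => (n : ℝ) * ‖z‖ ^ n) (𝓝[≠] 0) (𝓝[>] 0) := by
      refine tendsto_nhdsWithin_iff.2 ⟨?_, ?_⟩
      · have : ContinuousAt (fun z : ℂ => (n : ℝ) * ‖z‖ ^ n) 0 := by fun_prop
        simpa [show n ≠ 0 by omega] using this.continuousWithinAt.tendsto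
      · filter_upwards [self_mem_nhdsWithin] with z hz
        have := norm_pos_iff.2 hz
        have : (0 : ℝ) < n := by exact_mod_cast hn
        exact Set.mem_Ioi.2 (by positivity)
    filter_upwards [(tendsto_inv_nhdsGT_zero.comp h1).eventually_ge_atTop (8 * M)] with z hz
    rwa [norm_fatouCoord]
  filter_upwards [hv, hw, htf.eventually hv, hW, hlarge, hgf.filter_mono nhdsWithin_le_nhds]
    with z h1 h2 h3 h4 h5 h6
  refine ⟨?_, ?_⟩
  · have := h1.2.1.add (h2.2.1.add h2.2.2)
    rwa [show δ / 3 + (δ / 3 + δ / 3) = δ by ring] at this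
  · have hcut := sectorCutoff_add_sectorCutoff_neg hM h5
    have hcut : (sectorCutoff M (fatouCoord n z) : ℂ) + sectorCutoff M (-fatouCoord n z) = 1 := by
      exact_mod_cast hcut
    have h7 := h3.1
    have h8 := h2.1
    simp only [h6, Pi.neg_apply, Complex.ofReal_neg, Complex.ofReal_one, neg_mul, one_mul]
      at h7 h8 ⊢
    linear_combination h4 + h7 - h8 - ε z * hcut

lemma exists_analytic_root (n : ℕ) (hn : 1 ≤ n) : ∃ (Q : ℂ → ℂ) (C ρ : ℝ), 0 < C ∧ 0 < ρ ∧
    ∀ x : ℂ, ‖x‖ < ρ → 1 + x ≠ 0 ∧ DifferentiableAt ℂ Q x ∧ ‖deriv Q x‖ ≤ C ∧ ‖Q x‖ ≤ C * ‖x‖ ∧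
      (1 + Q x) ^ n = (1 + x)⁻¹ := by
  have hnC : (n : ℂ) ≠ 0 := by exact_mod_cast (show n ≠ 0 by omega)
  set Q : ℂ → ℂ := fun x => Complex.exp (-Complex.log (1 + x) / n) - 1 with hQ
  have hlog : AnalyticAt ℂ (fun x : ℂ => Complex.log (1 + x)) 0 :=
    AnalyticAt.clog (by fun_prop) (by simp [Complex.mem_slitPlane_iff])
  have hQa : AnalyticAt ℂ Q 0 :=
    (AnalyticAt.cexp (hlog.neg.div analyticAt_const hnC)).sub analyticAt_const
  obtain ⟨C, hC, hb⟩ := hQa.exists_bound (by simp [hQ])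
  have h1 : ∀ᶠ x : ℂ in 𝓝 0, 1 + x ≠ 0 := ContinuousAt.eventually_ne (by fun_prop) (by simp)
  obtain ⟨ρ, hρ, h⟩ := Metric.eventually_nhds_iff.1 (h1.and hb)
  refine ⟨Q, C, ρ, hC, hρ, fun x hx => ?_⟩
  obtain ⟨a, b, c, d⟩ := h (y := x) (by simpa using hx)
  refine ⟨a, b, d, c, ?_⟩
  simp only [hQ]
  rw [add_sub_cancel, ← Complex.exp_nat_mul, mul_div_cancel₀ _ hnC, Complex.exp_neg,
    Complex.exp_log a]

lemma norm_sub_le_of_punctured_fderiv_le {F : ℂ → ℂ} {c r : ℝ} (h0 : F 0 = 0)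
    (hF : ∀ z, z ≠ 0 → ‖z‖ < r →
      DifferentiableAt ℝ F z ∧ ‖fderiv ℝ F z‖ ≤ c ∧ ‖F z‖ ≤ c * ‖z‖) {z w : ℂ}
    (hz : ‖z‖ < r) (hw : ‖w‖ < r) : ‖F z - F w‖ ≤ c * ‖z - w‖ := by
  have hle : ∀ y : ℂ, ‖y‖ < r → ‖F y‖ ≤ c * ‖y‖ := by
    intro y hy
    by_cases hy0 : y = 0
    · simp [hy0, h0]
    · exact (hF y hy0 hy).2.2
  by_cases hs : (0 : ℂ) ∈ segment ℝ w z
  · have h1 := dist_add_dist_of_mem_segment hs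
    rw [dist_zero_right, dist_zero_left, dist_comm, dist_eq_norm] at h1
    rw [← h1]
    linarith [norm_sub_le (F z) (F w), hle z hz, hle w hw]
  · have hb : ∀ y ∈ segment ℝ w z, ‖y‖ < r := by
      intro y hy
      have := (convex_ball (0 : ℂ) r).segment_subset (by simpa using hw) (by simpa using hz) hy
      simpa using this
    have hne : ∀ y ∈ segment ℝ w z, y ≠ 0 := fun y hy h => hs (h ▸ hy)
    exact (convex_segment w z).norm_image_sub_le_of_norm_fderiv_le (𝕜 := ℝ)
      (fun y hy => (hF y (hne y hy) (hb y hy)).1) (fun y hy => (hF y (hne y hy) (hb y hy)).2.1)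
      (left_mem_segment ℝ w z) (right_mem_segment ℝ w z)

lemma exists_perturbed_coordinate {n : ℕ} (hn : 1 ≤ n) : ∃ (Q : ℂ → ℂ) (C δ₀ : ℝ), 0 < C ∧ 0 < δ₀ ∧
    ∀ δ, 0 < δ → δ < δ₀ → ∀ (u : ℂ → ℂ) (z : ℂ), z ≠ 0 → SmallAt n δ u z →
      let F : ℂ → ℂ := fun y => y * Q (-(n * y ^ n) * u y)
      fatouCoord n (z + F z) = fatouCoord n z + u z ∧ DifferentiableAt ℝ F z ∧
        ‖fderiv ℝ F z‖ ≤ C * δ ∧ ‖F z‖ ≤ C * δ * ‖z‖ := by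
  obtain ⟨Q, C, ρ, hC, hρ, hQ⟩ := exists_analytic_root n hn
  have hnR : (1 : ℝ) ≤ n := by exact_mod_cast hn
  have hnC : (n : ℂ) ≠ 0 := by exact_mod_cast (show n ≠ 0 by omega)
  refine ⟨Q, C * (1 + 2 * n), ρ, by positivity, hρ, fun δ hδ hδρ u z hz hu => ?_⟩
  intro F
  obtain ⟨hu, hud, hud'⟩ := hu
  have hzp : 0 < ‖z‖ := norm_pos_iff.2 hz
  rw [norm_fatouCoord, ← div_eq_mul_inv, le_div_iff₀ (by positivity)] at hu
  set x : ℂ → ℂ := fun y => -(n * y ^ n) * u y with hx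
  have hxn : ‖x z‖ ≤ δ := by
    simp only [hx, norm_mul, norm_neg, norm_pow, Complex.norm_natCast]
    linarith
  obtain ⟨h1, h2, h3, h4, h5⟩ := hQ (x z) (by linarith)
  obtain ⟨L, hL, hLn⟩ : ∃ L : ℂ →L[ℝ] ℂ, HasFDerivAt x L z ∧ ‖z‖ * ‖L‖ ≤ 2 * n * δ := by
    have ha : HasFDerivAt (fun y : ℂ => -(n * y ^ n))
        ((-(n * (n * z ^ (n - 1)))) • (1 : ℂ →L[ℝ] ℂ)) z :=
      ((hasDerivAt_pow n z).const_mul (n : ℂ)).neg.complexToReal_fderiv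
    refine ⟨_, ha.mul hud.hasFDerivAt, ?_⟩
    have e1 : ‖-(n * z ^ n) • fderiv ℝ u z‖ = n * ‖z‖ ^ n * ‖fderiv ℝ u z‖ := by
      rw [norm_smul]
      simp
    have e2 : ‖u z • (-(n * (n * z ^ (n - 1)))) • (1 : ℂ →L[ℝ] ℂ)‖ =
        ‖u z‖ * (n * (n * ‖z‖ ^ (n - 1))) := by
      rw [norm_smul, norm_smul]
      simp
    have e3 : ‖z‖ ^ n = ‖z‖ ^ (n - 1) * ‖z‖ := (pow_sub_one_mul (by omega) _).symm
    calc _ ≤ ‖z‖ * (n * ‖z‖ ^ n * ‖fderiv ℝ u z‖ + ‖u z‖ * (n * (n * ‖z‖ ^ (n - 1)))) := by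
          gcongr
          exact (norm_add_le _ _).trans (by rw [e1, e2])
      _ = n * (‖fderiv ℝ u z‖ * ‖z‖ ^ (n + 1)) + n * (‖u z‖ * (n * ‖z‖ ^ n)) := by
          rw [e3]
          ring_nf
          rw [e3]
          ring
      _ ≤ n * δ + n * δ := by gcongr
      _ = _ := by ring
  have hQx : HasFDerivAt (fun y => Q (x y)) ((deriv Q (x z)) • L) z := by
    refine (h2.hasDerivAt.complexToReal_fderiv.comp z hL).congr_fderiv ?_
    ext
    simp
  have hFz : HasFDerivAt F (z • ((deriv Q (x z)) • L) + Q (x z) • ContinuousLinearMap.id ℝ ℂ) z :=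
    (hasFDerivAt_id z).mul hQx
  have hQz : ‖Q (x z)‖ ≤ C * δ := h4.trans (by gcongr)
  refine ⟨?_, hFz.differentiableAt, ?_, ?_⟩
  · have : z + F z = z * (1 + Q (x z)) := by simp only [F, hx]; ring
    rw [this, fatouCoord, mul_pow, h5, fatouCoord]
    have hzn : z ^ n ≠ 0 := pow_ne_zero _ hz
    have hxz : x z = -(n * z ^ n) * u z := rfl
    have h1' := h1
    rw [hxz] at h1'
    rw [hxz]
    field_simp
    ring
  · rw [hFz.fderiv]
    have e1 : ‖z • (deriv Q (x z)) • L‖ ≤ C * (2 * n * δ) := by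
      rw [norm_smul, norm_smul]
      calc ‖z‖ * (‖deriv Q (x z)‖ * ‖L‖) = ‖deriv Q (x z)‖ * (‖z‖ * ‖L‖) := by ring
        _ ≤ _ := by gcongr
    have e2 : ‖Q (x z) • ContinuousLinearMap.id ℝ ℂ‖ ≤ C * δ := by
      rw [norm_smul, ContinuousLinearMap.norm_id, mul_one]
      exact hQz
    calc _ ≤ _ := norm_add_le _ _
      _ ≤ C * (2 * n * δ) + C * δ := add_le_add e1 e2
      _ = _ := by ring
  · simp only [F, norm_mul]
    have : C * δ ≤ C * (1 + 2 * n) * δ := by nlinarith [mul_pos hC hδ]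
    calc ‖z‖ * ‖Q (x z)‖ ≤ ‖z‖ * (C * (1 + 2 * n) * δ) := by
          gcongr; exact hQz.trans this
      _ = _ := by ring

lemma exists_abel_coordinate {n : ℕ} (hn : 1 ≤ n) {f : ℂ → ℂ} (hf : AnalyticAt ℂ f 0)
    (hfexp : (fun z : ℂ => f z - z * (1 + z ^ n)) =o[𝓝 (0 : ℂ)] fun z : ℂ => z ^ (n + 1))
    {δ : ℝ} (hδ : 0 < δ) :
    ∃ φ : ℂ → ℂ, φ 0 = 0 ∧ ∀ᶠ r in 𝓝[>] (0 : ℝ),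
      (∀ z w, ‖z‖ < r → ‖w‖ < r → ‖(φ z - z) - (φ w - w)‖ ≤ δ * ‖z - w‖) ∧
      ∀ z, z ≠ 0 → ‖z‖ < r → ‖f z - z‖ ≤ δ * ‖z‖ ∧
        fatouCoord n (φ (f z)) = fatouCoord n (φ z) + 1 := by
  obtain ⟨Q, C, δ₀, hC, hδ₀, hQ⟩ := exists_perturbed_coordinate hn
  obtain ⟨hf0, hd, hfne, -⟩ := exists_fatouCoord_normalForm hn hf hfexp
  obtain ⟨δ₁, hδ₁, h1, h2⟩ : ∃ δ₁, 0 < δ₁ ∧ δ₁ < δ₀ ∧ C * δ₁ ≤ δ := by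
    refine ⟨min (δ₀ / 2) (δ / C), by positivity, ?_, ?_⟩
    · exact (min_le_left _ _).trans_lt (by linarith)
    · calc C * min (δ₀ / 2) (δ / C) ≤ C * (δ / C) := by gcongr; exact min_le_right _ _
        _ = δ := by field_simp
  obtain ⟨u, hu⟩ := exists_abel_correction hn hf hfexp hδ₁
  set F : ℂ → ℂ := fun y => y * Q (-(n * y ^ n) * u y) with hF
  have htf : Tendsto f (𝓝[≠] 0) (𝓝[≠] 0) :=
    tendsto_nhdsWithin_iff.2 ⟨by simpa [hf0] using hf.continuousAt.continuousWithinAt.tendsto, hfne⟩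
  have hfid : ∀ᶠ z in 𝓝 0, ‖f z - z‖ ≤ δ * ‖z‖ := by
    have := hf.differentiableAt.hasDerivAt.isLittleO.def hδ
    simpa [hf0, hd] using this
  have hall : ∀ᶠ z in 𝓝[≠] 0, (‖f z - z‖ ≤ δ * ‖z‖ ∧
      fatouCoord n (f z + F (f z)) = fatouCoord n (z + F z) + 1) ∧
      DifferentiableAt ℝ F z ∧ ‖fderiv ℝ F z‖ ≤ δ ∧ ‖F z‖ ≤ δ * ‖z‖ := by
    filter_upwards [hu, htf.eventually hu, hfne, self_mem_nhdsWithin,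
      hfid.filter_mono nhdsWithin_le_nhds] with z hz hfz hne hz0 hid
    obtain ⟨a, b, c, d⟩ := hQ δ₁ hδ₁ h1 u z hz0 hz.1
    obtain ⟨a', -⟩ := hQ δ₁ hδ₁ h1 u (f z) hne hfz.1
    refine ⟨⟨hid, ?_⟩, b, c.trans h2, d.trans (by gcongr)⟩
    rw [a, a', hz.2]
  rw [eventually_nhdsWithin_iff, Metric.eventually_nhds_iff] at hall
  obtain ⟨r₀, hr₀, hall⟩ := hall
  refine ⟨fun z => z + F z, by simp [hF], ?_⟩
  filter_upwards [Ioo_mem_nhdsGT hr₀] with r hr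
  have hall' : ∀ z : ℂ, z ≠ 0 → ‖z‖ < r → _ := fun z hz hzr =>
    hall (y := z) (by simpa using hzr.trans hr.2) hz
  refine ⟨fun z w hz hw => ?_, fun z hz hzr => (hall' z hz hzr).1⟩
  simpa using norm_sub_le_of_punctured_fderiv_le (by simp [hF]) (fun z hz hzr => (hall' z hz hzr).2)
    hz hw

lemma exists_root_of_unity_gap {n : ℕ} (hn : 1 ≤ n) : ∃ κ : ℝ, 0 < κ ∧
    ∀ a b : ℂ, b ≠ 0 → ‖a - b‖ < κ * ‖b‖ → fatouCoord n a = fatouCoord n b → a = b := by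
  have hnC : (n : ℂ) ≠ 0 := by exact_mod_cast (show n ≠ 0 by omega)
  have h1 := (hasDerivAt_pow n (1 : ℂ)).eventually_ne (c := 1) (by simpa using hnC)
  rw [eventually_nhdsWithin_iff, Metric.eventually_nhds_iff] at h1
  obtain ⟨κ, hκ, h⟩ := h1
  refine ⟨κ, hκ, fun a b hb hab hW => ?_⟩
  have hpow : a ^ n = b ^ n := by
    simpa [fatouCoord, hnC] using hW
  by_contra hne
  refine h (y := a / b) ?_ ?_ ?_
  · rw [dist_eq_norm, show a / b - 1 = (a - b) / b by field_simp, norm_div,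
      div_lt_iff₀ (norm_pos_iff.2 hb)]
    exact hab
  · simpa [div_eq_one_iff_eq hb] using hne
  · rw [div_pow, hpow, div_self (pow_ne_zero _ hb)]

lemma norm_coordinate_step_le {f φ : ℂ → ℂ} {δ r : ℝ} (hδ : 0 < δ) (hδ' : δ ≤ 1 / 16) (h0 : φ 0 = 0)
    (hφ : ∀ z w, ‖z‖ < r → ‖w‖ < r → ‖(φ z - z) - (φ w - w)‖ ≤ δ * ‖z - w‖) {z : ℂ}
    (hzr : ‖z‖ < r / 4) (hf : ‖f z - z‖ ≤ δ * ‖z‖) :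
    ‖f z‖ < r ∧ ‖z‖ ≤ 2 * ‖φ z‖ ∧ ‖φ (f z) - φ z‖ ≤ 4 * δ * ‖φ z‖ := by
  have hz0 := norm_nonneg z
  have h1 : ‖f z‖ ≤ ‖f z - z‖ + ‖z‖ := by simpa using norm_add_le (f z - z) z
  have hfr : ‖f z‖ < r := by nlinarith
  have h2 : ‖φ z - z‖ ≤ δ * ‖z‖ := by
    simpa [h0] using hφ z 0 (by linarith) (by simpa using by linarith)
  have h3 : ‖z‖ ≤ ‖φ z - z‖ + ‖φ z‖ := by
    simpa [norm_sub_rev] using norm_add_le (z - φ z) (φ z)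
  have h4 : ‖φ (f z) - φ z‖ ≤ ‖(φ (f z) - f z) - (φ z - z)‖ + ‖f z - z‖ := by
    refine le_trans (le_of_eq (congrArg _ ?_)) (norm_add_le _ _)
    ring
  have h5 := hφ (f z) z hfr (by linarith)
  have h6 : ‖z‖ ≤ (16 / 15) * ‖φ z‖ := by nlinarith
  refine ⟨hfr, by linarith [norm_nonneg (φ z)], ?_⟩
  have h7 : ‖φ (f z) - φ z‖ ≤ (17 / 16) * (δ * ‖z‖) := by nlinarith [norm_nonneg (f z - z)]
  nlinarith [mul_le_mul_of_nonneg_left h6 hδ.le, mul_nonneg hδ.le (norm_nonneg (φ z))]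

lemma exists_openPartialHomeomorph {φ : ℂ → ℂ} {δ r : ℝ} (hδ : 0 < δ) (hδ' : δ < 1)
    (hφ : ∀ z w, ‖z‖ < r → ‖w‖ < r → ‖(φ z - z) - (φ w - w)‖ ≤ δ * ‖z - w‖) {s : Set ℂ}
    (hs : IsOpen s) (hsr : s ⊆ Metric.ball 0 r) :
    ∃ e : OpenPartialHomeomorph ℂ ℂ, e.source = s ∧ ⇑e = φ := by
  lift δ to NNReal using hδ.le
  have ha : ApproximatesLinearOn φ ((ContinuousLinearEquiv.refl ℂ ℂ : ℂ ≃L[ℂ] ℂ) : ℂ →L[ℂ] ℂ) s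
      δ := by
    intro z hz w hw
    refine le_trans (le_of_eq (congrArg _ ?_))
      (hφ z w (by simpa using hsr hz) (by simpa using hsr hw))
    change φ z - φ w - (z - w) = _
    ring
  have hc : δ < ‖((ContinuousLinearEquiv.refl ℂ ℂ : ℂ ≃L[ℂ] ℂ).symm : ℂ →L[ℂ] ℂ)‖₊⁻¹ := by
    rw [← NNReal.coe_lt_coe]
    simpa using hδ'
  exact ⟨ha.toOpenPartialHomeomorph φ s (Or.inr hc) hs, rfl, rfl⟩

/-- Topological rigidity of parabolic germs: two normalized parabolic germs of
the same multiplicity `n + 1` are topologically conjugate near `0` via a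
homeomorphism `ψ : V → U` fixing `0`. -/
theorem topological_rigidity_parabolic (n : ℕ) (hn : 1 ≤ n)
    (f g : ℂ → ℂ) (Nf Ng : Set ℂ) (hNf : Nf ∈ 𝓝 (0 : ℂ)) (hNg : Ng ∈ 𝓝 (0 : ℂ))
    (hfd : DifferentiableOn ℂ f Nf) (hfinj : Set.InjOn f Nf)
    (hfexp : (fun z : ℂ => f z - z * (1 + z ^ n)) =o[𝓝 (0 : ℂ)]
      fun z : ℂ => z ^ (n + 1))
    (hgd : DifferentiableOn ℂ g Ng) (hginj : Set.InjOn g Ng)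
    (hgexp : (fun z : ℂ => g z - z * (1 + z ^ n)) =o[𝓝 (0 : ℂ)]
      fun z : ℂ => z ^ (n + 1)) :
    ∃ (V U : Set ℂ), V ∈ 𝓝 (0 : ℂ) ∧ U ∈ 𝓝 (0 : ℂ) ∧
      ∃ ψ ψinv : ℂ → ℂ,
        ContinuousOn ψ V ∧ ContinuousOn ψinv U ∧
        Set.MapsTo ψ V U ∧ Set.MapsTo ψinv U V ∧
        (∀ z ∈ V, ψinv (ψ z) = z) ∧ (∀ w ∈ U, ψ (ψinv w) = w) ∧
        ψ 0 = 0 ∧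
        ∀ z ∈ V, g z ∈ V → f (ψ z) = ψ (g z) := by
  have hf := hfd.analyticAt hNf
  have hg := hgd.analyticAt hNg
  obtain ⟨κ, hκ, hroot⟩ := exists_root_of_unity_gap hn
  obtain ⟨δ, hδ, hδ', hδκ⟩ : ∃ δ : ℝ, 0 < δ ∧ δ ≤ 1 / 16 ∧ δ ≤ κ / 32 :=
    ⟨min (1 / 16) (κ / 32), by positivity, min_le_left _ _, min_le_right _ _⟩
  obtain ⟨φ, hφ0, hφ⟩ := exists_abel_coordinate hn hf hfexp hδ
  obtain ⟨χ, hχ0, hχ⟩ := exists_abel_coordinate hn hg hgexp hδ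
  obtain ⟨r, ⟨hφ, hfW⟩, ⟨hχ, hgW⟩, hr⟩ := (hφ.and (hχ.and self_mem_nhdsWithin)).exists
  have hr : 0 < r := hr
  have hr4 : Metric.ball (0 : ℂ) (r / 4) ⊆ Metric.ball 0 r := Metric.ball_subset_ball (by linarith)
  obtain ⟨ef, hefs, hef⟩ := exists_openPartialHomeomorph hδ (by linarith) hφ Metric.isOpen_ball hr4
  obtain ⟨eg, hegs, heg⟩ := exists_openPartialHomeomorph hδ (by linarith) hχ Metric.isOpen_ball hr4
  have hf0 : f 0 = 0 := (exists_fatouCoord_normalForm hn hf hfexp).1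
  have hg0 : g 0 = 0 := (exists_fatouCoord_normalForm hn hg hgexp).1
  have h0f : (0 : ℂ) ∈ ef.source := by simp [hefs, hr]
  have h0g : (0 : ℂ) ∈ eg.source := by simp [hegs, hr]
  have hsymm : ef.symm 0 = 0 := by
    have := ef.left_inv h0f
    rwa [hef, hφ0] at this
  set e := eg.trans ef.symm with he
  have h0 : (0 : ℂ) ∈ e.source := by
    have := ef.map_source h0f
    rw [hef, hφ0] at this
    simp [he, h0g, heg, hχ0, this]
  have he0 : e 0 = 0 := by simp [he, heg, hχ0, hsymm]
  have hφe : ∀ z ∈ e.source, ‖z‖ < r / 4 ∧ ‖e z‖ < r / 4 ∧ φ (e z) = χ z := by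
    intro z hz
    rw [he, OpenPartialHomeomorph.trans_source] at hz
    have h1 := ef.map_target hz.2
    have h2 := ef.right_inv hz.2
    rw [hefs] at h1
    have h3 := hz.1
    rw [hegs] at h3
    rw [hef, heg] at h2
    exact ⟨by simpa using h3, by simpa [he] using h1, by simpa [he, heg] using h2⟩
  refine ⟨e.source, e.target, e.open_source.mem_nhds h0,
    e.open_target.mem_nhds (by simpa [he0] using e.map_source h0), e, e.symm, e.continuousOn,
    e.symm.continuousOn, e.mapsTo, e.symm.mapsTo, fun z hz => e.left_inv hz,
    fun w hw => e.right_inv hw, he0, fun z hz hgz => ?_⟩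
  by_cases hz0 : z = 0
  · simp [hz0, hg0, he0, hf0]
  obtain ⟨hz4, hez4, hφz⟩ := hφe z hz
  obtain ⟨-, hegz4, hφgz⟩ := hφe (g z) hgz
  have hx0 : e z ≠ 0 := fun h => hz0 <| e.injOn hz h0 (by rw [h, he0])
  obtain ⟨hfx, hfWx⟩ := hfW (e z) hx0 (by linarith)
  obtain ⟨hgz', hgWz⟩ := hgW z hz0 (by linarith)
  obtain ⟨hfr, -, hfs⟩ := norm_coordinate_step_le hδ hδ' hφ0 hφ hez4 hfx
  obtain ⟨hgr, hzc, hgs⟩ := norm_coordinate_step_le hδ hδ' hχ0 hχ hz4 hgz'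
  rw [hφz] at hfs hfWx
  have hzp := norm_pos_iff.2 hz0
  have hb : ‖χ z‖ ≤ 2 * ‖χ (g z)‖ := by
    have : ‖χ z‖ ≤ ‖χ (g z) - χ z‖ + ‖χ (g z)‖ := by
      simpa [norm_sub_rev] using norm_add_le (χ z - χ (g z)) (χ (g z))
    nlinarith [norm_nonneg (χ z)]
  have hab : φ (f (e z)) = χ (g z) := by
    refine hroot _ _ (norm_pos_iff.1 (by linarith)) ?_ (by rw [hfWx, hgWz])
    have h1 : ‖φ (f (e z)) - χ (g z)‖ ≤ ‖φ (f (e z)) - χ z‖ + ‖χ (g z) - χ z‖ := by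
      simpa using norm_sub_le (φ (f (e z)) - χ z) (χ (g z) - χ z)
    have h2 : 0 < ‖χ (g z)‖ := by linarith
    calc _ ≤ 8 * δ * ‖χ z‖ := by linarith
      _ ≤ 8 * δ * (2 * ‖χ (g z)‖) := by gcongr
      _ ≤ 8 * (κ / 32) * (2 * ‖χ (g z)‖) := by gcongr
      _ < κ * ‖χ (g z)‖ := by nlinarith [mul_pos hκ h2]
  have hlip := hφ (f (e z)) (e (g z)) hfr (by linarith)
  rw [hab, hφgz, sub_sub_sub_cancel_left, norm_sub_rev] at hlip
  have : ‖f (e z) - e (g z)‖ = 0 := by nlinarith [norm_nonneg (f (e z) - e (g z))]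
  exact sub_eq_zero.1 (norm_eq_zero.1 this)
end

section
/- (Gluing parabolic germs by a global homeomorphism.) Let z₁, …, z_k be distinct points of ℂ and for each i let f_i be a parabolic germ at z_i, i.e., f_i is holomorphic and injective on a disk around z_i with f_i(z_i) = z_i and f_i'(z_i) = 1. Then there exist r > 0 and a homeomorphism f : ℂ → ℂ such that f(z) = f_i(z) for all z in the open disk Δ_r(z_i) of radius r centered at z_i, for every i = 1, …, k. -/
open Filter Topology
open scoped NNReal

/-- A map with derivative `1` at `a` in the strict sense is, near `a`, a perturbation of the
identity with arbitrarily small Lipschitz constant. -/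
theorem HasStrictDerivAt.exists_ball_norm_sub_sub_le {f : ℂ → ℂ} {a : ℂ}
    (h : HasStrictDerivAt f 1 a) {c : ℝ≥0} (hc : 0 < c) :
    ∃ δ > 0, ∀ x ∈ Metric.ball a δ, ∀ y ∈ Metric.ball a δ,
      ‖f x - f y - (x - y)‖ ≤ c * ‖x - y‖ := by
  obtain ⟨s, hs, hsf⟩ :=
    h.hasStrictFDerivAt.approximates_deriv_on_nhds (c := c) (Or.inr hc)
  obtain ⟨δ, hδ, hball⟩ := Metric.mem_nhds_iff.1 hs
  refine ⟨δ, hδ, fun x hx y hy ↦ ?_⟩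
  simpa using hsf x (hball hx) y (hball hy)

/-- Maps fixing the centres of well-separated balls of equal radius, each a perturbation of the
identity with small Lipschitz constant on its ball, have a common extension to a homeomorphism. -/
theorem exists_homeomorph_eq_on_balls {ι E : Type*} [NormedAddCommGroup E] [NormedSpace ℝ E]
    [FiniteDimensional ℝ E] (z : ι → E) (f : ι → E → E) (hfix : ∀ i, f i (z i) = z i)
    {r : ℝ} (hr : 0 < r) (hsep : ∀ i j, i ≠ j → 4 * r ≤ dist (z i) (z j)) {c : ℝ≥0}
    (hlip : ∀ i, ∀ x ∈ Metric.ball (z i) r, ∀ y ∈ Metric.ball (z i) r,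
      ‖f i x - f i y - (x - y)‖ ≤ c * ‖x - y‖)
    (hc : lipschitzExtensionConstant E * c < 1) :
    ∃ F : E ≃ₜ E, ∀ i, ∀ w ∈ Metric.ball (z i) r, F w = f i w := by
  classical
  have huniq : ∀ i j w, w ∈ Metric.ball (z i) r → w ∈ Metric.ball (z j) r → i = j := by
    intro i j w hi hj
    by_contra hij
    have h1 := hsep i j hij
    have h2 := dist_triangle_left (z i) (z j) w
    rw [Metric.mem_ball] at hi hj
    linarith
  let g : E → E := fun w ↦ if h : ∃ i, w ∈ Metric.ball (z i) r then f h.choose w else w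
  have hg : ∀ i, ∀ w ∈ Metric.ball (z i) r, g w = f i w := by
    intro i w hw
    have h : ∃ i, w ∈ Metric.ball (z i) r := ⟨i, hw⟩
    simp only [g, dif_pos h]
    rw [huniq _ _ w h.choose_spec hw]
  have hcenter : ∀ i, ∀ w ∈ Metric.ball (z i) r, ‖f i w - w‖ ≤ c * r := by
    intro i w hw
    have h := hlip i w hw (z i) (Metric.mem_ball_self hr)
    rw [hfix, sub_sub_sub_cancel_right] at h
    refine h.trans (mul_le_mul_of_nonneg_left ?_ c.2)
    exact (mem_ball_iff_norm.1 hw).le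
  have happ : ApproximatesLinearOn g ((ContinuousLinearEquiv.refl ℝ E : E ≃L[ℝ] E) : E →L[ℝ] E)
      (⋃ i, Metric.ball (z i) r) c := by
    intro x hx y hy
    obtain ⟨i, hi⟩ := Set.mem_iUnion.1 hx
    obtain ⟨j, hj⟩ := Set.mem_iUnion.1 hy
    rw [hg i x hi, hg j y hj]
    change ‖f i x - f j y - (x - y)‖ ≤ c * ‖x - y‖
    by_cases hij : i = j
    · subst hij
      exact hlip i x hi y hj
    · have hdist : 2 * r ≤ ‖x - y‖ := by
        rw [← dist_eq_norm]
        have h1 := hsep i j hij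
        have h2 := dist_triangle4 (z i) x y (z j)
        rw [Metric.mem_ball'] at hi
        rw [Metric.mem_ball] at hj
        linarith
      calc ‖f i x - f j y - (x - y)‖ = ‖(f i x - x) - (f j y - y)‖ := by congr 1; abel
        _ ≤ ‖f i x - x‖ + ‖f j y - y‖ := norm_sub_le _ _
        _ ≤ c * r + c * r := add_le_add (hcenter i x hi) (hcenter j y hj)
        _ = c * (2 * r) := by ring
        _ ≤ c * ‖x - y‖ := mul_le_mul_of_nonneg_left hdist c.2
  obtain ⟨F, hF⟩ := happ.exists_homeomorph_extension (by
    rcases subsingleton_or_nontrivial E with hE | hE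
    · exact Or.inl hE
    · right
      have : ‖((ContinuousLinearEquiv.refl ℝ E).symm : E →L[ℝ] E)‖₊ = 1 := by
        ext
        exact ContinuousLinearMap.norm_id
      rwa [this, inv_one])
  exact ⟨F, fun i w hw ↦ (hF (Set.mem_iUnion.2 ⟨i, hw⟩)).symm.trans (hg i w hw)⟩


/-- Gluing parabolic germs by a global homeomorphism: finitely many parabolic
germs `f_i` at distinct points `z_i` agree, on small disks around the `z_i`,
with a single homeomorphism of `ℂ`. -/
theorem glue_parabolic_germs (k : ℕ) (z : Fin k → ℂ) (hz : Function.Injective z)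
    (ρ : Fin k → ℝ) (hρ : ∀ i, 0 < ρ i)
    (f : Fin k → ℂ → ℂ)
    (hfd : ∀ i, DifferentiableOn ℂ (f i) (Metric.ball (z i) (ρ i)))
    (hfinj : ∀ i, Set.InjOn (f i) (Metric.ball (z i) (ρ i)))
    (hfix : ∀ i, f i (z i) = z i)
    (hder : ∀ i, deriv (f i) (z i) = 1) :
    ∃ r : ℝ, 0 < r ∧ (∀ i, r ≤ ρ i) ∧
      ∃ F : ℂ ≃ₜ ℂ, ∀ i, ∀ w ∈ Metric.ball (z i) r, F w = f i w := by
  set c : ℝ≥0 := (lipschitzExtensionConstant ℂ + 1)⁻¹ with hc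
  have hc0 : 0 < c := by positivity
  have hstrict : ∀ i, ∃ δ > 0, ∀ x ∈ Metric.ball (z i) δ, ∀ y ∈ Metric.ball (z i) δ,
      ‖f i x - f i y - (x - y)‖ ≤ c * ‖x - y‖ := fun i ↦ by
    have han : AnalyticAt ℂ (f i) (z i) :=
      (hfd i).analyticAt (Metric.ball_mem_nhds _ (hρ i))
    have h := han.hasStrictDerivAt
    rw [hder i] at h
    exact h.exists_ball_norm_sub_sub_le hc0
  choose δ hδ hlip using hstrict
  have hr : ∀ᶠ r : ℝ in 𝓝[>] 0, 0 < r ∧ (∀ i, r ≤ ρ i) ∧ (∀ i, r ≤ δ i) ∧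
      ∀ i j, i ≠ j → 4 * r ≤ dist (z i) (z j) := by
    have small : ∀ a : ℝ, 0 < a → ∀ᶠ r : ℝ in 𝓝[>] 0, r ≤ a := fun a ha ↦
      (eventually_le_nhds ha).filter_mono nhdsWithin_le_nhds
    refine (eventually_mem_nhdsWithin).and
      ((eventually_all.2 fun i ↦ small _ (hρ i)).and
      ((eventually_all.2 fun i ↦ small _ (hδ i)).and
      (eventually_all.2 fun i ↦ eventually_all.2 fun j ↦ ?_)))
    by_cases hij : i = j
    · simp [hij]
    · have hd : 0 < dist (z i) (z j) / 4 := by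
        have := dist_pos.2 (hz.ne hij)
        positivity
      filter_upwards [small _ hd] with r hr _
      linarith
  obtain ⟨r, hr0, hrρ, hrδ, hsep⟩ := hr.exists
  obtain ⟨F, hF⟩ := exists_homeomorph_eq_on_balls z f hfix hr0 hsep
    (fun i x hx y hy ↦ hlip i x (Metric.ball_subset_ball (hrδ i) hx) y
      (Metric.ball_subset_ball (hrδ i) hy))
    (by
      rw [hc, ← div_eq_mul_inv, div_lt_one (by positivity)]
      exact lt_add_one _)
  exact ⟨r, hr0, hrρ, F, hF⟩
end

section
/- (Gluing germs with nonzero derivative by a global homeomorphism.) Let z₁, …, z_k be distinct points of ℂ and for each i let f_i be holomorphic and injective on a disk around z_i with f_i(z_i) = z_i and f_i'(z_i) = λ_i ≠ 0. Then there exist s > 0 and a homeomorphism f : ℂ → ℂ such that f(z) = f_i(z) for all z in the open disk Δ_s(z_i) of radius s centered at z_i, for every i = 1, …, k. -/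
open Filter Topology Metric

/-- A germ at `z` whose derivative is close to `1` extends to a homeomorphism of `ℂ`
supported in any prescribed disk around `z`. -/
theorem exists_homeomorph_of_hasStrictDerivAt_near_one {f : ℂ → ℂ} {z μ : ℂ}
    (hf : HasStrictDerivAt f μ z) (hfz : f z = z) (hμ : ‖μ - 1‖ ≤ 1 / 12)
    {R : ℝ} (hR : 0 < R) :
    ∃ F : ℂ ≃ₜ ℂ, (∀ᶠ w in 𝓝 z, F w = f w) ∧ ∀ w, R ≤ dist w z → F w = w := by
  have hc : ∀ᶠ p : ℂ × ℂ in 𝓝 (z, z),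
      ‖f p.1 - f p.2 - (p.1 - p.2) * μ‖ ≤ (1 / 12) * ‖p.1 - p.2‖ := by
    simpa using hf.hasStrictFDerivAt.isLittleO.bound (show (0 : ℝ) < 1 / 12 by norm_num)
  obtain ⟨δ, hδ, hball⟩ := Metric.eventually_nhds_iff.1 hc
  obtain ⟨ε, hε, hεδ, hεR⟩ : ∃ ε : ℝ, 0 < ε ∧ ε ≤ δ ∧ ε ≤ R :=
    ⟨min δ R, lt_min hδ hR, min_le_left _ _, min_le_right _ _⟩
  have hu : ∀ x y, dist x z < ε → dist y z < ε →
      ‖(f x - x) - (f y - y)‖ ≤ (1 / 6) * ‖x - y‖ := by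
    intro x y hx hy
    have h := @hball (x, y) (by
      rw [Prod.dist_eq]; exact max_lt (hx.trans_le hεδ) (hy.trans_le hεδ))
    calc ‖(f x - x) - (f y - y)‖
        = ‖(f x - f y - (x - y) * μ) + (x - y) * (μ - 1)‖ := by ring_nf
      _ ≤ (1 / 12) * ‖x - y‖ + ‖x - y‖ * (1 / 12) :=
        (norm_add_le _ _).trans (add_le_add h (by rw [norm_mul]; gcongr))
      _ = (1 / 6) * ‖x - y‖ := by ring
  have hu0 : ∀ x, dist x z < ε → ‖f x - x‖ ≤ (1 / 6) * ε := by
    intro x hx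
    have h := hu x z hx (by simpa using hε)
    rw [hfz, sub_self, sub_zero, ← dist_eq_norm x z] at h
    linarith
  let χ : ℂ → ℝ := fun w => max 0 (min 1 (2 - 2 / ε * dist w z))
  have hχ0 : ∀ w, 0 ≤ χ w := fun w => le_max_left _ _
  have hχ1 : ∀ w, χ w ≤ 1 := fun w => max_le zero_le_one (min_le_left _ _)
  have hχout : ∀ w, ε ≤ dist w z → χ w = 0 := by
    intro w hw
    refine max_eq_left ((min_le_right _ _).trans ?_)
    have : 2 / ε * ε ≤ 2 / ε * dist w z := by gcongr
    rw [div_mul_cancel₀ _ hε.ne'] at this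
    linarith
  have hχin : ∀ w, dist w z < ε / 2 → χ w = 1 := by
    intro w hw
    have : 2 / ε * dist w z ≤ 2 / ε * (ε / 2) := by gcongr
    have h2 : 2 / ε * (ε / 2) = 1 := by field_simp
    have h3 : min 1 (2 - 2 / ε * dist w z) = 1 := min_eq_left (by linarith)
    simp [χ, h3]
  have hχL : ∀ x y, |χ x - χ y| ≤ 2 / ε * ‖x - y‖ := by
    intro x y
    calc |χ x - χ y| ≤ |min 1 (2 - 2 / ε * dist x z) - min 1 (2 - 2 / ε * dist y z)| := by
          simpa using abs_max_sub_max_le_max 0 (min 1 (2 - 2 / ε * dist x z)) 0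
            (min 1 (2 - 2 / ε * dist y z))
      _ ≤ |(2 - 2 / ε * dist x z) - (2 - 2 / ε * dist y z)| := by
          simpa using abs_min_sub_min_le_max 1 (2 - 2 / ε * dist x z) 1
            (2 - 2 / ε * dist y z)
      _ = 2 / ε * |dist x z - dist y z| := by
          rw [← abs_of_pos (show 0 < 2 / ε by positivity), ← abs_mul, abs_sub_comm,
            abs_of_pos (show 0 < 2 / ε by positivity)]
          ring_nf
      _ ≤ 2 / ε * ‖x - y‖ := by
          gcongr
          rw [← dist_eq_norm]
          exact abs_dist_sub_le x y z
  have hone : ∀ x y, dist x z < ε →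
      ‖((χ x - χ y : ℝ) : ℂ) * (f x - x)‖ ≤ (1 / 3) * ‖x - y‖ := by
    intro x y hx
    rw [norm_mul, Complex.norm_real, Real.norm_eq_abs]
    calc _ ≤ 2 / ε * ‖x - y‖ * ((1 / 6) * ε) :=
          mul_le_mul (hχL x y) (hu0 x hx) (norm_nonneg _) (by positivity)
      _ = _ := by field_simp; ring
  let v : ℂ → ℂ := fun w => (χ w : ℂ) * (f w - w)
  have hv : ∀ x y, ‖v x - v y‖ ≤ (1 / 2) * ‖x - y‖ := by
    intro x y
    have hnn := norm_nonneg (x - y)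
    rcases lt_or_ge (dist x z) ε with hx | hx <;> rcases lt_or_ge (dist y z) ε with hy | hy
    · calc ‖v x - v y‖
          = ‖((χ x - χ y : ℝ) : ℂ) * (f x - x) + (χ y : ℂ) * ((f x - x) - (f y - y))‖ := by
            simp only [v]; push_cast; ring_nf
        _ ≤ (1 / 3) * ‖x - y‖ + 1 * ((1 / 6) * ‖x - y‖) := by
            refine (norm_add_le _ _).trans (add_le_add (hone x y hx) ?_)
            rw [norm_mul, Complex.norm_real, Real.norm_of_nonneg (hχ0 y)]
            exact mul_le_mul (hχ1 y) (hu x y hx hy) (norm_nonneg _) zero_le_one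
        _ = _ := by ring
    · have h := hone x y hx
      have h2 : v x - v y = ((χ x - χ y : ℝ) : ℂ) * (f x - x) := by simp [v, hχout y hy]
      rw [h2]; linarith
    · have h := hone y x hy
      have h2 : v x - v y = -(((χ y - χ x : ℝ) : ℂ) * (f y - y)) := by simp [v, hχout x hx]
      rw [h2, norm_neg]; rw [norm_sub_rev y x] at h; linarith
    · simp [v, hχout x hx, hχout y hy]
  have happ : ApproximatesLinearOn (fun w => w + v w)
      ((ContinuousLinearEquiv.refl ℂ ℂ : ℂ ≃L[ℂ] ℂ) : ℂ →L[ℂ] ℂ) Set.univ (1 / 2) := by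
    intro x _ y _
    have h : x + v x - (y + v y) - (x - y) = v x - v y := by ring
    simpa [h] using hv x y
  refine ⟨happ.toHomeomorph _ (Or.inr ?_), ?_, ?_⟩
  · have : ‖((ContinuousLinearEquiv.refl ℂ ℂ).symm : ℂ →L[ℂ] ℂ)‖₊ = 1 := by
      ext; simp
    rw [this, inv_one, ← NNReal.coe_lt_coe]
    norm_num
  · filter_upwards [Metric.ball_mem_nhds z (half_pos hε)] with w hw
    change w + v w = f w
    simp [v, hχin w hw]
  · intro w hw
    change w + v w = w
    simp [v, hχout w (hεR.trans hw)]

theorem hasStrictDerivAt_add_mul_sub (z μ : ℂ) :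
    HasStrictDerivAt (fun w => z + μ * (w - z)) μ z := by
  have h : HasStrictDerivAt (fun w => w - z) 1 z := (hasStrictDerivAt_id z).sub_const z
  have h2 : HasStrictDerivAt (fun w => μ * (w - z)) (μ * 1) z := HasStrictDerivAt.const_mul μ h
  rw [mul_one] at h2
  exact h2.const_add z

/-- Every linear germ `w ↦ z + μ ^ n * (w - z)` with `μ` close to `1` extends to a homeomorphism
supported in a prescribed disk. -/
theorem exists_homeomorph_pow_mul {z μ : ℂ} (hμ : ‖μ - 1‖ ≤ 1 / 12) {R : ℝ} (hR : 0 < R)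
    (n : ℕ) :
    ∃ F : ℂ ≃ₜ ℂ, (∀ᶠ w in 𝓝 z, F w = z + μ ^ n * (w - z)) ∧
      ∀ w, R ≤ dist w z → F w = w := by
  induction n with
  | zero => exact ⟨Homeomorph.refl ℂ, by simp, by simp⟩
  | succ n ih =>
    obtain ⟨F, hF, hFR⟩ := ih
    have hd : HasStrictDerivAt (fun w => z + μ * (w - z)) μ z := hasStrictDerivAt_add_mul_sub z μ
    obtain ⟨G, hG, hGR⟩ :=
      exists_homeomorph_of_hasStrictDerivAt_near_one hd (by simp) hμ hR
    have hFz : F z = z := by simpa using hF.self_of_nhds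
    have hFt : Tendsto F (𝓝 z) (𝓝 z) := by simpa [hFz] using F.continuous.tendsto z
    refine ⟨F.trans G, ?_, fun w hw => ?_⟩
    · filter_upwards [hF, hFt.eventually hG] with w h1 h2
      rw [Homeomorph.trans_apply, h2, h1]
      ring
    · rw [Homeomorph.trans_apply, hFR w hw, hGR w hw]

/-- A germ at `z` with nonzero derivative extends to a homeomorphism of `ℂ` supported in any
prescribed disk around `z`. -/
theorem exists_homeomorph_of_hasStrictDerivAt {f : ℂ → ℂ} {z l : ℂ}
    (hf : HasStrictDerivAt f l z) (hfz : f z = z) (hl : l ≠ 0) {R : ℝ} (hR : 0 < R) :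
    ∃ F : ℂ ≃ₜ ℂ, (∀ᶠ w in 𝓝 z, F w = f w) ∧ ∀ w, R ≤ dist w z → F w = w := by
  obtain ⟨n, μ, hμ, hμn⟩ : ∃ (n : ℕ) (μ : ℂ), ‖μ - 1‖ ≤ 1 / 12 ∧ μ ^ n = l := by
    have ht : Tendsto (fun n : ℕ => Complex.exp (Complex.log l / n)) atTop (𝓝 1) := by
      simpa [Function.comp_def] using (Complex.continuous_exp.tendsto 0).comp
        (tendsto_const_div_atTop_nhds_zero_nat (Complex.log l))
    obtain ⟨n, hn, hn0⟩ := ((ht.eventually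
      (Metric.closedBall_mem_nhds 1 (show (0 : ℝ) < 1 / 12 by norm_num))).and
      (eventually_ne_atTop 0)).exists
    refine ⟨n, _, by simpa [dist_eq_norm] using hn, ?_⟩
    rw [← Complex.exp_nat_mul, mul_div_cancel₀ _ (Nat.cast_ne_zero.2 hn0), Complex.exp_log hl]
  obtain ⟨F, hF, hFR⟩ := exists_homeomorph_pow_mul (z := z) hμ hR n
  rw [hμn] at hF
  have hd : HasStrictDerivAt (fun w => f (z + l⁻¹ * (w - z))) 1 z := by
    have h1 : HasStrictDerivAt (fun w => z + l⁻¹ * (w - z)) l⁻¹ z :=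
      hasStrictDerivAt_add_mul_sub z l⁻¹
    have h2 : HasStrictDerivAt f l (z + l⁻¹ * (z - z)) := by simpa using hf
    have h3 := HasStrictDerivAt.comp z h2 h1
    rwa [mul_inv_cancel₀ hl] at h3
  obtain ⟨G, hG, hGR⟩ := exists_homeomorph_of_hasStrictDerivAt_near_one hd
    (by simpa using hfz) (by norm_num) hR
  have hFz : F z = z := by simpa using hF.self_of_nhds
  have hFt : Tendsto F (𝓝 z) (𝓝 z) := by simpa [hFz] using F.continuous.tendsto z
  refine ⟨F.trans G, ?_, fun w hw => ?_⟩
  · filter_upwards [hF, hFt.eventually hG] with w h1 h2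
    rw [Homeomorph.trans_apply, h2, h1, add_sub_cancel_left, inv_mul_cancel_left₀ hl,
      add_sub_cancel]
  · rw [Homeomorph.trans_apply, hFR w hw, hGR w hw]

/-- Germs with nonzero derivatives at finitely many distinct fixed points extend to a common
homeomorphism of `ℂ`. -/
theorem exists_homeomorph_eventuallyEq {ι : Type*} [Finite ι] {z : ι → ℂ}
    (hz : Function.Injective z) {f : ι → ℂ → ℂ} {l : ι → ℂ}
    (hf : ∀ i, HasStrictDerivAt (f i) (l i) (z i)) (hfz : ∀ i, f i (z i) = z i)
    (hl : ∀ i, l i ≠ 0) :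
    ∃ F : ℂ ≃ₜ ℂ, ∀ i, ∀ᶠ w in 𝓝 (z i), F w = f i w := by
  classical
  cases nonempty_fintype ι
  suffices H : ∀ S : Finset ι, ∃ F : ℂ ≃ₜ ℂ, (∀ i ∈ S, ∀ᶠ w in 𝓝 (z i), F w = f i w) ∧
      ∀ i ∉ S, ∀ᶠ w in 𝓝 (z i), F w = w by
    obtain ⟨F, hF, -⟩ := H Finset.univ
    exact ⟨F, fun i => hF i (Finset.mem_univ i)⟩
  intro S
  induction S using Finset.induction_on with
  | empty => exact ⟨Homeomorph.refl ℂ, by simp, by simp⟩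
  | insert a S ha ih =>
    obtain ⟨F, hF, hF'⟩ := ih
    obtain ⟨R, hR, hRd⟩ : ∃ R : ℝ, 0 < R ∧ ∀ j, j ≠ a → R < dist (z j) (z a) := by
      have h : ∀ᶠ R : ℝ in 𝓝[>] 0, ∀ j, j ≠ a → R < dist (z j) (z a) := by
        refine eventually_all.2 fun j => ?_
        by_cases hj : j = a
        · simp [hj]
        · filter_upwards [mem_nhdsWithin_of_mem_nhds
            (Iio_mem_nhds (dist_pos.2 (hz.ne hj)))] with R hR _ using hR
      exact ((eventually_mem_nhdsWithin (α := ℝ)).and h).exists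
    obtain ⟨G, hG, hGR⟩ := exists_homeomorph_of_hasStrictDerivAt (hf a) (hfz a) (hl a) hR
    have hGj : ∀ j, j ≠ a → ∀ᶠ w in 𝓝 (z j), G w = w := by
      intro j hj
      have hd : Tendsto (fun w => dist w (z a)) (𝓝 (z j)) (𝓝 (dist (z j) (z a))) :=
        (continuous_id.dist continuous_const).tendsto _
      filter_upwards [hd.eventually_const_lt (hRd j hj)] with w hw using hGR w hw.le
    refine ⟨G.trans F, fun i hi => ?_, fun i hi => ?_⟩
    · rcases Finset.mem_insert.1 hi with rfl | hi
      · have hGz : G (z i) = z i := hG.self_of_nhds.trans (hfz i)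
        have hGt : Tendsto G (𝓝 (z i)) (𝓝 (z i)) := by
          simpa [hGz] using G.continuous.tendsto (z i)
        filter_upwards [hG, hGt.eventually (hF' i ha)] with w h1 h2
        rw [Homeomorph.trans_apply, h2, h1]
      · filter_upwards [hGj i (ne_of_mem_of_not_mem hi ha), hF i hi] with w h1 h2
        rw [Homeomorph.trans_apply, h1, h2]
    · rw [Finset.mem_insert, not_or] at hi
      filter_upwards [hGj i hi.1, hF' i hi.2] with w h1 h2
      rw [Homeomorph.trans_apply, h1, h2]


/-- Gluing germs with nonzero derivative by a global homeomorphism: finitely many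
holomorphic germs `f_i` fixing distinct points `z_i` with `f_i'(z_i) = λ_i ≠ 0`
agree, on small disks around the `z_i`, with a single homeomorphism of `ℂ`. -/
theorem glue_germs_nonzero_derivative (k : ℕ) (z : Fin k → ℂ)
    (hz : Function.Injective z)
    (ρ : Fin k → ℝ) (hρ : ∀ i, 0 < ρ i)
    (f : Fin k → ℂ → ℂ) (lam : Fin k → ℂ) (hlam : ∀ i, lam i ≠ 0)
    (hfd : ∀ i, DifferentiableOn ℂ (f i) (Metric.ball (z i) (ρ i)))
    (hfinj : ∀ i, Set.InjOn (f i) (Metric.ball (z i) (ρ i)))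
    (hfix : ∀ i, f i (z i) = z i)
    (hder : ∀ i, deriv (f i) (z i) = lam i) :
    ∃ s : ℝ, 0 < s ∧ (∀ i, s ≤ ρ i) ∧
      ∃ F : ℂ ≃ₜ ℂ, ∀ i, ∀ w ∈ Metric.ball (z i) s, F w = f i w := by
  have hs : ∀ i, HasStrictDerivAt (f i) (lam i) (z i) := fun i => by
    have h := ((hfd i).analyticAt (ball_mem_nhds (z i) (hρ i))).hasStrictDerivAt
    rwa [hder i] at h
  obtain ⟨F, hF⟩ := exists_homeomorph_eventuallyEq hz hs hfix hlam
  have h : ∀ᶠ s : ℝ in 𝓝[>] 0, ∀ i, s ≤ ρ i ∧ ∀ w ∈ ball (z i) s, F w = f i w := by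
    refine eventually_all.2 fun i => ?_
    obtain ⟨δ, hδ, hb⟩ := Metric.eventually_nhds_iff_ball.1 (hF i)
    filter_upwards [mem_nhdsWithin_of_mem_nhds (Iio_mem_nhds (hρ i)),
      mem_nhdsWithin_of_mem_nhds (Iio_mem_nhds hδ)] with s h1 h2
    exact ⟨le_of_lt h1, fun w hw => hb w (ball_subset_ball (le_of_lt h2) hw)⟩
  obtain ⟨s, hs0, hsi⟩ := ((eventually_mem_nhdsWithin (α := ℝ)).and h).exists
  exact ⟨s, hs0, fun i => (hsi i).1, F, fun i => (hsi i).2⟩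
end
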